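/- arXiv:1105.0127 — 4 statements merged into one kernel-verified Lean document; each statement's English description precedes it below -/
import Mathlib

section
/- The localization A[λ_∅^{-1}] of A at the coordinate λ₀ = λ_∅ (the affine chart of the cone over X where the Λ⁰-component is invertible) is isomorphic as a ℂ-algebra to ℂ[u,u^{-1}] ⊗_ℂ ℂ[x₁,…,x₁₅] ⊗_ℂ B, where ℂ[u,u^{-1}] is the Laurent polynomial ring in one variable, ℂ[x₁,…,x₁₅] is a polynomial ring in 15 variables, and B = ℂ[u_{ij} : 1≤i<j≤5]/(P₁,…,P₅) is the Pfaffian (Plücker) algebra of Gr(2,5). -/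
set_option synthInstance.maxHeartbeats 1000000
set_option maxHeartbeats 2000000

noncomputable section

/-- The polynomial ring `R` over `ℂ` in the 32 variables `λ_S`, `S ⊆ {1,…,5}`. -/
abbrev R32 : Type := MvPolynomial (Finset (Fin 5)) ℂ

/-- The exterior algebra `Λ(V) ⊗ R` of `V = ℂ⁵` with polynomial coefficients. -/
abbrev Ext5 : Type := ExteriorAlgebra R32 (Fin 5 → R32)

/-- The basis wedge monomial `e_S = e_{s₁} ∧ ⋯ ∧ e_{s_k}` for `S = {s₁ < ⋯ < s_k}`. -/
def eS (S : Finset (Fin 5)) : Ext5 :=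
  ((S.sort (· ≤ ·)).map fun s => ExteriorAlgebra.ι R32 (Pi.single s 1)).prod

/-- The degree-`k` component `λ_k = Σ_{|S| = k} λ_S e_S` of the generic spinor. -/
def lamb (k : ℕ) : Ext5 :=
  ∑ S ∈ Finset.univ.filter (fun S : Finset (Fin 5) => S.card = k),
    (MvPolynomial.X S : R32) • eS S

/-- Contraction `ι_r` with the `r`-th dual basis vector. -/
def ctr (r : Fin 5) : Ext5 →ₗ[R32] Ext5 :=
  CliffordAlgebra.contractLeft (Q := (0 : QuadraticForm R32 (Fin 5 → R32))) (LinearMap.proj r)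

/-- Equation (E1): `λ₀λ₅ + λ₁∧λ₄ − λ₂∧λ₃ = 0` in `Λ⁵V`. -/
def E1 : Ext5 := (MvPolynomial.X ∅ : R32) • lamb 5 + lamb 1 * lamb 4 - lamb 2 * lamb 3

/-- Equation (E2): `−2λ₀λ₄ − 2λ₁∧λ₃ + λ₂∧λ₂ = 0` in `Λ⁴V`. -/
def E2 : Ext5 :=
  -(2 • ((MvPolynomial.X ∅ : R32) • lamb 4)) - 2 • (lamb 1 * lamb 3) + lamb 2 * lamb 2

/-- Equation (E3): `−2ι_r(λ₁)λ₅ + 2ι_r(λ₂)∧λ₄ + ι_r(λ₃)∧λ₃ = 0` in `Λ⁵V`, `r = 1,…,5`. -/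
def E3 (r : Fin 5) : Ext5 :=
  -(2 • (ctr r (lamb 1) * lamb 5)) + 2 • (ctr r (lamb 2) * lamb 4) + ctr r (lamb 3) * lamb 3

/-- The ideal `I ⊆ R` generated by the 11 coefficients of the expressions (E1), (E2), (E3):
equivalently, the smallest ideal `J` such that each of the expressions lies in the submodule
`J • Λ(V)` of the (free) `R`-module `Λ(V) ⊗ R`. -/
def Igrav : Ideal R32 :=
  sInf {J : Ideal R32 |
    E1 ∈ J • (⊤ : Submodule R32 Ext5) ∧ E2 ∈ J • (⊤ : Submodule R32 Ext5) ∧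
    ∀ r : Fin 5, E3 r ∈ J • (⊤ : Submodule R32 Ext5)}

/-- `A = R/I`, the homogeneous coordinate ring of the space of gravitational spinors. -/
abbrev Aq : Type := R32 ⧸ Igrav

/-- The image of the coordinate `λ₀ = λ_∅` in `A`. -/
def lam0 : Aq := Ideal.Quotient.mk Igrav (MvPolynomial.X ∅)

/-- The polynomial ring `ℂ[u_{ij} : 1 ≤ i < j ≤ 5]` in ten variables. -/
abbrev PR : Type := MvPolynomial {p : Fin 5 × Fin 5 // p.1 < p.2} ℂ

/-- The full skew-symmetric matrix of variables. -/
def U (i j : Fin 5) : PR :=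
  if h : i < j then MvPolynomial.X ⟨(i, j), h⟩
  else if h : j < i then -MvPolynomial.X ⟨(j, i), h⟩
  else 0

/-- The Pfaffian of the 4×4 skew submatrix obtained by deleting row and column `k`. -/
def Pf (k : Fin 5) : PR :=
  U (k.succAbove 0) (k.succAbove 1) * U (k.succAbove 2) (k.succAbove 3) -
    U (k.succAbove 0) (k.succAbove 2) * U (k.succAbove 1) (k.succAbove 3) +
    U (k.succAbove 0) (k.succAbove 3) * U (k.succAbove 1) (k.succAbove 2)

/-- The homogeneous coordinate ring `B = ℂ[u_{ij}]/(P₁,…,P₅)` of `Gr(2,5) ⊂ ℙ⁹`. -/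
abbrev Bring : Type := PR ⧸ Ideal.span (Set.range Pf)

open scoped TensorProduct
/-- The coefficient of (E1) at a point `y`. -/
def g1 {K : Type*} [CommRing K] (y : Finset (Fin 5) → K) : K :=
  y ∅ * y {0, 1, 2, 3, 4} + y {0} * y {1, 2, 3, 4} - y {1} * y {0, 2, 3, 4}
    + y {2} * y {0, 1, 3, 4} - y {3} * y {0, 1, 2, 4} + y {4} * y {0, 1, 2, 3}
    - y {0, 1} * y {2, 3, 4} + y {0, 2} * y {1, 3, 4} - y {0, 3} * y {1, 2, 4}
    + y {0, 4} * y {1, 2, 3} - y {1, 2} * y {0, 3, 4} + y {1, 3} * y {0, 2, 4}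
    - y {1, 4} * y {0, 2, 3} - y {2, 3} * y {0, 1, 4} + y {2, 4} * y {0, 1, 3}
    - y {3, 4} * y {0, 1, 2}

/-- The coefficients of (E2); entry `k` is that of `e_{hat k}`. -/
def g2 {K : Type*} [CommRing K] (y : Finset (Fin 5) → K) : Fin 5 → K := ![
  -2 * y ∅ * y {1, 2, 3, 4} - 2 * y {1} * y {2, 3, 4} + 2 * y {2} * y {1, 3, 4}
    - 2 * y {3} * y {1, 2, 4} + 2 * y {4} * y {1, 2, 3} + 2 * y {1, 2} * y {3, 4}
    - 2 * y {1, 3} * y {2, 4} + 2 * y {1, 4} * y {2, 3},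
  -2 * y ∅ * y {0, 2, 3, 4} - 2 * y {0} * y {2, 3, 4} + 2 * y {2} * y {0, 3, 4}
    - 2 * y {3} * y {0, 2, 4} + 2 * y {4} * y {0, 2, 3} + 2 * y {0, 2} * y {3, 4}
    - 2 * y {0, 3} * y {2, 4} + 2 * y {0, 4} * y {2, 3},
  -2 * y ∅ * y {0, 1, 3, 4} - 2 * y {0} * y {1, 3, 4} + 2 * y {1} * y {0, 3, 4}
    - 2 * y {3} * y {0, 1, 4} + 2 * y {4} * y {0, 1, 3} + 2 * y {0, 1} * y {3, 4}
    - 2 * y {0, 3} * y {1, 4} + 2 * y {0, 4} * y {1, 3},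
  -2 * y ∅ * y {0, 1, 2, 4} - 2 * y {0} * y {1, 2, 4} + 2 * y {1} * y {0, 2, 4}
    - 2 * y {2} * y {0, 1, 4} + 2 * y {4} * y {0, 1, 2} + 2 * y {0, 1} * y {2, 4}
    - 2 * y {0, 2} * y {1, 4} + 2 * y {0, 4} * y {1, 2},
  -2 * y ∅ * y {0, 1, 2, 3} - 2 * y {0} * y {1, 2, 3} + 2 * y {1} * y {0, 2, 3}
    - 2 * y {2} * y {0, 1, 3} + 2 * y {3} * y {0, 1, 2} + 2 * y {0, 1} * y {2, 3}
    - 2 * y {0, 2} * y {1, 3} + 2 * y {0, 3} * y {1, 2}]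

/-- The coefficients of (E3) for `r = 0, …, 4`. -/
def g3 {K : Type*} [CommRing K] (y : Finset (Fin 5) → K) : Fin 5 → K := ![
  -2 * y {0} * y {0, 1, 2, 3, 4} - 2 * y {0, 1} * y {0, 2, 3, 4}
    + 2 * y {0, 2} * y {0, 1, 3, 4} - 2 * y {0, 3} * y {0, 1, 2, 4}
    + 2 * y {0, 4} * y {0, 1, 2, 3} + 2 * y {0, 1, 2} * y {0, 3, 4}
    - 2 * y {0, 1, 3} * y {0, 2, 4} + 2 * y {0, 1, 4} * y {0, 2, 3},
  -2 * y {1} * y {0, 1, 2, 3, 4} - 2 * y {0, 1} * y {1, 2, 3, 4}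
    + 2 * y {1, 2} * y {0, 1, 3, 4} - 2 * y {1, 3} * y {0, 1, 2, 4}
    + 2 * y {1, 4} * y {0, 1, 2, 3} + 2 * y {0, 1, 2} * y {1, 3, 4}
    - 2 * y {0, 1, 3} * y {1, 2, 4} + 2 * y {0, 1, 4} * y {1, 2, 3},
  -2 * y {2} * y {0, 1, 2, 3, 4} - 2 * y {0, 2} * y {1, 2, 3, 4}
    + 2 * y {1, 2} * y {0, 2, 3, 4} - 2 * y {2, 3} * y {0, 1, 2, 4}
    + 2 * y {2, 4} * y {0, 1, 2, 3} + 2 * y {0, 1, 2} * y {2, 3, 4}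
    - 2 * y {0, 2, 3} * y {1, 2, 4} + 2 * y {0, 2, 4} * y {1, 2, 3},
  -2 * y {3} * y {0, 1, 2, 3, 4} - 2 * y {0, 3} * y {1, 2, 3, 4}
    + 2 * y {1, 3} * y {0, 2, 3, 4} - 2 * y {2, 3} * y {0, 1, 3, 4}
    + 2 * y {3, 4} * y {0, 1, 2, 3} + 2 * y {0, 1, 3} * y {2, 3, 4}
    - 2 * y {0, 2, 3} * y {1, 3, 4} + 2 * y {0, 3, 4} * y {1, 2, 3},
  -2 * y {4} * y {0, 1, 2, 3, 4} - 2 * y {0, 4} * y {1, 2, 3, 4}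
    + 2 * y {1, 4} * y {0, 2, 3, 4} - 2 * y {2, 4} * y {0, 1, 3, 4}
    + 2 * y {3, 4} * y {0, 1, 2, 4} + 2 * y {0, 1, 4} * y {2, 3, 4}
    - 2 * y {0, 2, 4} * y {1, 3, 4} + 2 * y {0, 3, 4} * y {1, 2, 4}]

/-- Degree-1 part of the spinor, written out. -/
def gl1 {K W : Type*} [CommRing K] [Ring W] [Algebra K W]
    (y : Finset (Fin 5) → K) (e : Fin 5 → W) : W :=
  y {0} • e 0 + y {1} • e 1 + y {2} • e 2 + y {3} • e 3 + y {4} • e 4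

/-- Degree-2 part of the spinor, written out. -/
def gl2 {K W : Type*} [CommRing K] [Ring W] [Algebra K W]
    (y : Finset (Fin 5) → K) (e : Fin 5 → W) : W :=
  y {0, 1} • (e 0 * e 1) + y {0, 2} • (e 0 * e 2) + y {0, 3} • (e 0 * e 3)
    + y {0, 4} • (e 0 * e 4) + y {1, 2} • (e 1 * e 2) + y {1, 3} • (e 1 * e 3)
    + y {1, 4} • (e 1 * e 4) + y {2, 3} • (e 2 * e 3) + y {2, 4} • (e 2 * e 4)
    + y {3, 4} • (e 3 * e 4)

/-- Degree-3 part of the spinor, written out. -/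
def gl3 {K W : Type*} [CommRing K] [Ring W] [Algebra K W]
    (y : Finset (Fin 5) → K) (e : Fin 5 → W) : W :=
  y {0, 1, 2} • (e 0 * e 1 * e 2) + y {0, 1, 3} • (e 0 * e 1 * e 3)
    + y {0, 1, 4} • (e 0 * e 1 * e 4) + y {0, 2, 3} • (e 0 * e 2 * e 3)
    + y {0, 2, 4} • (e 0 * e 2 * e 4) + y {0, 3, 4} • (e 0 * e 3 * e 4)
    + y {1, 2, 3} • (e 1 * e 2 * e 3) + y {1, 2, 4} • (e 1 * e 2 * e 4)
    + y {1, 3, 4} • (e 1 * e 3 * e 4) + y {2, 3, 4} • (e 2 * e 3 * e 4)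

/-- Degree-4 part of the spinor, written out. -/
def gl4 {K W : Type*} [CommRing K] [Ring W] [Algebra K W]
    (y : Finset (Fin 5) → K) (e : Fin 5 → W) : W :=
  y {0, 1, 2, 3} • (e 0 * e 1 * e 2 * e 3) + y {0, 1, 2, 4} • (e 0 * e 1 * e 2 * e 4)
    + y {0, 1, 3, 4} • (e 0 * e 1 * e 3 * e 4) + y {0, 2, 3, 4} • (e 0 * e 2 * e 3 * e 4)
    + y {1, 2, 3, 4} • (e 1 * e 2 * e 3 * e 4)

/-- Degree-5 part of the spinor, written out. -/
def gl5 {K W : Type*} [CommRing K] [Ring W] [Algebra K W]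
    (y : Finset (Fin 5) → K) (e : Fin 5 → W) : W :=
  y {0, 1, 2, 3, 4} • (e 0 * e 1 * e 2 * e 3 * e 4)

theorem wedge_E1 {K W : Type*} [CommRing K] [Ring W] [Algebra K W]
    (y : Finset (Fin 5) → K) (e : Fin 5 → W) (h0 : ∀ i, e i * e i = 0)
    (h1 : ∀ i j, j < i → e i * e j = -(e j * e i)) :
    y ∅ • gl5 y e + gl1 y e * gl4 y e - gl2 y e * gl3 y e =
      g1 y • (e 0 * e 1 * e 2 * e 3 * e 4) := by
  have h0' : ∀ i x, e i * (e i * x) = 0 := fun i x => by rw [← mul_assoc, h0, zero_mul]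
  have h1' : ∀ i j x, j < i → e i * (e j * x) = -(e j * (e i * x)) := fun i j x h => by
    rw [← mul_assoc, h1 i j h, neg_mul, mul_assoc]
  simp only [gl1, gl2, gl3, gl4, gl5, mul_add, add_mul, smul_mul_assoc, mul_smul_comm, mul_assoc]
  simp only [h0, h0', h1, h1', mul_neg, neg_neg, mul_zero, smul_zero, Fin.reduceLT, smul_neg,
    add_zero, zero_add, neg_zero]
  simp only [g1]
  module

theorem wedge_E2 {K W : Type*} [CommRing K] [Ring W] [Algebra K W]
    (y : Finset (Fin 5) → K) (e : Fin 5 → W) (h0 : ∀ i, e i * e i = 0)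
    (h1 : ∀ i j, j < i → e i * e j = -(e j * e i)) :
    -(2 • (y ∅ • gl4 y e)) - 2 • (gl1 y e * gl3 y e) + gl2 y e * gl2 y e =
      g2 y 0 • (e 1 * e 2 * e 3 * e 4) + g2 y 1 • (e 0 * e 2 * e 3 * e 4) +
      g2 y 2 • (e 0 * e 1 * e 3 * e 4) + g2 y 3 • (e 0 * e 1 * e 2 * e 4) +
      g2 y 4 • (e 0 * e 1 * e 2 * e 3) := by
  have h0' : ∀ i x, e i * (e i * x) = 0 := fun i x => by rw [← mul_assoc, h0, zero_mul]
  have h1' : ∀ i j x, j < i → e i * (e j * x) = -(e j * (e i * x)) := fun i j x h => by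
    rw [← mul_assoc, h1 i j h, neg_mul, mul_assoc]
  simp only [gl1, gl2, gl3, gl4, mul_add, add_mul, smul_mul_assoc, mul_smul_comm, mul_assoc]
  simp only [h0, h0', h1, h1', mul_neg, neg_neg, mul_zero, smul_zero, Fin.reduceLT, smul_neg,
    add_zero, zero_add, neg_zero]
  simp only [g2, Matrix.cons_val]
  module

theorem wedge_E3 {K W : Type*} [CommRing K] [Ring W] [Algebra K W]
    (y : Finset (Fin 5) → K) (e : Fin 5 → W) (h0 : ∀ i, e i * e i = 0)
    (h1 : ∀ i j, j < i → e i * e j = -(e j * e i)) (r : Fin 5) (c : W →ₗ[K] W)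
    (hc : ∀ i, c (e i) = if i = r then 1 else 0)
    (hc' : ∀ i x, c (e i * x) = (if i = r then x else 0) - e i * c x) :
    -(2 • (c (gl1 y e) * gl5 y e)) + 2 • (c (gl2 y e) * gl4 y e) + c (gl3 y e) * gl3 y e =
      g3 y r • (e 0 * e 1 * e 2 * e 3 * e 4) := by
  have h0' : ∀ i x, e i * (e i * x) = 0 := fun i x => by rw [← mul_assoc, h0, zero_mul]
  have h1' : ∀ i j x, j < i → e i * (e j * x) = -(e j * (e i * x)) := fun i j x h => by
    rw [← mul_assoc, h1 i j h, neg_mul, mul_assoc]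
  fin_cases r <;>
  · simp only [gl1, gl2, gl3, gl4, gl5, map_add, map_smul, mul_assoc]
    simp only [hc, hc', Fin.zero_eta, Fin.mk_one, Fin.reduceFinMk, Fin.reduceEq, if_true, if_false,
      mul_zero, mul_one, sub_zero, zero_sub, mul_neg, smul_zero, add_zero, zero_add, neg_neg,
      neg_zero, Fin.isValue]
    simp only [mul_add, add_mul, smul_mul_assoc, mul_smul_comm, mul_assoc, mul_sub, sub_mul,
      neg_mul, one_mul, smul_neg, smul_add, smul_sub]
    simp only [h0, h0', h1, h1', mul_neg, neg_neg, mul_zero, smul_zero, Fin.reduceLT, smul_neg,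
      add_zero, zero_add, neg_zero, Fin.isValue]
    simp only [g3, Matrix.cons_val, Fin.isValue]
    module

/-! ### The ideal `Igrav` is generated by the eleven polynomials -/

/-- The basis vectors inside the exterior algebra. -/
def ee (i : Fin 5) : Ext5 := ExteriorAlgebra.ι R32 (Pi.single i 1)

theorem ee_sq (i : Fin 5) : ee i * ee i = 0 := ExteriorAlgebra.ι_sq_zero _

theorem ee_anti (i j : Fin 5) (_ : j < i) : ee i * ee j = -(ee j * ee i) :=
  eq_neg_of_add_eq_zero_left (ExteriorAlgebra.ι_add_mul_swap _ _)

theorem eS_empty : eS ∅ = 1 := by simp [eS]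

theorem eS_insert (a : Fin 5) (S : Finset (Fin 5)) (h : ∀ b ∈ S, a < b) :
    eS (insert a S) = ee a * eS S := by
  have h2 : a ∉ S := fun h' => lt_irrefl _ (h a h')
  rw [eS, Finset.sort_insert _ (fun b hb => (h b hb).le) h2]
  simp [eS, ee]

theorem eS_singleton (a : Fin 5) : eS {a} = ee a := by
  rw [← insert_empty_eq, eS_insert a ∅ (by simp), eS_empty, mul_one]

theorem ctr_ee (r i : Fin 5) : ctr r (ee i) = if i = r then 1 else 0 := by
  have h := CliffordAlgebra.contractLeft_ι (Q := (0 : QuadraticForm R32 (Fin 5 → R32)))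
    (LinearMap.proj r) (Pi.single i 1)
  refine h.trans ?_
  by_cases hr : i = r
  · subst hr; simp
  · simp [hr, Pi.single_apply, Ne.symm hr]

theorem ctr_ee_mul (r i : Fin 5) (x : Ext5) :
    ctr r (ee i * x) = (if i = r then x else 0) - ee i * ctr r x := by
  have h := CliffordAlgebra.contractLeft_ι_mul (Q := (0 : QuadraticForm R32 (Fin 5 → R32)))
    (d := LinearMap.proj r) (Pi.single i 1) x
  refine h.trans ?_
  by_cases hr : i = r
  · subst hr; simp; rfl
  · simp [hr, Pi.single_apply, Ne.symm hr]; rfl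

theorem lamb_one : lamb 1 = gl1 (MvPolynomial.X : _ → R32) ee := by
  have : Finset.univ.filter (fun S : Finset (Fin 5) => S.card = 1) =
      {{0}, {1}, {2}, {3}, {4}} := by decide
  rw [lamb, this]
  repeat rw [Finset.sum_insert (by decide)]
  rw [Finset.sum_singleton]
  simp only [eS_singleton, gl1]
  abel

theorem lamb_two : lamb 2 = gl2 (MvPolynomial.X : _ → R32) ee := by
  have : Finset.univ.filter (fun S : Finset (Fin 5) => S.card = 2) =
      {{0, 1}, {0, 2}, {0, 3}, {0, 4}, {1, 2}, {1, 3}, {1, 4}, {2, 3}, {2, 4}, {3, 4}} := by decide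
  rw [lamb, this]
  repeat rw [Finset.sum_insert (by decide)]
  rw [Finset.sum_singleton]
  repeat rw [eS_insert _ _ (by decide)]
  simp only [eS_singleton, gl2]
  abel

theorem lamb_three : lamb 3 = gl3 (MvPolynomial.X : _ → R32) ee := by
  have : Finset.univ.filter (fun S : Finset (Fin 5) => S.card = 3) =
      {{0, 1, 2}, {0, 1, 3}, {0, 1, 4}, {0, 2, 3}, {0, 2, 4}, {0, 3, 4}, {1, 2, 3}, {1, 2, 4},
        {1, 3, 4}, {2, 3, 4}} := by decide
  rw [lamb, this]
  repeat rw [Finset.sum_insert (by decide)]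
  rw [Finset.sum_singleton]
  repeat rw [eS_insert _ _ (by decide)]
  simp only [eS_singleton, gl3, mul_assoc]
  abel

theorem lamb_four : lamb 4 = gl4 (MvPolynomial.X : _ → R32) ee := by
  have : Finset.univ.filter (fun S : Finset (Fin 5) => S.card = 4) =
      {{0, 1, 2, 3}, {0, 1, 2, 4}, {0, 1, 3, 4}, {0, 2, 3, 4}, {1, 2, 3, 4}} := by decide
  rw [lamb, this]
  repeat rw [Finset.sum_insert (by decide)]
  rw [Finset.sum_singleton]
  repeat rw [eS_insert _ _ (by decide)]
  simp only [eS_singleton, gl4, mul_assoc]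
  abel

theorem lamb_five : lamb 5 = gl5 (MvPolynomial.X : _ → R32) ee := by
  have : Finset.univ.filter (fun S : Finset (Fin 5) => S.card = 5) =
      {{0, 1, 2, 3, 4}} := by decide
  rw [lamb, this, Finset.sum_singleton]
  repeat rw [eS_insert _ _ (by decide)]
  simp only [eS_singleton, gl5, mul_assoc]

theorem E1_eq : E1 = g1 (MvPolynomial.X : _ → R32) • (ee 0 * ee 1 * ee 2 * ee 3 * ee 4) := by
  rw [E1, lamb_one, lamb_two, lamb_three, lamb_four, lamb_five]
  exact wedge_E1 _ ee ee_sq ee_anti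

theorem E2_eq : E2 =
    g2 (MvPolynomial.X : _ → R32) 0 • (ee 1 * ee 2 * ee 3 * ee 4) +
    g2 (MvPolynomial.X : _ → R32) 1 • (ee 0 * ee 2 * ee 3 * ee 4) +
    g2 (MvPolynomial.X : _ → R32) 2 • (ee 0 * ee 1 * ee 3 * ee 4) +
    g2 (MvPolynomial.X : _ → R32) 3 • (ee 0 * ee 1 * ee 2 * ee 4) +
    g2 (MvPolynomial.X : _ → R32) 4 • (ee 0 * ee 1 * ee 2 * ee 3) := by
  rw [E2, lamb_one, lamb_two, lamb_three, lamb_four]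
  exact wedge_E2 _ ee ee_sq ee_anti

theorem E3_eq (r : Fin 5) :
    E3 r = g3 (MvPolynomial.X : _ → R32) r • (ee 0 * ee 1 * ee 2 * ee 3 * ee 4) := by
  rw [E3, lamb_one, lamb_two, lamb_three, lamb_four, lamb_five]
  exact wedge_E3 _ ee ee_sq ee_anti r (ctr r) (ctr_ee r) (ctr_ee_mul r)

/-- Coordinate functional of a four-form obtained by iterated contraction. -/
def co4 (a b c d : Fin 5) : Ext5 →ₗ[R32] R32 :=
  ExteriorAlgebra.algebraMapInv.toLinearMap ∘ₗ ctr d ∘ₗ ctr c ∘ₗ ctr b ∘ₗ ctr a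

/-- Coordinate functional of the top form. -/
def co5 : Ext5 →ₗ[R32] R32 := co4 1 2 3 4 ∘ₗ ctr 0

theorem co5_top : co5 (ee 0 * ee 1 * ee 2 * ee 3 * ee 4) = 1 := by
  simp [co5, co4, mul_assoc, ctr_ee, ctr_ee_mul]

theorem map_mem_of_mem_smul {K M : Type*} [CommRing K] [AddCommGroup M] [Module K M]
    (J : Ideal K) (f : M →ₗ[K] K) (z : M)
    (hz : z ∈ J • (⊤ : Submodule K M)) : f z ∈ J := by
  refine Submodule.smul_induction_on hz (fun r hr n _ => ?_) (fun x y hx hy => ?_)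
  · rw [map_smul, smul_eq_mul]
    exact Ideal.mul_mem_right _ _ hr
  · rw [map_add]
    exact add_mem hx hy

theorem coeffs_mem (J : Ideal R32) (h1 : E1 ∈ J • (⊤ : Submodule R32 Ext5))
    (h2 : E2 ∈ J • (⊤ : Submodule R32 Ext5))
    (h3 : ∀ r : Fin 5, E3 r ∈ J • (⊤ : Submodule R32 Ext5)) :
    g1 (MvPolynomial.X : _ → R32) ∈ J ∧ (∀ k, g2 (MvPolynomial.X : _ → R32) k ∈ J) ∧
      ∀ k, g3 (MvPolynomial.X : _ → R32) k ∈ J := by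
  refine ⟨?_, ?_, ?_⟩
  · simpa [E1_eq, co5_top] using map_mem_of_mem_smul J co5 _ h1
  · have h0' := map_mem_of_mem_smul J (co4 1 2 3 4) _ h2
    have h1' := map_mem_of_mem_smul J (co4 0 2 3 4) _ h2
    have h2' := map_mem_of_mem_smul J (co4 0 1 3 4) _ h2
    have h3' := map_mem_of_mem_smul J (co4 0 1 2 4) _ h2
    have h4' := map_mem_of_mem_smul J (co4 0 1 2 3) _ h2
    rw [E2_eq] at h0' h1' h2' h3' h4'
    generalize (g2 (MvPolynomial.X : _ → R32)) = q at *
    simp [co4, mul_assoc, ctr_ee, ctr_ee_mul] at h0' h1' h2' h3' h4'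
    intro k
    fin_cases k <;> assumption
  · intro r
    simpa [E3_eq, co5_top] using map_mem_of_mem_smul J co5 _ (h3 r)

theorem g1_mem : g1 (MvPolynomial.X : _ → R32) ∈ Igrav := by
  rw [Igrav, Submodule.mem_sInf]
  rintro J ⟨h1, h2, h3⟩
  exact (coeffs_mem J h1 h2 h3).1

theorem g2_mem (k : Fin 5) : g2 (MvPolynomial.X : _ → R32) k ∈ Igrav := by
  rw [Igrav, Submodule.mem_sInf]
  rintro J ⟨h1, h2, h3⟩
  exact (coeffs_mem J h1 h2 h3).2.1 k

theorem g3_mem (k : Fin 5) : g3 (MvPolynomial.X : _ → R32) k ∈ Igrav := by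
  rw [Igrav, Submodule.mem_sInf]
  rintro J ⟨h1, h2, h3⟩
  exact (coeffs_mem J h1 h2 h3).2.2 k

theorem Igrav_le (J : Ideal R32) (h1 : g1 (MvPolynomial.X : _ → R32) ∈ J)
    (h2 : ∀ k, g2 (MvPolynomial.X : _ → R32) k ∈ J)
    (h3 : ∀ k, g3 (MvPolynomial.X : _ → R32) k ∈ J) : Igrav ≤ J := by
  refine sInf_le ⟨?_, ?_, fun r => ?_⟩
  · rw [E1_eq]
    exact Submodule.smul_mem_smul h1 trivial
  · rw [E2_eq]
    exact add_mem (add_mem (add_mem (add_mem (Submodule.smul_mem_smul (h2 0) trivial)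
      (Submodule.smul_mem_smul (h2 1) trivial)) (Submodule.smul_mem_smul (h2 2) trivial))
      (Submodule.smul_mem_smul (h2 3) trivial)) (Submodule.smul_mem_smul (h2 4) trivial)
  · rw [E3_eq]
    exact Submodule.smul_mem_smul (h3 r) trivial

/-! ### The chart -/

/-- Chart formula for the degree-three components. -/
def tri {K : Type*} [CommRing K] (v : K) (x : Fin 15 → K)
    (w : {p : Fin 5 × Fin 5 // p.1 < p.2} → K) : Fin 10 → K := ![
  w ⟨(3, 4), by decide⟩ + v * (x 0 * x 9 - x 1 * x 6 + x 2 * x 5),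
  w ⟨(2, 4), by decide⟩ + v * (x 0 * x 10 - x 1 * x 7 + x 3 * x 5),
  w ⟨(2, 3), by decide⟩ + v * (x 0 * x 11 - x 1 * x 8 + x 4 * x 5),
  w ⟨(1, 4), by decide⟩ + v * (x 0 * x 12 - x 2 * x 7 + x 3 * x 6),
  w ⟨(1, 3), by decide⟩ + v * (x 0 * x 13 - x 2 * x 8 + x 4 * x 6),
  w ⟨(1, 2), by decide⟩ + v * (x 0 * x 14 - x 3 * x 8 + x 4 * x 7),
  w ⟨(0, 4), by decide⟩ + v * (x 1 * x 12 - x 2 * x 10 + x 3 * x 9),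
  w ⟨(0, 3), by decide⟩ + v * (x 1 * x 13 - x 2 * x 11 + x 4 * x 9),
  w ⟨(0, 2), by decide⟩ + v * (x 1 * x 14 - x 3 * x 11 + x 4 * x 10),
  w ⟨(0, 1), by decide⟩ + v * (x 2 * x 14 - x 3 * x 13 + x 4 * x 12)]

/-- Chart formula for the degree-four components (entry `k` omits index `k`). -/
def quad {K : Type*} [CommRing K] (v : K) (x : Fin 15 → K) (t : Fin 10 → K) : Fin 5 → K := ![
  v * (-x 1 * t 9 + x 2 * t 8 - x 3 * t 7 + x 4 * t 6 + x 9 * x 14 - x 10 * x 13 + x 11 * x 12),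
  v * (-x 0 * t 9 + x 2 * t 5 - x 3 * t 4 + x 4 * t 3 + x 6 * x 14 - x 7 * x 13 + x 8 * x 12),
  v * (-x 0 * t 8 + x 1 * t 5 - x 3 * t 2 + x 4 * t 1 + x 5 * x 14 - x 7 * x 11 + x 8 * x 10),
  v * (-x 0 * t 7 + x 1 * t 4 - x 2 * t 2 + x 4 * t 0 + x 5 * x 13 - x 6 * x 11 + x 8 * x 9),
  v * (-x 0 * t 6 + x 1 * t 3 - x 2 * t 1 + x 3 * t 0 + x 5 * x 12 - x 6 * x 10 + x 7 * x 9)]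

/-- Chart formula for the degree-five component. -/
def topc {K : Type*} [CommRing K] (v : K) (x : Fin 15 → K) (t : Fin 10 → K) (q : Fin 5 → K) : K :=
  v * (x 5 * t 9 - x 6 * t 8 + x 7 * t 7 - x 8 * t 6 + x 9 * t 5 - x 10 * t 4 + x 11 * t 3
    + x 12 * t 2 - x 13 * t 1 + x 14 * t 0 - x 0 * q 0 + x 1 * q 1 - x 2 * q 2 + x 3 * q 3
    - x 4 * q 4)

/-- The spinor with given chart coordinates. -/
def chart {K : Type*} [CommRing K] (u v : K) (x : Fin 15 → K)
    (w : {p : Fin 5 × Fin 5 // p.1 < p.2} → K) (S : Finset (Fin 5)) : K :=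
  match decide (0 ∈ S), decide (1 ∈ S), decide (2 ∈ S), decide (3 ∈ S), decide (4 ∈ S) with
  | false, false, false, false, false => u
  | true, false, false, false, false => x 0
  | false, true, false, false, false => x 1
  | false, false, true, false, false => x 2
  | false, false, false, true, false => x 3
  | false, false, false, false, true => x 4
  | true, true, false, false, false => x 5
  | true, false, true, false, false => x 6
  | true, false, false, true, false => x 7
  | true, false, false, false, true => x 8
  | false, true, true, false, false => x 9
  | false, true, false, true, false => x 10
  | false, true, false, false, true => x 11
  | false, false, true, true, false => x 12
  | false, false, true, false, true => x 13
  | false, false, false, true, true => x 14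
  | true, true, true, false, false => tri v x w 0
  | true, true, false, true, false => tri v x w 1
  | true, true, false, false, true => tri v x w 2
  | true, false, true, true, false => tri v x w 3
  | true, false, true, false, true => tri v x w 4
  | true, false, false, true, true => tri v x w 5
  | false, true, true, true, false => tri v x w 6
  | false, true, true, false, true => tri v x w 7
  | false, true, false, true, true => tri v x w 8
  | false, false, true, true, true => tri v x w 9
  | true, true, true, true, false => quad v x (tri v x w) 4
  | true, true, true, false, true => quad v x (tri v x w) 3
  | true, true, false, true, true => quad v x (tri v x w) 2
  | true, false, true, true, true => quad v x (tri v x w) 1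
  | false, true, true, true, true => quad v x (tri v x w) 0
  | true, true, true, true, true => topc v x (tri v x w) (quad v x (tri v x w))

/-- The coordinates of degrees one and two of a spinor. -/
def lowc {K : Type*} (y : Finset (Fin 5) → K) : Fin 15 → K :=
  ![y {0}, y {1}, y {2}, y {3}, y {4}, y {0, 1}, y {0, 2}, y {0, 3}, y {0, 4}, y {1, 2},
    y {1, 3}, y {1, 4}, y {2, 3}, y {2, 4}, y {3, 4}]

/-- The shifted degree-three coordinates, as an upper triangular matrix (by complement). -/
def mu {K : Type*} [CommRing K] (v : K) (y : Finset (Fin 5) → K) : Matrix (Fin 5) (Fin 5) K := !![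
  0,
  y {2, 3, 4} - v * (y {2} * y {3, 4} - y {3} * y {2, 4} + y {4} * y {2, 3}),
  y {1, 3, 4} - v * (y {1} * y {3, 4} - y {3} * y {1, 4} + y {4} * y {1, 3}),
  y {1, 2, 4} - v * (y {1} * y {2, 4} - y {2} * y {1, 4} + y {4} * y {1, 2}),
  y {1, 2, 3} - v * (y {1} * y {2, 3} - y {2} * y {1, 3} + y {3} * y {1, 2});
  0,
  0,
  y {0, 3, 4} - v * (y {0} * y {3, 4} - y {3} * y {0, 4} + y {4} * y {0, 3}),
  y {0, 2, 4} - v * (y {0} * y {2, 4} - y {2} * y {0, 4} + y {4} * y {0, 2}),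
  y {0, 2, 3} - v * (y {0} * y {2, 3} - y {2} * y {0, 3} + y {3} * y {0, 2});
  0,
  0,
  0,
  y {0, 1, 4} - v * (y {0} * y {1, 4} - y {1} * y {0, 4} + y {4} * y {0, 1}),
  y {0, 1, 3} - v * (y {0} * y {1, 3} - y {1} * y {0, 3} + y {3} * y {0, 1});
  0,
  0,
  0,
  0,
  y {0, 1, 2} - v * (y {0} * y {1, 2} - y {1} * y {0, 2} + y {2} * y {0, 1});
  0,
  0,
  0,
  0,
  0]

theorem forall_finset5 (p : Finset (Fin 5) → Prop)
    (h0 : p ∅) (h1 : p {0}) (h2 : p {1}) (h3 : p {2}) (h4 : p {3}) (h5 : p {4}) (h6 : p {0, 1})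
    (h7 : p {0, 2}) (h8 : p {0, 3}) (h9 : p {0, 4}) (h10 : p {1, 2}) (h11 : p {1, 3})
    (h12 : p {1, 4}) (h13 : p {2, 3}) (h14 : p {2, 4}) (h15 : p {3, 4}) (h16 : p {0, 1, 2})
    (h17 : p {0, 1, 3}) (h18 : p {0, 1, 4}) (h19 : p {0, 2, 3}) (h20 : p {0, 2, 4})
    (h21 : p {0, 3, 4}) (h22 : p {1, 2, 3}) (h23 : p {1, 2, 4}) (h24 : p {1, 3, 4})
    (h25 : p {2, 3, 4}) (h26 : p {0, 1, 2, 3}) (h27 : p {0, 1, 2, 4}) (h28 : p {0, 1, 3, 4})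
    (h29 : p {0, 2, 3, 4}) (h30 : p {1, 2, 3, 4}) (h31 : p {0, 1, 2, 3, 4}) :
    ∀ S, p S := by
  have h : ∀ S : Finset (Fin 5), S = ∅ ∨ S = {0} ∨ S = {1} ∨ S = {2} ∨ S = {3} ∨ S = {4} ∨
      S = {0, 1} ∨ S = {0, 2} ∨ S = {0, 3} ∨ S = {0, 4} ∨ S = {1, 2} ∨ S = {1, 3} ∨ S = {1, 4} ∨
      S = {2, 3} ∨ S = {2, 4} ∨ S = {3, 4} ∨ S = {0, 1, 2} ∨ S = {0, 1, 3} ∨ S = {0, 1, 4} ∨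
      S = {0, 2, 3} ∨ S = {0, 2, 4} ∨ S = {0, 3, 4} ∨ S = {1, 2, 3} ∨ S = {1, 2, 4} ∨
      S = {1, 3, 4} ∨ S = {2, 3, 4} ∨ S = {0, 1, 2, 3} ∨ S = {0, 1, 2, 4} ∨ S = {0, 1, 3, 4} ∨
      S = {0, 2, 3, 4} ∨ S = {1, 2, 3, 4} ∨ S = {0, 1, 2, 3, 4} := by decide
  intro S
  rcases h S with rfl | rfl | rfl | rfl | rfl | rfl | rfl | rfl | rfl | rfl | rfl | rfl | rfl |
    rfl | rfl | rfl | rfl | rfl | rfl | rfl | rfl | rfl | rfl | rfl | rfl | rfl | rfl | rfl | rfl |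
    rfl | rfl | rfl <;> assumption

theorem rel_quad {K : Type*} [CommRing K] (v : K) (y : Finset (Fin 5) → K)
    (h2 : ∀ a : K, 2 * a = 0 → a = 0) (hv : v * y ∅ = 1) (hg2 : ∀ k, g2 y k = 0)
    (t : Fin 10 → K)
    (ht : t = ![y {0, 1, 2}, y {0, 1, 3}, y {0, 1, 4}, y {0, 2, 3}, y {0, 2, 4}, y {0, 3, 4},
      y {1, 2, 3}, y {1, 2, 4}, y {1, 3, 4}, y {2, 3, 4}]) :
    quad v (lowc y) t = ![y {1, 2, 3, 4}, y {0, 2, 3, 4}, y {0, 1, 3, 4}, y {0, 1, 2, 4},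
      y {0, 1, 2, 3}] := by
  subst ht
  funext k
  have hk := hg2 k
  rw [← sub_eq_zero]
  apply h2
  fin_cases k <;>
  · simp only [quad, lowc, g2, Matrix.cons_val, Fin.zero_eta, Fin.mk_one, Fin.reduceFinMk,
      Fin.isValue] at hk ⊢
    first
    | linear_combination v * hk + 2 * y {1, 2, 3, 4} * hv
    | linear_combination v * hk + 2 * y {0, 2, 3, 4} * hv
    | linear_combination v * hk + 2 * y {0, 1, 3, 4} * hv
    | linear_combination v * hk + 2 * y {0, 1, 2, 4} * hv
    | linear_combination v * hk + 2 * y {0, 1, 2, 3} * hv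

theorem rel_top {K : Type*} [CommRing K] (v : K) (y : Finset (Fin 5) → K)
    (hv : v * y ∅ = 1) (hg1 : g1 y = 0) (t : Fin 10 → K) (q : Fin 5 → K)
    (ht : t = ![y {0, 1, 2}, y {0, 1, 3}, y {0, 1, 4}, y {0, 2, 3}, y {0, 2, 4}, y {0, 3, 4},
      y {1, 2, 3}, y {1, 2, 4}, y {1, 3, 4}, y {2, 3, 4}])
    (hq : q = ![y {1, 2, 3, 4}, y {0, 2, 3, 4}, y {0, 1, 3, 4}, y {0, 1, 2, 4},
      y {0, 1, 2, 3}]) :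
    topc v (lowc y) t q = y {0, 1, 2, 3, 4} := by
  subst ht hq
  simp only [topc, lowc, g1, Matrix.cons_val, Fin.isValue] at hg1 ⊢
  linear_combination (-v) * hg1 + y {0, 1, 2, 3, 4} * hv

theorem rel_tri {K : Type*} [CommRing K] (v : K) (y : Finset (Fin 5) → K) :
    tri v (lowc y) (fun p => mu v y p.1.1 p.1.2) =
      ![y {0, 1, 2}, y {0, 1, 3}, y {0, 1, 4}, y {0, 2, 3}, y {0, 2, 4}, y {0, 3, 4},
      y {1, 2, 3}, y {1, 2, 4}, y {1, 3, 4}, y {2, 3, 4}] := by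
  funext k
  fin_cases k <;>
  · simp only [tri, lowc, mu, Matrix.of_apply, Matrix.cons_val, Fin.zero_eta, Fin.mk_one,
      Fin.reduceFinMk, Fin.isValue]
    ring

/-- A spinor satisfying the equations is recovered from its chart coordinates. -/
theorem chart_of_rel {K : Type*} [CommRing K] (v : K) (y : Finset (Fin 5) → K)
    (h2 : ∀ a : K, 2 * a = 0 → a = 0) (hv : v * y ∅ = 1) (hg1 : g1 y = 0)
    (hg2 : ∀ k, g2 y k = 0) :
    ∀ S, chart (y ∅) v (lowc y) (fun p => mu v y p.1.1 p.1.2) S = y S := by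
  have e3 := rel_tri v y
  have e4 := rel_quad v y h2 hv hg2 _ e3
  have e5 := rel_top v y hv hg1 _ _ e3 e4
  apply forall_finset5 <;> simp [chart] <;>
    first | exact e5 | (rw [e4]; rfl) | (rw [e3]; rfl) | rfl

/-- The five Plücker relations evaluated. -/
theorem aeval_Pf {K : Type*} [CommRing K] [Algebra ℂ K]
    (w : {p : Fin 5 × Fin 5 // p.1 < p.2} → K) (k : Fin 5) :
    MvPolynomial.aeval w (Pf k) = (![
      w ⟨(1, 2), by decide⟩ * w ⟨(3, 4), by decide⟩ - w ⟨(1, 3), by decide⟩ * w ⟨(2, 4), by decide⟩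
        + w ⟨(1, 4), by decide⟩ * w ⟨(2, 3), by decide⟩,
      w ⟨(0, 2), by decide⟩ * w ⟨(3, 4), by decide⟩ - w ⟨(0, 3), by decide⟩ * w ⟨(2, 4), by decide⟩
        + w ⟨(0, 4), by decide⟩ * w ⟨(2, 3), by decide⟩,
      w ⟨(0, 1), by decide⟩ * w ⟨(3, 4), by decide⟩ - w ⟨(0, 3), by decide⟩ * w ⟨(1, 4), by decide⟩
        + w ⟨(0, 4), by decide⟩ * w ⟨(1, 3), by decide⟩,
      w ⟨(0, 1), by decide⟩ * w ⟨(2, 4), by decide⟩ - w ⟨(0, 2), by decide⟩ * w ⟨(1, 4), by decide⟩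
        + w ⟨(0, 4), by decide⟩ * w ⟨(1, 2), by decide⟩,
      w ⟨(0, 1), by decide⟩ * w ⟨(2, 3), by decide⟩ - w ⟨(0, 2), by decide⟩ * w ⟨(1, 3), by decide⟩
        + w ⟨(0, 3), by decide⟩ * w ⟨(1, 2), by decide⟩] : Fin 5 → K) k := by
  fin_cases k <;> simp [Pf, U, Fin.succAbove]

/-- Modulo (E1) and (E2), the equations (E3) are the Plücker relations of `mu`. -/
theorem g3_eq_Pf {K : Type*} [CommRing K] [Algebra ℂ K] (v : K) (y : Finset (Fin 5) → K)
    (h2 : ∀ a : K, 2 * a = 0 → a = 0) (hv : v * y ∅ = 1) (hg1 : g1 y = 0)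
    (hg2 : ∀ k, g2 y k = 0) (r : Fin 5) :
    g3 y r = 2 * MvPolynomial.aeval (fun p : {p : Fin 5 × Fin 5 // p.1 < p.2} =>
      mu v y p.1.1 p.1.2) (Pf r) := by
  have e4 := rel_quad v y h2 hv hg2 _ rfl
  have e5 := rel_top v y hv hg1 _ _ rfl e4
  have q0 := congrFun e4 0
  have q1 := congrFun e4 1
  have q2 := congrFun e4 2
  have q3 := congrFun e4 3
  have q4 := congrFun e4 4
  rw [aeval_Pf]
  rw [e4] at e5
  simp only [quad, topc, lowc, Matrix.cons_val, Fin.isValue] at q0 q1 q2 q3 q4 e5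
  fin_cases r <;>
  · simp only [g3, mu, Matrix.of_apply, Matrix.cons_val, Fin.zero_eta, Fin.mk_one,
      Fin.reduceFinMk, Fin.isValue]
    rw [← e5, ← q0, ← q1, ← q2, ← q3, ← q4]
    ring

theorem chart_mu {K : Type*} [CommRing K] (u v : K) (x : Fin 15 → K)
    (w : {p : Fin 5 × Fin 5 // p.1 < p.2} → K) (p : {p : Fin 5 × Fin 5 // p.1 < p.2}) :
    mu v (chart u v x w) p.1.1 p.1.2 = w p := by
  obtain ⟨⟨i, j⟩, h⟩ := p
  fin_cases i <;> fin_cases j <;> first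
    | exact absurd h (by decide)
    | (simp [mu, chart, tri])

theorem chart_lowc {K : Type*} [CommRing K] (u v : K) (x : Fin 15 → K)
    (w : {p : Fin 5 × Fin 5 // p.1 < p.2} → K) (i : Fin 15) :
    lowc (chart u v x w) i = x i := by
  fin_cases i <;> simp [lowc, chart]

theorem chart_empty {K : Type*} [CommRing K] (u v : K) (x : Fin 15 → K)
    (w : {p : Fin 5 × Fin 5 // p.1 < p.2} → K) : chart u v x w ∅ = u := by
  simp [chart]

theorem chart_g1 {K : Type*} [CommRing K] (u v : K) (x : Fin 15 → K)
    (w : {p : Fin 5 × Fin 5 // p.1 < p.2} → K) (hv : v * u = 1) : g1 (chart u v x w) = 0 := by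
  have huv : ∀ a, u * (v * a) = a := fun a => by rw [← mul_assoc, mul_comm u, hv, one_mul]
  generalize ht : tri v x w = t
  generalize hq : quad v x t = q
  simp [g1, chart, ht, hq, topc]
  simp only [huv]
  ring

theorem chart_g2 {K : Type*} [CommRing K] (u v : K) (x : Fin 15 → K)
    (w : {p : Fin 5 × Fin 5 // p.1 < p.2} → K) (hv : v * u = 1) (k : Fin 5) :
    g2 (chart u v x w) k = 0 := by
  have huv : ∀ a, u * (v * a) = a := fun a => by rw [← mul_assoc, mul_comm u, hv, one_mul]
  generalize ht : tri v x w = t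
  fin_cases k
  all_goals simp [g2, chart, ht, quad]
  all_goals
    simp only [mul_assoc, huv]
    ring

theorem chart_map {K K' : Type*} [CommRing K] [CommRing K'] (f : K →+* K') (u v : K)
    (x : Fin 15 → K) (w : {p : Fin 5 × Fin 5 // p.1 < p.2} → K) :
    ∀ S, f (chart u v x w S) = chart (f u) (f v) (fun i => f (x i)) (fun i => f (w i)) S := by
  have e3 : ∀ i, f (tri v x w i) = tri (f v) (fun i => f (x i)) (fun i => f (w i)) i := by
    intro i
    fin_cases i <;> simp [tri]
  have e4 : ∀ t i, f (quad v x t i) = quad (f v) (fun i => f (x i)) (fun i => f (t i)) i := by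
    intro t i
    fin_cases i <;> simp [quad]
  have e5 : ∀ t q, f (topc v x t q) =
      topc (f v) (fun i => f (x i)) (fun i => f (t i)) (fun i => f (q i)) := by
    intro t q
    simp [topc]
  apply forall_finset5 <;> simp [chart, e3, e4, e5]

theorem gs_map {K K' : Type*} [CommRing K] [CommRing K'] (f : K →+* K')
    (y : Finset (Fin 5) → K) : f (g1 y) = g1 (fun S => f (y S)) ∧
      (∀ k, f (g2 y k) = g2 (fun S => f (y S)) k) ∧
      (∀ k, f (g3 y k) = g3 (fun S => f (y S)) k) := by
  refine ⟨?_, ?_, ?_⟩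
  · simp [g1]
  · intro k
    fin_cases k <;> simp [g2, map_ofNat]
  · intro k
    fin_cases k <;> simp [g3, map_ofNat]

/-! ### The isomorphism -/

theorem two_cancel {K : Type*} [CommRing K] [Algebra ℂ K] (a : K) (h : 2 * a = 0) : a = 0 := by
  have h2 : algebraMap ℂ K (1 / 2) * 2 = 1 := by
    rw [← map_ofNat (algebraMap ℂ K) 2, ← map_mul]
    norm_num
  calc a = (algebraMap ℂ K (1 / 2) * 2) * a := by rw [h2, one_mul]
    _ = 0 := by rw [mul_assoc, h, mul_zero]

theorem chart_g3 {K : Type*} [CommRing K] [Algebra ℂ K] (u v : K) (x : Fin 15 → K)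
    (w : {p : Fin 5 × Fin 5 // p.1 < p.2} → K) (hv : v * u = 1)
    (hw : ∀ k, MvPolynomial.aeval w (Pf k) = 0) (k : Fin 5) : g3 (chart u v x w) k = 0 := by
  rw [g3_eq_Pf v _ two_cancel (by rw [chart_empty]; exact hv)
    (chart_g1 _ _ _ _ hv) (chart_g2 _ _ _ _ hv)]
  simp_rw [chart_mu]
  exact (congrArg (fun z => 2 * z) (hw k)).trans (mul_zero _)

theorem low_map {K K' : Type*} (f : K → K') (y : Finset (Fin 5) → K) (i : Fin 15) :
    f (lowc y i) = lowc (fun S => f (y S)) i := by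
  fin_cases i <;> rfl

theorem mu_map {K K' : Type*} [CommRing K] [CommRing K'] (f : K →+* K') (v : K)
    (y : Finset (Fin 5) → K) (i j : Fin 5) :
    f (mu v y i j) = mu (f v) (fun S => f (y S)) i j := by
  fin_cases i <;> fin_cases j <;> simp [mu]

/-- A solution of the equations defines a map out of `A`. -/
theorem exists_fwd {K : Type*} [CommRing K] [Algebra ℂ K] (y : Finset (Fin 5) → K)
    (h1 : g1 y = 0) (h2 : ∀ k, g2 y k = 0) (h3 : ∀ k, g3 y k = 0) :
    ∃ f : Aq →ₐ[ℂ] K, ∀ S, f (Ideal.Quotient.mk Igrav (MvPolynomial.X S)) = y S := by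
  let f0 : R32 →ₐ[ℂ] K := MvPolynomial.aeval y
  have hy : (fun S => (f0 : R32 →+* K) (MvPolynomial.X S)) = y := by
    funext S
    exact MvPolynomial.aeval_X _ _
  have h : Igrav ≤ RingHom.ker (f0 : R32 →+* K) := by
    obtain ⟨e1, e2, e3⟩ := gs_map (f0 : R32 →+* K) MvPolynomial.X
    rw [hy] at e1 e2 e3
    apply Igrav_le
    · rw [RingHom.mem_ker, e1, h1]
    · intro k
      rw [RingHom.mem_ker, e2, h2]
    · intro k
      rw [RingHom.mem_ker, e3, h3]
  exact ⟨Ideal.Quotient.liftₐ Igrav f0 fun a ha => h ha, fun S => MvPolynomial.aeval_X _ _⟩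

/-- The images of the variables in the localization. -/
def ly (L : Type) [CommRing L] [Algebra Aq L] (S : Finset (Fin 5)) : L :=
  algebraMap Aq L (Ideal.Quotient.mk Igrav (MvPolynomial.X S))

theorem ly_rel (L : Type) [CommRing L] [Algebra Aq L] :
    g1 (ly L) = 0 ∧ (∀ k, g2 (ly L) k = 0) ∧ ∀ k, g3 (ly L) k = 0 := by
  obtain ⟨h1, h2, h3⟩ := gs_map ((algebraMap Aq L).comp (Ideal.Quotient.mk Igrav)) MvPolynomial.X
  refine ⟨h1.symm.trans ?_, fun k => (h2 k).symm.trans ?_, fun k => (h3 k).symm.trans ?_⟩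
  · rw [RingHom.comp_apply, Ideal.Quotient.eq_zero_iff_mem.mpr g1_mem, map_zero]
  · rw [RingHom.comp_apply, Ideal.Quotient.eq_zero_iff_mem.mpr (g2_mem k), map_zero]
  · rw [RingHom.comp_apply, Ideal.Quotient.eq_zero_iff_mem.mpr (g3_mem k), map_zero]

/-- The images of the Plücker coordinates in the localization. -/
def lw (L : Type) [CommRing L] [Algebra Aq L] (x : Lˣ)
    (p : {p : Fin 5 × Fin 5 // p.1 < p.2}) : L := mu ((x⁻¹ : Lˣ) : L) (ly L) p.1.1 p.1.2

theorem lw_Pf (L : Type) [CommRing L] [Algebra Aq L] [Algebra ℂ L] (x : Lˣ)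
    (hx : (x : L) = ly L ∅) (k : Fin 5) : MvPolynomial.aeval (lw L x) (Pf k) = 0 := by
  obtain ⟨h1, h2, h3⟩ := ly_rel L
  apply two_cancel
  have := g3_eq_Pf ((x⁻¹ : Lˣ) : L) (ly L) two_cancel (by rw [← hx]; simp) h1 h2 k
  rw [h3] at this
  exact this.symm

/-- Any algebra with the universal property of the chart is isomorphic to the localization. -/
theorem iso_of_universal (L : Type) [CommRing L] [Algebra Aq L]
    [IsLocalization.Away lam0 L] [Algebra ℂ L] [IsScalarTower ℂ Aq L]
    (K : Type) [CommRing K] [Algebra ℂ K] (tu tv : K) (tx : Fin 15 → K)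
    (tw : {p : Fin 5 × Fin 5 // p.1 < p.2} → K) (hv : tv * tu = 1)
    (hw : ∀ k, MvPolynomial.aeval tw (Pf k) = 0)
    (hext : ∀ f g : K →ₐ[ℂ] K, f tu = g tu → (∀ i, f (tx i) = g (tx i)) →
      (∀ p, f (tw p) = g (tw p)) → f = g)
    (hlift : ∀ (x : Lˣ) (y : Fin 15 → L) (w : {p : Fin 5 × Fin 5 // p.1 < p.2} → L),
      (∀ k, MvPolynomial.aeval w (Pf k) = 0) →
      ∃ f : K →ₐ[ℂ] L, f tu = x ∧ f tv = ((x⁻¹ : Lˣ) : L) ∧ (∀ i, f (tx i) = y i) ∧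
        ∀ p, f (tw p) = w p) :
    Nonempty (L ≃ₐ[ℂ] K) := by
  obtain ⟨x, hx⟩ : IsUnit (algebraMap Aq L lam0) := IsLocalization.Away.algebraMap_isUnit lam0
  replace hx : (x : L) = ly L ∅ := hx
  obtain ⟨f1, hf1⟩ := exists_fwd (chart tu tv tx tw) (chart_g1 _ _ _ _ hv)
    (chart_g2 _ _ _ _ hv) (chart_g3 _ _ _ _ hv hw)
  have hunit : IsUnit (f1 lam0) := by
    rw [lam0, hf1, chart_empty]
    exact IsUnit.of_mul_eq_one_right _ hv
  let F : L →ₐ[ℂ] K := IsLocalization.Away.liftAlgHom lam0 hunit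
  have hF : ∀ S, F (ly L S) = chart tu tv tx tw S := fun S =>
    (IsLocalization.Away.lift_eq lam0 hunit _).trans (hf1 S)
  have hFv : F ((x⁻¹ : Lˣ) : L) = tv := by
    have h1 : F ((x⁻¹ : Lˣ) : L) * tu = 1 := by
      rw [← chart_empty tu tv tx tw, ← hF, ← hx, ← map_mul, Units.inv_mul, map_one]
    calc F ((x⁻¹ : Lˣ) : L) = F ((x⁻¹ : Lˣ) : L) * (tu * tv) := by
          rw [mul_comm tu, hv, mul_one]
      _ = tv := by rw [← mul_assoc, h1, one_mul]
  obtain ⟨G, hGu, hGv, hGx, hGw⟩ := hlift x (lowc (ly L)) (lw L x) (lw_Pf L x hx)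
  refine ⟨AlgEquiv.ofAlgHom F G ?_ ?_⟩
  · apply hext
    · rw [AlgHom.comp_apply, hGu, hx, hF, chart_empty]; rfl
    · intro i
      rw [AlgHom.comp_apply, hGx]
      refine (low_map F (ly L) i).trans ?_
      simp only [hF]
      exact chart_lowc _ _ _ _ i
    · intro p
      rw [AlgHom.comp_apply, hGw, lw]
      refine (mu_map (F : L →+* K) _ _ _ _).trans ?_
      simp only [RingHom.coe_coe, hF, hFv]
      exact chart_mu _ _ _ _ p
  · apply IsLocalization.algHom_ext (A := Aq) (Submonoid.powers lam0)
    apply Ideal.Quotient.algHom_ext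
    apply MvPolynomial.algHom_ext
    intro S
    change G (F (ly L S)) = ly L S
    obtain ⟨h1, h2, h3⟩ := ly_rel L
    rw [hF]
    refine (chart_map (G : K →+* L) tu tv tx tw S).trans ?_
    simp only [RingHom.coe_coe, hGu, hGv, hGx, hGw]
    rw [hx]
    exact chart_of_rel ((x⁻¹ : Lˣ) : L) (ly L) two_cancel (by rw [← hx]; simp) h1 h2 S

/-- Laurent polynomials map to any algebra with a chosen unit. -/
def laur {K : Type*} [CommRing K] [Algebra ℂ K] (x : Kˣ) : LaurentPolynomial ℂ →ₐ[ℂ] K :=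
  { LaurentPolynomial.eval₂ (algebraMap ℂ K) x with
    commutes' := fun r => LaurentPolynomial.eval₂_C _ _ r }

theorem laur_T {K : Type*} [CommRing K] [Algebra ℂ K] (x : Kˣ) (n : ℤ) :
    laur x (LaurentPolynomial.T n) = (x ^ n : Kˣ) := LaurentPolynomial.eval₂_T _ _ n

theorem laur_ext {K : Type*} [Semiring K] [Algebra ℂ K] (f g : LaurentPolynomial ℂ →ₐ[ℂ] K)
    (h : f (LaurentPolynomial.T 1) = g (LaurentPolynomial.T 1)) : f = g := by
  apply AlgHom.coe_ringHom_injective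
  apply IsLocalization.ringHom_ext (R := Polynomial ℂ) (Submonoid.powers (Polynomial.X))
  apply Polynomial.ringHom_ext
  · intro a
    have ha : algebraMap (Polynomial ℂ) (LaurentPolynomial ℂ) (Polynomial.C a) =
        algebraMap ℂ (LaurentPolynomial ℂ) a := by
      rw [LaurentPolynomial.algebraMap_eq_toLaurent, Polynomial.toLaurent_C]
      rfl
    rw [RingHom.comp_apply, RingHom.comp_apply, ha]
    exact (f.commutes a).trans (g.commutes a).symm
  · rw [RingHom.comp_apply, RingHom.comp_apply, LaurentPolynomial.algebraMap_eq_toLaurent,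
      Polynomial.toLaurent_X]
    exact h

theorem aeval_Pf_tensor (A B : Type*) [CommRing A] [Algebra ℂ A] [CommRing B] [Algebra ℂ B]
    (w : {p : Fin 5 × Fin 5 // p.1 < p.2} → B) (k : Fin 5)
    (hw : MvPolynomial.aeval w (Pf k) = 0) :
    MvPolynomial.aeval (fun p => (1 : A) ⊗ₜ[ℂ] w p) (Pf k) = 0 := by
  have h1 : MvPolynomial.aeval (fun p => (1 : A) ⊗ₜ[ℂ] w p) =
      (Algebra.TensorProduct.includeRight : B →ₐ[ℂ] A ⊗[ℂ] B).comp (MvPolynomial.aeval w) := by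
    apply MvPolynomial.algHom_ext
    intro p
    rw [MvPolynomial.aeval_X, AlgHom.comp_apply, MvPolynomial.aeval_X]
    rfl
  rw [h1, AlgHom.comp_apply, hw]
  exact map_zero _

theorem aeval_Pf_zero (k : Fin 5) :
    MvPolynomial.aeval (fun p => (Ideal.Quotient.mkₐ ℂ (Ideal.span (Set.range Pf))
      (MvPolynomial.X p) : Bring)) (Pf k) = 0 := by
  have h0 : Ideal.Quotient.mkₐ ℂ (Ideal.span (Set.range Pf)) (Pf k) = 0 :=
    Ideal.Quotient.eq_zero_iff_mem.mpr (Ideal.subset_span ⟨k, rfl⟩)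
  have h1 : MvPolynomial.aeval (fun p => (Ideal.Quotient.mkₐ ℂ (Ideal.span (Set.range Pf))
      (MvPolynomial.X p))) = (Ideal.Quotient.mkₐ ℂ (Ideal.span (Set.range Pf))) := by
    apply MvPolynomial.algHom_ext
    intro p
    rw [MvPolynomial.aeval_X]
  rw [h1, h0]

/-- the localization `A[λ_∅⁻¹]` is isomorphic as a `ℂ`-algebra to
`ℂ[u,u⁻¹] ⊗ ℂ[x₁,…,x₁₅] ⊗ B`. -/
theorem localization_chart_iso (L : Type) [CommRing L] [Algebra Aq L]
    [IsLocalization.Away lam0 L] [Algebra ℂ L] [IsScalarTower ℂ Aq L] :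
    Nonempty (L ≃ₐ[ℂ] ((LaurentPolynomial ℂ ⊗[ℂ] MvPolynomial (Fin 15) ℂ) ⊗[ℂ] Bring)) := by
  apply iso_of_universal L ((LaurentPolynomial ℂ ⊗[ℂ] MvPolynomial (Fin 15) ℂ) ⊗[ℂ] Bring)
    ((LaurentPolynomial.T 1 ⊗ₜ 1) ⊗ₜ 1) ((LaurentPolynomial.T (-1) ⊗ₜ 1) ⊗ₜ 1)
    (fun i => (1 ⊗ₜ MvPolynomial.X i) ⊗ₜ 1)
    (fun p => 1 ⊗ₜ Ideal.Quotient.mkₐ ℂ (Ideal.span (Set.range Pf)) (MvPolynomial.X p))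
  · rw [Algebra.TensorProduct.tmul_mul_tmul, Algebra.TensorProduct.tmul_mul_tmul,
      ← LaurentPolynomial.T_add]
    simp [Algebra.TensorProduct.one_def]
  · intro k
    exact aeval_Pf_tensor (LaurentPolynomial ℂ ⊗[ℂ] MvPolynomial (Fin 15) ℂ) Bring _ k (aeval_Pf_zero k)
  · intro f g h1 h2 h3
    apply Algebra.TensorProduct.ext
    · apply Algebra.TensorProduct.ext
      · exact laur_ext _ _ h1
      · exact MvPolynomial.algHom_ext h2
    · apply Ideal.Quotient.algHom_ext
      exact MvPolynomial.algHom_ext h3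
  · intro x y w hw
    have hspan : ∀ a ∈ Ideal.span (Set.range Pf), MvPolynomial.aeval w a = 0 := by
      have h : Ideal.span (Set.range Pf) ≤ RingHom.ker (MvPolynomial.aeval (R := ℂ) w) := by
        rw [Ideal.span_le]
        rintro _ ⟨k, rfl⟩
        exact hw k
      exact fun a ha => h ha
    refine ⟨Algebra.TensorProduct.lift
      (Algebra.TensorProduct.lift (laur x) (MvPolynomial.aeval y) (fun _ _ => Commute.all _ _))
      (Ideal.Quotient.liftₐ (Ideal.span (Set.range Pf)) (MvPolynomial.aeval w) hspan)
      (fun _ _ => Commute.all _ _), ?_, ?_, ?_, ?_⟩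
    · simp [laur_T]
    · simp [laur_T]
    · intro i
      simp
    · intro p
      rw [Algebra.TensorProduct.lift_tmul, map_one, one_mul]
      exact MvPolynomial.aeval_X _ _
end
end

section
/- The localization A[λ_∅^{-1}] of A at the coordinate λ₀ = λ_∅ is a reduced ring; in fact it is an integral domain that is integrally closed in its field of fractions (the local rings of X at points of the chart λ₀ ≠ 0 are normal domains). -/
set_option synthInstance.maxHeartbeats 1000000
set_option maxHeartbeats 2000000

noncomputable section

set_option linter.unusedSimpArgs false
set_option linter.unusedSectionVars false

namespace Grav
open MvPolynomial
open scoped MonomialOrder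

theorem ker_eq_span {σ τ K : Type} [CommRing K] [IsDomain K] (m : MonomialOrder σ)
    (m' : MonomialOrder τ) (B : Set (MvPolynomial σ K))
    (hB : ∀ b ∈ B, IsUnit (m.leadingCoeff b))
    (φ : MvPolynomial σ K →ₐ[K] MvPolynomial τ K) (hker : ∀ b ∈ B, φ b = 0)
    (hX : ∀ c : σ →₀ ℕ, (∀ b ∈ B, ¬ m.degree b ≤ c) → ∀ i ∈ c.support, φ (X i) ≠ 0)
    (hinj : ∀ c c' : σ →₀ ℕ, (∀ b ∈ B, ¬ m.degree b ≤ c) → (∀ b ∈ B, ¬ m.degree b ≤ c') →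
      (c.sum fun i n => n • m'.degree (φ (X i))) = (c'.sum fun i n => n • m'.degree (φ (X i))) →
      c = c') :
    RingHom.ker φ = Ideal.span B := by
  classical
  apply le_antisymm
  · intro f hf
    obtain ⟨g, r, hfr, -, hr⟩ := m.div_set hB f
    have hlin : Finsupp.linearCombination _ (fun b : B => (b : MvPolynomial σ K)) g
        ∈ Ideal.span B := by
      rw [Finsupp.linearCombination_apply]
      exact Ideal.sum_mem _ fun b _ => Ideal.mul_mem_left _ _ (Ideal.subset_span b.2)
    have hle : Ideal.span B ≤ RingHom.ker φ := Ideal.span_le.2 hker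
    have hr0 : φ r = 0 := by
      have h1 : φ f = 0 := hf
      rw [hfr, map_add, show φ _ = 0 from hle hlin, zero_add] at h1
      exact h1
    suffices r = 0 by rw [hfr, this, add_zero]; exact hlin
    by_contra hne
    have hdeg : ∀ c ∈ r.support, φ (monomial c 1) ≠ 0 ∧
        m'.degree (φ (monomial c 1)) = c.sum fun i n => n • m'.degree (φ (X i)) := by
      intro c hcr
      rw [monomial_eq, map_one, one_mul]
      simp only [Finsupp.prod, map_prod, map_pow]
      refine ⟨Finset.prod_ne_zero_iff.2 fun i hi => pow_ne_zero _ (hX c (hr c hcr) i hi), ?_⟩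
      rw [m'.degree_prod fun i hi => pow_ne_zero _ (hX c (hr c hcr) i hi)]
      simp only [Finsupp.sum, m'.degree_pow]
    set d : (σ →₀ ℕ) → (τ →₀ ℕ) := fun c => c.sum fun i n => n • m'.degree (φ (X i)) with hd
    obtain ⟨c, hc, hmax⟩ := r.support.exists_max_image (fun c => m'.toSyn (d c))
      (by simpa [Finset.nonempty_iff_ne_empty] using hne)
    have hexp : φ r = ∑ c ∈ r.support, C (coeff c r) * φ (monomial c 1) := by
      conv_lhs => rw [r.as_sum, map_sum]
      refine Finset.sum_congr rfl fun c _ => ?_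
      rw [← mul_one (coeff c r), ← C_mul_monomial, map_mul, mul_one]
      congr 1
      exact φ.commutes _
    have hco : coeff (d c) (φ r) = coeff c r * m'.leadingCoeff (φ (monomial c 1)) := by
      rw [hexp, coeff_sum, Finset.sum_eq_single_of_mem c hc]
      · rw [coeff_C_mul, MonomialOrder.leadingCoeff, (hdeg c hc).2]
      · intro c' hc' hcc
        rw [coeff_C_mul, m'.coeff_eq_zero_of_lt, mul_zero]
        rw [(hdeg c' hc').2]
        refine lt_of_le_of_ne (hmax c' hc') fun h => hcc ?_
        exact hinj _ _ (hr c' hc') (hr c hc) (m'.toSyn.injective h)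
    rw [hr0, coeff_zero] at hco
    rcases mul_eq_zero.1 hco.symm with h | h
    · exact (mem_support_iff.1 hc) h
    · exact (hdeg c hc).1 (m'.leadingCoeff_eq_zero_iff.1 h)
  · exact Ideal.span_le.2 hker

/-- descent -/
theorem descent {B F : Type} [CommRing B] [Field F] [Algebra B F]
    (hinj : Function.Injective (algebraMap B F)) (p : B) (hp : p ≠ 0)
    (hrad : ∀ (b : B) (m : ℕ), p ∣ b ^ m → p ∣ b) (N : ℕ) :
    ∀ t : F, IsIntegral B t → (∃ b, algebraMap B F p ^ N * t = algebraMap B F b) →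
      ∃ b, t = algebraMap B F b := by
  have hpF : algebraMap B F p ≠ 0 := fun h => hp (hinj (by simpa using h))
  induction N with
  | zero => rintro t - ⟨b, hb⟩; exact ⟨b, by simpa using hb⟩
  | succ N ih =>
    rintro t ht ⟨b, hb⟩
    obtain ⟨b', hb'⟩ := ih (algebraMap B F p * t) (isIntegral_algebraMap.mul ht)
      ⟨b, by rw [← hb]; ring⟩
    obtain ⟨q, hq, hqt⟩ := ht
    have h1 : Polynomial.eval b' (q.scaleRoots p) = 0 := by
      apply hinj
      rw [map_zero, ← Polynomial.eval₂_at_apply, ← hb']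
      exact Polynomial.scaleRoots_eval₂_eq_zero _ hqt
    have h2 : p ∣ b' ^ q.natDegree := by
      rw [Polynomial.eval_eq_sum_range, Finset.sum_range_succ, Polynomial.natDegree_scaleRoots,
        Polynomial.coeff_scaleRoots_natDegree, hq.leadingCoeff, one_mul] at h1
      rw [eq_neg_of_add_eq_zero_right h1, dvd_neg]
      refine Finset.dvd_sum fun i hi => ?_
      rw [Polynomial.coeff_scaleRoots]
      have : q.natDegree - i ≠ 0 := by have := Finset.mem_range.1 hi; omega
      exact Dvd.dvd.mul_right (Dvd.dvd.mul_left (dvd_pow_self p this) _) _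
    obtain ⟨b'', rfl⟩ := hrad _ _ h2
    refine ⟨b'', mul_left_cancel₀ hpF ?_⟩
    rw [hb', map_mul]

theorem comb1 (a0 a1 a2 a3 a4 a5 a6 a7 a8 a9 b0 b1 b2 b3 b4 b5 b6 b7 b8 b9 : ℕ)
  (h1 : a1 = 0 ∨ a7 = 0) (h2 : a0 = 0 ∨ a7 = 0) (h3 : a0 = 0 ∨ a4 = 0) (h4 : a0 = 0 ∨ a8 = 0)
  (h5 : a2 = 0 ∨ a8 = 0)
  (k1 : b1 = 0 ∨ b7 = 0) (k2 : b0 = 0 ∨ b7 = 0) (k3 : b0 = 0 ∨ b4 = 0) (k4 : b0 = 0 ∨ b8 = 0)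
  (k5 : b2 = 0 ∨ b8 = 0)
  (x1 : a0 + a1 + a3 + a6 = b0 + b1 + b3 + b6)
  (x2 : a2 + a4 + a7 = b2 + b4 + b7)
  (x3 : a5 + a8 = b5 + b8)
  (x4 : a9 = b9)
  (y2 : a6 = b6) (y3 : a3 + a7 = b3 + b7) (y4 : a1 + a4 + a8 = b1 + b4 + b8)
  (_y5 : a0 + a2 + a5 + a9 = b0 + b2 + b5 + b9) :
  a0 = b0 ∧ a1 = b1 ∧ a2 = b2 ∧ a3 = b3 ∧ a4 = b4 ∧ a5 = b5 ∧ a6 = b6 ∧ a7 = b7 ∧ a8 = b8 ∧ 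
   a9 = b9 := by
  have e3 : a3 = b3 := by clear h3 h4 h5 k3 k4 k5; omega
  have e8 : a8 = b8 := by clear h3 k3 h1 h2 k1 k2; omega
  have e7 : a7 = b7 := by omega
  have e5 : a5 = b5 := by omega
  have : a0 = b0 := by clear h1 h2 h4 h5 k1 k2 k4 k5; omega
  omega

theorem comb2 (a0 a1 a2 a3 a4 a5 a6 a7 a8 a9 b0 b1 b2 b3 b4 b5 b6 b7 b8 b9 : ℕ)
  (h1 : a1 = 0 ∨ a7 = 0) (h2 : a0 = 0 ∨ a7 = 0) (h3 : a0 = 0 ∨ a4 = 0) (h4 : a0 = 0 ∨ a8 = 0)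
  (h5 : a2 = 0 ∨ a8 = 0)
  (k1 : b1 = 0 ∨ b7 = 0) (k2 : b0 = 0 ∨ b7 = 0) (k3 : b0 = 0 ∨ b4 = 0) (k4 : b0 = 0 ∨ b8 = 0)
  (k5 : b2 = 0 ∨ b8 = 0) (h6 : a6 = 0) (k6 : b6 = 0)
  (s : a0 + a1 + a3 = b0 + b1 + b3)
  (t : a2 + a4 + a7 = b2 + b4 + b7)
  (x3 : a3 + a7 = b3 + b7)
  (x4 : a1 + a4 + a8 = b1 + b4 + b8)
  (x5 : a0 + a2 + a5 + a9 = b0 + b2 + b5 + b9)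
  (y4 : a5 + a8 = b5 + b8)
  (_y5 : a9 = b9) :
  a0 = b0 ∧ a1 = b1 ∧ a2 = b2 ∧ a3 = b3 ∧ a4 = b4 ∧ a5 = b5 ∧ a6 = b6 ∧ a7 = b7 ∧ a8 = b8 ∧ 
   a9 = b9 := by
  have e3 : a3 = b3 := by clear h3 h4 h5 k3 k4 k5; omega
  have e8 : a8 = b8 := by clear h3 k3 h1 h2 k1 k2; omega
  have e7 : a7 = b7 := by omega
  have e5 : a5 = b5 := by omega
  have : a0 = b0 := by clear h1 h2 h4 h5 k1 k2 k4 k5; omega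
  omega
end Grav

namespace Grav
open MvPolynomial
open scoped MonomialOrder

theorem lex_lt_aux {n : ℕ} {a b c d : Fin n} (hab : a < b) (hac : a < c) (had : a < d) :
    (Finsupp.single c 1 + Finsupp.single d 1 : Fin n →₀ ℕ) ≺[MonomialOrder.lex]
      (Finsupp.single a 1 + Finsupp.single b 1) := by
  rw [MonomialOrder.lex_lt_iff]
  refine ⟨a, fun j hj => ?_, ?_⟩
  · have h1 := (hj.trans hab).ne'
    have h2 := (hj.trans hac).ne'
    have h3 := (hj.trans had).ne'
    have h4 := hj.ne'
    simp [h1, h2, h3, h4]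
  · simp [hab.ne', hac.ne', had.ne']

theorem degXX {n : ℕ} {K : Type} [CommRing K] [IsDomain K] (a b : Fin n) :
    MonomialOrder.lex.degree (X a * X b : MvPolynomial (Fin n) K) =
      Finsupp.single a 1 + Finsupp.single b 1 := by
  rw [MonomialOrder.degree_mul (X_ne_zero _) (X_ne_zero _), MonomialOrder.degree_X,
    MonomialOrder.degree_X]

theorem lead2 {n : ℕ} {K : Type} [CommRing K] [IsDomain K] {a b c d : Fin n}
    (hab : a < b) (hac : a < c) (had : a < d) :
    MonomialOrder.lex.degree (X a * X b - X c * X d : MvPolynomial (Fin n) K) =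
      Finsupp.single a 1 + Finsupp.single b 1 ∧
    MonomialOrder.lex.leadingCoeff (X a * X b - X c * X d : MvPolynomial (Fin n) K) = 1 := by
  have h : MonomialOrder.lex.degree (X c * X d : MvPolynomial (Fin n) K) ≺[MonomialOrder.lex]
      MonomialOrder.lex.degree (X a * X b : MvPolynomial (Fin n) K) := by
    rw [degXX, degXX]; exact lex_lt_aux hab hac had
  rw [MonomialOrder.degree_sub_of_lt h, MonomialOrder.leadingCoeff_sub_of_lt h, degXX]
  exact ⟨rfl, by simp⟩

theorem lead3 {n : ℕ} {K : Type} [CommRing K] [IsDomain K] {a b c d e f : Fin n}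
    (hab : a < b) (hac : a < c) (had : a < d) (hae : a < e) (haf : a < f) :
    MonomialOrder.lex.degree (X a * X b - X c * X d + X e * X f : MvPolynomial (Fin n) K) =
      Finsupp.single a 1 + Finsupp.single b 1 ∧
    MonomialOrder.lex.leadingCoeff
      (X a * X b - X c * X d + X e * X f : MvPolynomial (Fin n) K) = 1 := by
  have h : MonomialOrder.lex.degree (X e * X f : MvPolynomial (Fin n) K) ≺[MonomialOrder.lex]
      MonomialOrder.lex.degree (X a * X b - X c * X d : MvPolynomial (Fin n) K) := by
    rw [degXX, (lead2 hab hac had).1]; exact lex_lt_aux hab hae haf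
  rw [MonomialOrder.degree_add_of_lt h, MonomialOrder.leadingCoeff_add_of_lt h]
  exact lead2 hab hac had

/-- The five Pluecker relations. Variables: 0 is p15, 1 is p14, 2 is p25, 3 is p13, 4 is p24,
5 is p35, 6 is p12, 7 is p23, 8 is p34, 9 is p45. -/
def pf (K : Type) [CommRing K] : Set (MvPolynomial (Fin 10) K) :=
  {X 1 * X 7 - X 3 * X 4 + X 6 * X 8, X 0 * X 7 - X 3 * X 2 + X 6 * X 5,
   X 0 * X 4 - X 1 * X 2 + X 6 * X 9, X 0 * X 8 - X 1 * X 5 + X 3 * X 9,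
   X 2 * X 8 - X 4 * X 5 + X 7 * X 9}

/-- Parametrization of the Grassmannian. -/
noncomputable def phi (K : Type) [CommRing K] :
    MvPolynomial (Fin 10) K →ₐ[K] MvPolynomial (Fin 10) K :=
  aeval ![X 0 * X 9 - X 4 * X 5, X 0 * X 8 - X 3 * X 5, X 1 * X 9 - X 4 * X 6,
    X 0 * X 7 - X 2 * X 5, X 1 * X 8 - X 3 * X 6, X 2 * X 9 - X 4 * X 7,
    X 0 * X 6 - X 1 * X 5, X 1 * X 7 - X 2 * X 6, X 2 * X 8 - X 3 * X 7, X 3 * X 9 - X 4 * X 8]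

/-- Parametrization of the Schubert divisor. -/
noncomputable def psi (K : Type) [CommRing K] :
    MvPolynomial (Fin 10) K →ₐ[K] MvPolynomial (Fin 8) K :=
  aeval ![X 0 * X 2, X 0 * X 3, X 1 * X 2, X 0 * X 4, X 1 * X 3, 
    -(X 2 * X 5 - X 4 * X 7), 0, X 1 * X 4, -(X 3 * X 5 - X 4 * X 6), -(X 2 * X 6 - X 3 * X 7)]

theorem not_le_aux {c : Fin 10 →₀ ℕ} {a b : Fin 10} (hab : a ≠ b)
    (h : ¬ (Finsupp.single a 1 + Finsupp.single b 1 : Fin 10 →₀ ℕ) ≤ c) : c a = 0 ∨ c b = 0 := by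
  by_contra! hc
  refine h fun i => ?_
  simp only [Finsupp.add_apply, Finsupp.single_apply]
  split_ifs with h1 h2 h2
  · exact absurd (h1.trans h2.symm) hab
  · subst h1; omega
  · subst h2; omega
  · omega

theorem pf_lead {K : Type} [CommRing K] [IsDomain K] (b : MvPolynomial (Fin 10) K)
    (hb : b ∈ pf K) : MonomialOrder.lex.leadingCoeff b = 1 := by
  rcases hb with rfl | rfl | rfl | rfl | rfl
  all_goals exact (lead3 (by decide) (by decide) (by decide) (by decide) (by decide)).2

theorem pf_normal {K : Type} [CommRing K] [IsDomain K] (c : Fin 10 →₀ ℕ)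
    (h : ∀ b ∈ pf K, ¬ MonomialOrder.lex.degree b ≤ c) :
    (c 1 = 0 ∨ c 7 = 0) ∧ (c 0 = 0 ∨ c 7 = 0) ∧ (c 0 = 0 ∨ c 4 = 0) ∧ (c 0 = 0 ∨ c 8 = 0) ∧
    (c 2 = 0 ∨ c 8 = 0) := by
  simp only [pf, Set.mem_insert_iff, Set.mem_singleton_iff, forall_eq_or_imp, forall_eq] at h
  obtain ⟨h1, h2, h3, h4, h5⟩ := h
  rw [(lead3 (by decide) (by decide) (by decide) (by decide) (by decide)).1] at h1 h2 h3 h4 h5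
  exact ⟨not_le_aux (by decide) h1, not_le_aux (by decide) h2, not_le_aux (by decide) h3,
    not_le_aux (by decide) h4, not_le_aux (by decide) h5⟩

theorem phi_pf {K : Type} [CommRing K] (b : MvPolynomial (Fin 10) K)
    (hb : b ∈ pf K) : phi K b = 0 := by
  rcases hb with rfl | rfl | rfl | rfl | rfl
  all_goals
    simp only [phi, map_add, map_sub, map_mul, aeval_X]
    simp
    ring

theorem psi_pf {K : Type} [CommRing K] (b : MvPolynomial (Fin 10) K)
    (hb : b ∈ pf K) : psi K b = 0 := by
  rcases hb with rfl | rfl | rfl | rfl | rfl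
  all_goals
    simp only [psi, map_add, map_sub, map_mul, aeval_X]
    simp
    try ring

theorem phi_X {K : Type} [CommRing K] [IsDomain K] (i : Fin 10) :
    MonomialOrder.lex.leadingCoeff (phi K (X i)) = 1 ∧
    MonomialOrder.lex.degree (phi K (X i)) = (Finsupp.single (![0,0,1,0,1,2,0,1,2,3] i) 1 +
      Finsupp.single (![9,8,9,7,8,9,6,7,8,9] i) 1 : Fin 10 →₀ ℕ) := by
  fin_cases i
  all_goals
    simp only [phi, aeval_X]
    exact ⟨(lead2 (by decide) (by decide) (by decide)).2,
      (lead2 (by decide) (by decide) (by decide)).1⟩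

theorem phi_ker {K : Type} [CommRing K] [IsDomain K] :
    RingHom.ker (phi K) = Ideal.span (pf K) := by
  refine ker_eq_span MonomialOrder.lex MonomialOrder.lex (pf K) (fun b hb => ?_) _ phi_pf ?_ ?_
  · rw [pf_lead b hb]; exact isUnit_one
  · intro c hc i hi h
    have := (phi_X (K := K) i).1
    simp [h] at this
  · intro c c' hc hc' h
    obtain ⟨h1, h2, h3, h4, h5⟩ := pf_normal c hc
    obtain ⟨k1, k2, k3, k4, k5⟩ := pf_normal c' hc'
    simp only [phi_X] at h
    rw [Finsupp.sum_fintype _ _ (by simp), Finsupp.sum_fintype _ _ (by simp)] at h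
    have H := fun i => DFunLike.congr_fun h i
    have x1 := H 0
    have x2 := H 1
    have x3 := H 2
    have x4 := H 3
    have y2 := H 6
    have y3 := H 7
    have y4 := H 8
    have y5 := H 9
    simp [Fin.sum_univ_succ] at x1 x2 x3 x4 y2 y3 y4 y5
    have := comb1 (c 0) (c 1) (c 2) (c 3) (c 4) (c 5) (c 6) (c 7) (c 8) (c 9)
      (c' 0) (c' 1) (c' 2) (c' 3) (c' 4) (c' 5) (c' 6) (c' 7) (c' 8) (c' 9)
      h1 h2 h3 h4 h5 k1 k2 k3 k4 k5 (by omega) (by omega) (by omega) (by omega) (by omega)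
      (by omega) (by omega) (by omega)
    ext i
    fin_cases i <;> simp <;> omega

theorem psi_X {K : Type} [CommRing K] [IsDomain K] (i : Fin 10) (hi : i ≠ 6) :
    MonomialOrder.lex.leadingCoeff (psi K (X i)) ≠ 0 ∧
    MonomialOrder.lex.degree (psi K (X i)) = (Finsupp.single (![0,0,1,0,1,2,0,1,3,2] i) 1 +
      Finsupp.single (![2,3,2,4,3,5,0,4,5,6] i) 1 : Fin 8 →₀ ℕ) := by
  have hm : ∀ a b : Fin 8, MonomialOrder.lex.leadingCoeff (X a * X b : MvPolynomial (Fin 8) K) ≠ 0 ∧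
      MonomialOrder.lex.degree (X a * X b : MvPolynomial (Fin 8) K) =
      Finsupp.single a 1 + Finsupp.single b 1 := fun a b => ⟨by simp, degXX a b⟩
  have hn : ∀ a b c d : Fin 8, a < b → a < c → a < d →
      MonomialOrder.lex.leadingCoeff (-(X a * X b - X c * X d) : MvPolynomial (Fin 8) K) ≠ 0 ∧
      MonomialOrder.lex.degree (-(X a * X b - X c * X d) : MvPolynomial (Fin 8) K) =
      Finsupp.single a 1 + Finsupp.single b 1 := by
    intro a b c d h1 h2 h3
    rw [MonomialOrder.leadingCoeff_neg, (lead2 h1 h2 h3).2, MonomialOrder.degree_neg]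
    exact ⟨neg_ne_zero.2 one_ne_zero, (lead2 h1 h2 h3).1⟩
  rw [psi, aeval_X]
  fin_cases i
  · exact hm 0 2
  · exact hm 0 3
  · exact hm 1 2
  · exact hm 0 4
  · exact hm 1 3
  · exact hn 2 5 4 7 (by decide) (by decide) (by decide)
  · exact absurd rfl hi
  · exact hm 1 4
  · exact hn 3 5 4 6 (by decide) (by decide) (by decide)
  · exact hn 2 6 3 7 (by decide) (by decide) (by decide)

theorem psi_ker {K : Type} [CommRing K] [IsDomain K] :
    RingHom.ker (psi K) = Ideal.span (insert (X 6) (pf K)) := by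
  have h6 : ∀ c : Fin 10 →₀ ℕ, (∀ b ∈ insert (X 6) (pf K), ¬ MonomialOrder.lex.degree b ≤ c) →
      c 6 = 0 := by
    intro c hc
    have := hc (X 6) (Set.mem_insert _ _)
    rw [MonomialOrder.degree_X] at this
    simpa using this
  refine ker_eq_span MonomialOrder.lex MonomialOrder.lex (insert (X 6) (pf K))
    (fun b hb => ?_) _ ?_ ?_ ?_
  · rcases hb with rfl | hb
    · simp
    · rw [pf_lead b hb]; exact isUnit_one
  · intro b hb
    rcases hb with rfl | hb
    · simp [psi]
    · exact psi_pf b hb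
  · intro c hc i hi h
    have hi6 : i ≠ 6 := by
      rintro rfl
      exact (Finsupp.mem_support_iff.1 hi) (h6 c hc)
    have := (psi_X (K := K) i hi6).1
    simp [h] at this
  · intro c c' hc hc' h
    obtain ⟨h1, h2, h3, h4, h5⟩ := pf_normal (K := K) c fun b hb => hc b (Set.mem_insert_of_mem _ hb)
    obtain ⟨k1, k2, k3, k4, k5⟩ := pf_normal (K := K) c' fun b hb =>
      hc' b (Set.mem_insert_of_mem _ hb)
    have hh6 := h6 c hc
    have hk6 := h6 c' hc'
    have key : ∀ c : Fin 10 →₀ ℕ, c 6 = 0 →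
        (c.sum fun i n => n • MonomialOrder.lex.degree (psi K (X i))) =
        c.sum fun i n => n • (Finsupp.single (![0,0,1,0,1,2,0,1,3,2] i) 1 +
          Finsupp.single (![2,3,2,4,3,5,0,4,5,6] i) 1 : Fin 8 →₀ ℕ) := by
      intro c h
      refine Finset.sum_congr rfl fun i hi => ?_
      have hi6 : i ≠ 6 := by
        rintro rfl
        exact (Finsupp.mem_support_iff.1 hi) h
      simp only [(psi_X (K := K) i hi6).2]
    rw [key c hh6, key c' hk6] at h
    rw [Finsupp.sum_fintype _ _ (by simp), Finsupp.sum_fintype _ _ (by simp)] at h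
    have H := fun i => DFunLike.congr_fun h i
    have s := H 0
    have t := H 1
    have x5 := H 2
    have x4 := H 3
    have x3 := H 4
    have y3 := H 5
    have y4 := H 6
    simp [Fin.sum_univ_succ] at s t x5 x4 x3 y3 y4
    have := comb2 (c 0) (c 1) (c 2) (c 3) (c 4) (c 5) (c 6) (c 7) (c 8) (c 9)
      (c' 0) (c' 1) (c' 2) (c' 3) (c' 4) (c' 5) (c' 6) (c' 7) (c' 8) (c' 9)
      h1 h2 h3 h4 h5 k1 k2 k3 k4 k5 hh6 hk6 (by omega) (by omega) (by omega) (by omega) (by omega)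
      (by omega) (by omega)
    ext i
    fin_cases i <;> simp <;> omega

end Grav

namespace Grav
open MvPolynomial

/-- The Pluecker algebra of the Grassmannian `G(2,5)`. -/
abbrev PB (K : Type) [CommRing K] : Type := MvPolynomial (Fin 10) K ⧸ Ideal.span (pf K)

instance pf_prime {K : Type} [CommRing K] [IsDomain K] : (Ideal.span (pf K)).IsPrime := by
  rw [← phi_ker]; exact RingHom.ker_isPrime _

noncomputable def kap (K : Type) [CommRing K] :
    MvPolynomial (Fin 7) K →ₐ[K] MvPolynomial (Fin 10) K :=
  aeval ![X 6, X 3, X 1, X 0, X 7, X 4, X 2]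

theorem kap_X {K : Type} [CommRing K] (i : Fin 7) : kap K (X i) =
    (![X 6, X 3, X 1, X 0, X 7, X 4, X 2] : Fin 7 → MvPolynomial (Fin 10) K) i := by
  simp [kap]

theorem clear_X {K : Type} [CommRing K] (i : Fin 10) :
    ∃ c, X 6 * X i - kap K c ∈ Ideal.span (pf K) := by
  have key : ∀ c, X i = kap K c → ∃ c, X 6 * X i - kap K c ∈ Ideal.span (pf K) := by
    rintro c hc
    refine ⟨X 0 * c, ?_⟩
    rw [map_mul, ← hc, kap_X]
    simp
  fin_cases i
  · exact key (X 3) (by simp [kap_X])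
  · exact key (X 2) (by simp [kap_X])
  · exact key (X 6) (by simp [kap_X])
  · exact key (X 1) (by simp [kap_X])
  · exact key (X 5) (by simp [kap_X])
  · refine ⟨X 1 * X 6 - X 3 * X 4, ?_⟩
    have : (X 0 * X 7 - X 3 * X 2 + X 6 * X 5 : MvPolynomial (Fin 10) K) ∈ Ideal.span (pf K) :=
      Ideal.subset_span (by simp [pf])
    convert this using 1
    simp [kap_X]
    ring
  · exact key (X 0) (by simp [kap_X])
  · exact key (X 4) (by simp [kap_X])
  · refine ⟨X 1 * X 5 - X 2 * X 4, ?_⟩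
    have : (X 1 * X 7 - X 3 * X 4 + X 6 * X 8 : MvPolynomial (Fin 10) K) ∈ Ideal.span (pf K) :=
      Ideal.subset_span (by simp [pf])
    convert this using 1
    simp [kap_X]
    ring
  · refine ⟨X 2 * X 6 - X 3 * X 5, ?_⟩
    have : (X 0 * X 4 - X 1 * X 2 + X 6 * X 9 : MvPolynomial (Fin 10) K) ∈ Ideal.span (pf K) :=
      Ideal.subset_span (by simp [pf])
    convert this using 1
    simp [kap_X]
    ring

theorem clear_all {K : Type} [CommRing K] (r : MvPolynomial (Fin 10) K) :
    ∃ n c, X 6 ^ n * r - kap K c ∈ Ideal.span (pf K) := by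
  have h6 : kap K (X 0) = X 6 := by simp [kap_X]
  induction r using MvPolynomial.induction_on with
  | C a =>
    refine ⟨0, C a, ?_⟩
    have : kap K (C a) = C a := (kap K).commutes a
    simp [this]
  | add p q hp hq =>
    obtain ⟨n, c, h⟩ := hp
    obtain ⟨n', c', h'⟩ := hq
    refine ⟨n + n', X 0 ^ n' * c + X 0 ^ n * c', ?_⟩
    have := Ideal.add_mem _ (Ideal.mul_mem_left _ (X 6 ^ n') h)
      (Ideal.mul_mem_left _ (X 6 ^ n) h')
    convert this using 1
    simp only [map_add, map_mul, map_pow, h6]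
    ring
  | mul_X p i hp =>
    obtain ⟨n, c, h⟩ := hp
    obtain ⟨c', h'⟩ := clear_X (K := K) i
    refine ⟨n + 1, c * c', ?_⟩
    have := Ideal.add_mem _ (Ideal.mul_mem_left _ (X 6 * X i) h)
      (Ideal.mul_mem_left _ (kap K c) h')
    convert this using 1
    simp only [map_mul]
    ring

/-- The chart `p12 ≠ 0`. -/
abbrev PT (K : Type) [CommRing K] : Type := Localization.Away (X 0 : MvPolynomial (Fin 7) K)

noncomputable def rho (K : Type) [CommRing K] : MvPolynomial (Fin 10) K →ₐ[K] PT K :=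
  let a := algebraMap (MvPolynomial (Fin 7) K) (PT K)
  let q : PT K := IsLocalization.Away.invSelf (X 0 : MvPolynomial (Fin 7) K)
  aeval ![a (X 3), a (X 2), a (X 6), a (X 1), a (X 5), q * a (X 1 * X 6 - X 3 * X 4), a (X 0),
    a (X 4), q * a (X 1 * X 5 - X 2 * X 4), q * a (X 2 * X 6 - X 3 * X 5)]

theorem rho_kap {K : Type} [CommRing K] (c : MvPolynomial (Fin 7) K) :
    rho K (kap K c) = algebraMap _ (PT K) c := by
  have : (rho K).comp (kap K) = IsScalarTower.toAlgHom K (MvPolynomial (Fin 7) K) (PT K) := by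
    apply MvPolynomial.algHom_ext
    intro i
    rw [AlgHom.comp_apply, kap_X]
    fin_cases i <;> simp [rho]
  exact DFunLike.congr_fun this c

theorem rho_pf {K : Type} [CommRing K] (b : MvPolynomial (Fin 10) K)
    (hb : b ∈ pf K) : rho K b = 0 := by
  have hq : algebraMap _ (PT K) (X 0 : MvPolynomial (Fin 7) K) *
    (IsLocalization.Away.invSelf (X 0 : MvPolynomial (Fin 7) K) : PT K) = 1 :=
    IsLocalization.Away.mul_invSelf _
  let z : Fin 7 → PT K := fun i => algebraMap _ (PT K) (X i : MvPolynomial (Fin 7) K)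
  rcases hb with rfl | rfl | rfl | rfl | rfl
  all_goals
    simp only [rho, map_add, map_sub, map_mul, aeval_X]
    simp
    generalize (IsLocalization.Away.invSelf (X 0 : MvPolynomial (Fin 7) K) : PT K) = q at *
    generalize algebraMap _ (PT K) (X 0 : MvPolynomial (Fin 7) K) = z0 at *
  · linear_combination (z 1 * z 5 - z 2 * z 4) * hq
  · linear_combination (z 1 * z 6 - z 3 * z 4) * hq
  · linear_combination (z 2 * z 6 - z 3 * z 5) * hq
  · ring
  · ring

theorem rho_inj {K : Type} [CommRing K] [IsDomain K] (r : MvPolynomial (Fin 10) K)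
    (h : rho K r = 0) : r ∈ Ideal.span (pf K) := by
  obtain ⟨n, c, hc⟩ := clear_all r
  have hle : Ideal.span (pf K) ≤ RingHom.ker (rho K) := Ideal.span_le.2 rho_pf
  have h1 : rho K (X 6 ^ n * r - kap K c) = 0 := hle hc
  rw [map_sub, map_mul, h, mul_zero, zero_sub, neg_eq_zero, rho_kap] at h1
  have hc0 : c = 0 := by
    have hinj : Function.Injective (algebraMap (MvPolynomial (Fin 7) K) (PT K)) :=
      IsLocalization.injective (PT K) (M := Submonoid.powers (X 0 : MvPolynomial (Fin 7) K))
        (powers_le_nonZeroDivisors_of_noZeroDivisors (X_ne_zero 0))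
    exact hinj (by simpa using h1)
  rw [hc0, map_zero, sub_zero] at hc
  rcases pf_prime.mem_or_mem hc with h2 | h2
  · exfalso
    have h3 := pf_prime.mem_of_pow_mem _ h2
    rw [← phi_ker] at h3
    have h4 : phi K (X 6) = 0 := h3
    have := (phi_X (K := K) 6).1
    simp [h4] at this
  · exact h2

theorem PB_normal_aux {K : Type} [CommRing K] [IsDomain K] [UniqueFactorizationMonoid K]
    (F : Type) [Field F] [Algebra (PT K) F] [IsFractionRing (PT K) F] :
    IsIntegrallyClosed (PB K) := by
  have hM : Submonoid.powers (X 0 : MvPolynomial (Fin 7) K) ≤ nonZeroDivisors _ :=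
    powers_le_nonZeroDivisors_of_noZeroDivisors (X_ne_zero 0)
  have hTd : IsDomain (PT K) := IsLocalization.isDomain_localization hM
  have hTn : IsIntegrallyClosed (PT K) :=
    isIntegrallyClosed_of_isLocalization (PT K) (Submonoid.powers (X 0 : MvPolynomial (Fin 7) K)) hM
  let ρ : PB K →+* PT K := Ideal.Quotient.lift _ (rho K : MvPolynomial (Fin 10) K →+* PT K)
    (fun a ha => (Ideal.span_le.2 rho_pf : Ideal.span (pf K) ≤ RingHom.ker (rho K)) ha)
  have hρ : Function.Injective ρ := by
    rw [injective_iff_map_eq_zero]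
    intro b hb
    obtain ⟨r, rfl⟩ := Ideal.Quotient.mk_surjective b
    rw [Ideal.Quotient.eq_zero_iff_mem]
    exact rho_inj r hb
  let : Algebra (PB K) (PT K) := ρ.toAlgebra
  let : Algebra (PB K) F := ((algebraMap (PT K) F).comp ρ).toAlgebra
  have : IsScalarTower (PB K) (PT K) F := IsScalarTower.of_algebraMap_eq fun _ => rfl
  have hTF : Function.Injective (algebraMap (PT K) F) := IsFractionRing.injective _ _
  have hinj : Function.Injective (algebraMap (PB K) F) := hTF.comp hρ
  let p : PB K := Ideal.Quotient.mk _ (X 6)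
  have hclear : ∀ t : PT K, ∃ n b, ρ p ^ n * t = ρ b := by
    intro t
    obtain ⟨⟨c, ⟨_, n, rfl⟩⟩, hc⟩ :=
      IsLocalization.surj (Submonoid.powers (X 0 : MvPolynomial (Fin 7) K)) t
    refine ⟨n, Ideal.Quotient.mk _ (kap K c), ?_⟩
    have h1 : ρ (Ideal.Quotient.mk _ (kap K c)) = algebraMap _ (PT K) c := rho_kap c
    have h2 : ρ p = algebraMap (MvPolynomial (Fin 7) K) (PT K) (X 0) := by
      rw [← rho_kap, kap_X]; rfl
    rw [h1, ← hc, h2, mul_comm]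
    simp
  have hp : p ≠ 0 := by
    intro h
    rw [Ideal.Quotient.eq_zero_iff_mem, ← phi_ker] at h
    have h4 : phi K (X 6) = 0 := h
    have := (phi_X (K := K) 6).1
    simp [h4] at this
  have hρp : ρ p ≠ 0 := fun h => hp (hρ (by simpa using h))
  have : FaithfulSMul (PB K) F := (faithfulSMul_iff_algebraMap_injective _ _).2 hinj
  have : IsFractionRing (PB K) F := by
    refine IsFractionRing.of_field _ _ fun z => ?_
    obtain ⟨t, t', -, rfl⟩ := IsFractionRing.div_surjective (A := PT K) z
    obtain ⟨n, b, hb⟩ := hclear t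
    obtain ⟨n', b', hb'⟩ := hclear t'
    refine ⟨p ^ n' * b, p ^ n * b', ?_⟩
    have e : ∀ x, algebraMap (PB K) F x = algebraMap (PT K) F (ρ x) := fun _ => rfl
    rw [e, e, map_mul ρ, map_mul ρ, ← hb, ← hb']
    have hpF : algebraMap (PT K) F (ρ p) ≠ 0 := fun h => hρp (hTF (h.trans (map_zero _).symm))
    simp only [map_mul, map_pow]
    rw [← mul_assoc, ← mul_assoc, mul_comm (algebraMap (PT K) F (ρ p) ^ n'),
      mul_div_mul_left _ _ (mul_ne_zero (pow_ne_zero _ hpF) (pow_ne_zero _ hpF))]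
  have hrad : ∀ (b : PB K) (m : ℕ), p ∣ b ^ m → p ∣ b := by
    intro b m h
    obtain ⟨r, rfl⟩ := Ideal.Quotient.mk_surjective b
    have hJ : (Ideal.span (insert (X 6) (pf K))).IsPrime := by
      rw [← psi_ker]; exact RingHom.ker_isPrime _
    have hiff : ∀ s : MvPolynomial (Fin 10) K, p ∣ (Ideal.Quotient.mk (Ideal.span (pf K)) s) ↔
        s ∈ Ideal.span (insert (X 6) (pf K)) := by
      intro s
      rw [Ideal.span_insert, Submodule.mem_sup]
      constructor
      · rintro ⟨c, hc⟩
        obtain ⟨c, rfl⟩ := Ideal.Quotient.mk_surjective c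
        refine ⟨X 6 * c, Ideal.mul_mem_right _ _ (Ideal.mem_span_singleton_self _), s - X 6 * c,
          ?_, by ring⟩
        rw [← Ideal.Quotient.eq, hc, map_mul]
      · rintro ⟨y, hy, z, hz, rfl⟩
        obtain ⟨c, rfl⟩ := Ideal.mem_span_singleton.1 hy
        rw [map_add, Ideal.Quotient.eq_zero_iff_mem.2 hz, add_zero, map_mul]
        exact dvd_mul_right _ _
    rw [← map_pow, hiff] at h
    rw [hiff]
    exact hJ.mem_of_pow_mem _ h
  rw [isIntegrallyClosed_iff F]
  intro x hx
  obtain ⟨t, rfl⟩ := (isIntegrallyClosed_iff (R := PT K) F).1 hTn (hx.tower_top (A := PT K))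
  obtain ⟨n, b, hb⟩ := hclear t
  obtain ⟨b', hb'⟩ := descent hinj p hp hrad n _ hx ⟨b, by
    show algebraMap (PT K) F (ρ p) ^ n * _ = algebraMap (PT K) F (ρ b)
    rw [← hb]; simp⟩
  exact ⟨b', hb'.symm⟩

theorem PB_normal {K : Type} [CommRing K] [IsDomain K] [UniqueFactorizationMonoid K] :
    IsIntegrallyClosed (PB K) := by
  have hM : Submonoid.powers (X 0 : MvPolynomial (Fin 7) K) ≤ nonZeroDivisors _ :=
    powers_le_nonZeroDivisors_of_noZeroDivisors (X_ne_zero 0)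
  have hTd : IsDomain (PT K) := IsLocalization.isDomain_localization hM
  exact PB_normal_aux (FractionRing (PT K))

end Grav

namespace Grav
open MvPolynomial

section
variable {S : Type*} [CommRing S]
/-- The coefficient of (E1). -/
def c1 (l : Finset (Fin 5) → S) : S :=
  (l ∅ * l {0,1,2,3,4}) + (l {0} * l {1,2,3,4}) - (l {0,2,3,4} * l {1}) + (l {0,1,3,4} * l
    {2}) - (l {0,1,2,4} * l {3}) + (l {0,1,2,3} * l {4}) - (l {0,1} * l {2,3,4}) + (l {0,2}
    * l {1,3,4}) - (l {0,3} * l {1,2,4}) + (l {0,4} * l {1,2,3}) - (l {0,3,4} * l {1,2}) +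
    (l {0,2,4} * l {1,3}) - (l {0,2,3} * l {1,4}) - (l {0,1,4} * l {2,3}) + (l {0,1,3} * l
    {2,4}) - (l {0,1,2} * l {3,4})

/-- Half of the coefficients of (E2); index `i` is the complement of `{i}`. -/
def c2 (l : Finset (Fin 5) → S) : Fin 5 → S := ![
  -(l ∅ * l {1,2,3,4}) - (l {1} * l {2,3,4}) + (l {1,3,4} * l {2}) - (l {1,2,4} * l {3}) +
    (l {1,2,3} * l {4}) + (l {1,2} * l {3,4}) - (l {1,3} * l {2,4}) + (l {1,4} * l {2,3}),
  -(l ∅ * l {0,2,3,4}) - (l {0} * l {2,3,4}) + (l {0,3,4} * l {2}) - (l {0,2,4} * l {3}) +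
    (l {0,2,3} * l {4}) + (l {0,2} * l {3,4}) - (l {0,3} * l {2,4}) + (l {0,4} * l {2,3}),
  -(l ∅ * l {0,1,3,4}) - (l {0} * l {1,3,4}) + (l {0,3,4} * l {1}) - (l {0,1,4} * l {3}) +
    (l {0,1,3} * l {4}) + (l {0,1} * l {3,4}) - (l {0,3} * l {1,4}) + (l {0,4} * l {1,3}),
  -(l ∅ * l {0,1,2,4}) - (l {0} * l {1,2,4}) + (l {0,2,4} * l {1}) - (l {0,1,4} * l {2}) +
    (l {0,1,2} * l {4}) + (l {0,1} * l {2,4}) - (l {0,2} * l {1,4}) + (l {0,4} * l {1,2}),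
  -(l ∅ * l {0,1,2,3}) - (l {0} * l {1,2,3}) + (l {0,2,3} * l {1}) - (l {0,1,3} * l {2}) +
    (l {0,1,2} * l {3}) + (l {0,1} * l {2,3}) - (l {0,2} * l {1,3}) + (l {0,3} * l {1,2})]

/-- Half of the coefficients of (E3). -/
def c3 (l : Finset (Fin 5) → S) : Fin 5 → S := ![
  -(l {0} * l {0,1,2,3,4}) - (l {0,1} * l {0,2,3,4}) + (l {0,1,3,4} * l {0,2}) - (l
    {0,1,2,4} * l {0,3}) + (l {0,1,2,3} * l {0,4}) + (l {0,1,2} * l {0,3,4}) - (l {0,1,3} *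
    l {0,2,4}) + (l {0,1,4} * l {0,2,3}),
  -(l {0,1,2,3,4} * l {1}) - (l {0,1} * l {1,2,3,4}) + (l {0,1,3,4} * l {1,2}) - (l
    {0,1,2,4} * l {1,3}) + (l {0,1,2,3} * l {1,4}) + (l {0,1,2} * l {1,3,4}) - (l {0,1,3} *
    l {1,2,4}) + (l {0,1,4} * l {1,2,3}),
  -(l {0,1,2,3,4} * l {2}) - (l {0,2} * l {1,2,3,4}) + (l {0,2,3,4} * l {1,2}) - (l
    {0,1,2,4} * l {2,3}) + (l {0,1,2,3} * l {2,4}) + (l {0,1,2} * l {2,3,4}) - (l {0,2,3} *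
    l {1,2,4}) + (l {0,2,4} * l {1,2,3}),
  -(l {0,1,2,3,4} * l {3}) - (l {0,3} * l {1,2,3,4}) + (l {0,2,3,4} * l {1,3}) - (l
    {0,1,3,4} * l {2,3}) + (l {0,1,2,3} * l {3,4}) + (l {0,1,3} * l {2,3,4}) - (l {0,2,3} *
    l {1,3,4}) + (l {0,3,4} * l {1,2,3}),
  -(l {0,1,2,3,4} * l {4}) - (l {0,4} * l {1,2,3,4}) + (l {0,2,3,4} * l {1,4}) - (l
    {0,1,3,4} * l {2,4}) + (l {0,1,2,4} * l {3,4}) + (l {0,1,4} * l {2,3,4}) - (l {0,2,4} *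
    l {1,3,4}) + (l {0,3,4} * l {1,2,4})]

variable {A : Type*} [Ring A] [Algebra S A] (e : Fin 5 → A) (l : Finset (Fin 5) → S)

def W1 : A :=
  l {0} • (e 0) + l {1} • (e 1) + l {2} • (e 2) + l {3} • (e 3) + l {4} • (e 4)
def W2 : A :=
  l {0,1} • (e 0 * (e 1)) + l {0,2} • (e 0 * (e 2)) + l {0,3} • (e 0 * (e 3)) + l {0,4} • (e
    0 * (e 4)) + l {1,2} • (e 1 * (e 2)) + l {1,3} • (e 1 * (e 3)) + l {1,4} • (e 1 * (e 4))
    + l {2,3} • (e 2 * (e 3)) + l {2,4} • (e 2 * (e 4)) + l {3,4} • (e 3 * (e 4))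
def W3 : A :=
  l {0,1,2} • (e 0 * (e 1 * (e 2))) + l {0,1,3} • (e 0 * (e 1 * (e 3))) + l {0,1,4} • (e 0 *
    (e 1 * (e 4))) + l {0,2,3} • (e 0 * (e 2 * (e 3))) + l {0,2,4} • (e 0 * (e 2 * (e 4))) +
    l {0,3,4} • (e 0 * (e 3 * (e 4))) + l {1,2,3} • (e 1 * (e 2 * (e 3))) + l {1,2,4} • (e 1
    * (e 2 * (e 4))) + l {1,3,4} • (e 1 * (e 3 * (e 4))) + l {2,3,4} • (e 2 * (e 3 * (e 4)))
def W4 : A :=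
  l {0,1,2,3} • (e 0 * (e 1 * (e 2 * (e 3)))) + l {0,1,2,4} • (e 0 * (e 1 * (e 2 * (e 4))))
    + l {0,1,3,4} • (e 0 * (e 1 * (e 3 * (e 4)))) + l {0,2,3,4} • (e 0 * (e 2 * (e 3 * (e
    4)))) + l {1,2,3,4} • (e 1 * (e 2 * (e 3 * (e 4))))
def W5 : A :=
  l {0,1,2,3,4} • (e 0 * (e 1 * (e 2 * (e 3 * (e 4)))))

variable {e}
theorem ac (h0 : ∀ i, e i * e i = 0) (hc : ∀ i j, e i * e j = -(e j * e i)) :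
    (∀ i x, e i * (e i * x) = 0) ∧ ∀ i j x, e i * (e j * x) = -(e j * (e i * x)) := by
  refine ⟨fun i x => by rw [← mul_assoc, h0, zero_mul], fun i j x => ?_⟩
  rw [← mul_assoc, hc, neg_mul, mul_assoc]

/-- top form -/

def top5 (e : Fin 5 → A) : A := e 0 * (e 1 * (e 2 * (e 3 * (e 4))))

theorem E1_eq (h0 : ∀ i, e i * e i = 0) (hc : ∀ i j, e i * e j = -(e j * e i)) :
    l ∅ • W5 e l + W1 e l * W4 e l - W2 e l * W3 e l = c1 l • top5 e := by
  obtain ⟨h02, hc2⟩ := ac h0 hc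
  simp only [W1, W2, W3, W4, W5, c1, top5, mul_add, add_mul, smul_mul_assoc, mul_smul_comm, smul_smul, mul_assoc,
    map_add, map_smul, hc 1 0, hc 2 0, hc 2 1, hc 3 0, hc 3 1, hc 3 2, hc 4 0, hc 4 1, hc 4 2, hc 4 3,
    hc2 1 0, hc2 2 0, hc2 2 1, hc2 3 0, hc2 3 1, hc2 3 2, hc2 4 0, hc2 4 1, hc2 4 2, hc2 4 3, h0, h02, mul_neg, neg_mul, neg_neg, smul_neg, mul_zero, smul_zero, neg_zero, add_zero,
    zero_add]
  all_goals module

/-- the forms of degree four -/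
def hat (e : Fin 5 → A) : Fin 5 → A := ![
  e 1 * (e 2 * (e 3 * (e 4))),
  e 0 * (e 2 * (e 3 * (e 4))),
  e 0 * (e 1 * (e 3 * (e 4))),
  e 0 * (e 1 * (e 2 * (e 4))),
  e 0 * (e 1 * (e 2 * (e 3)))]

theorem E2_eq (h0 : ∀ i, e i * e i = 0) (hc : ∀ i j, e i * e j = -(e j * e i)) :
    -(2 • (l ∅ • W4 e l)) - 2 • (W1 e l * W3 e l) + W2 e l * W2 e l =
      (2 : S) • (c2 l 0 • hat e 0 + c2 l 1 • hat e 1 + c2 l 2 • hat e 2 + c2 l 3 • hat e 3 +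
        c2 l 4 • hat e 4) := by
  obtain ⟨h02, hc2⟩ := ac h0 hc
  simp only [W1, W2, W3, W4, c2, hat, Matrix.cons_val, mul_add, add_mul, smul_mul_assoc, mul_smul_comm, smul_smul, mul_assoc,
    map_add, map_smul, hc 1 0, hc 2 0, hc 2 1, hc 3 0, hc 3 1, hc 3 2, hc 4 0, hc 4 1, hc 4 2, hc 4 3,
    hc2 1 0, hc2 2 0, hc2 2 1, hc2 3 0, hc2 3 1, hc2 3 2, hc2 4 0, hc2 4 1, hc2 4 2, hc2 4 3, h0, h02, mul_neg, neg_mul, neg_neg, smul_neg, mul_zero, smul_zero, neg_zero, add_zero,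
    zero_add]
  all_goals module

theorem E3_eq (h0 : ∀ i, e i * e i = 0) (hc : ∀ i j, e i * e j = -(e j * e i))
    (r : Fin 5) (D : A →ₗ[S] A) (hD : ∀ i, D (e i) = if r = i then 1 else 0)
    (hD2 : ∀ i x, D (e i * x) = (if r = i then x else 0) - e i * D x) :
    -(2 • (D (W1 e l) * W5 e l)) + 2 • (D (W2 e l) * W4 e l) + D (W3 e l) * W3 e l =
      (2 : S) • (c3 l r • top5 e) := by
  obtain ⟨h02, hc2⟩ := ac h0 hc
  have hD' : ∀ i j, D (e i * e j) = (if r = i then e j else 0) - (if r = j then e i else 0) := by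
    intro i j; rw [hD2, hD]; split_ifs <;> simp
  have hD3 : ∀ i j k, D (e i * (e j * e k)) = (if r = i then e j * e k else 0) -
      (if r = j then e i * e k else 0) + (if r = k then e i * e j else 0) := by
    intro i j k; rw [hD2, hD']; rw [mul_sub, mul_ite, mul_ite, mul_zero]; abel
  fin_cases r <;>
  simp only [W1, W2, W3, W4, W5, c3, top5, Matrix.cons_val, hD, hD', hD3, Fin.isValue, Fin.reduceFinMk,
    Fin.zero_eta, Fin.mk_one, Fin.reduceEq, if_true, if_false, one_ne_zero, zero_ne_one, sub_zero, zero_sub, one_mul, zero_mul, sub_mul, mul_add, add_mul, smul_mul_assoc, mul_smul_comm, smul_smul, mul_assoc,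
    map_add, map_smul, hc 1 0, hc 2 0, hc 2 1, hc 3 0, hc 3 1, hc 3 2, hc 4 0, hc 4 1, hc 4 2, hc 4 3,
    hc2 1 0, hc2 2 0, hc2 2 1, hc2 3 0, hc2 3 1, hc2 3 2, hc2 4 0, hc2 4 1, hc2 4 2, hc2 4 3, h0, h02, mul_neg, neg_mul, neg_neg, smul_neg, mul_zero, smul_zero, neg_zero, add_zero,
    zero_add]
  all_goals module

end
end Grav

namespace Grav
open MvPolynomial

/-- basis vectors -/
noncomputable def ee (i : Fin 5) : Ext5 := ExteriorAlgebra.ι R32 (Pi.single i 1)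

theorem ee_sq (i : Fin 5) : ee i * ee i = 0 := ExteriorAlgebra.ι_sq_zero _

theorem ee_ac (i j : Fin 5) : ee i * ee j = -(ee j * ee i) :=
  eq_neg_of_add_eq_zero_left (ExteriorAlgebra.ι_add_mul_swap _ _)

theorem eS_list (l : List (Fin 5)) (h1 : l.Pairwise (· ≤ ·)) (h2 : l.Nodup) :
    eS l.toFinset = (l.map ee).prod := by
  unfold eS
  rw [(List.toFinset_sort (· ≤ ·) h2).2 h1]
  rfl

theorem ctr_ee (r i : Fin 5) : ctr r (ee i) = if r = i then 1 else 0 := by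
  have := CliffordAlgebra.contractLeft_ι (Q := (0 : QuadraticForm R32 (Fin 5 → R32)))
    (LinearMap.proj r) (Pi.single i 1)
  refine this.trans ?_
  by_cases h : r = i
  · subst h; simp
  · simp [h]

theorem ctr_ee_mul (r i : Fin 5) (x : Ext5) :
    ctr r (ee i * x) = (if r = i then x else 0) - ee i * ctr r x := by
  have := CliffordAlgebra.contractLeft_ι_mul (Q := (0 : QuadraticForm R32 (Fin 5 → R32)))
    (d := LinearMap.proj r) (Pi.single i 1) x
  refine this.trans ?_
  by_cases h : r = i
  · subst h; simp [ee, ExteriorAlgebra.ι]; rfl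
  · simp [h, ee, ExteriorAlgebra.ι]; rfl

theorem eS1 (a : Fin 5) : eS {a} = ee a := by
  simpa using eS_list [a] (by simp) (by simp)

theorem eS2 {a b : Fin 5} (h : a < b) : eS {a, b} = ee a * ee b := by
  simpa using eS_list [a, b] (by simp [h.le]) (by simp [h.ne])

theorem eS3 {a b c : Fin 5} (h : a < b ∧ b < c) : eS {a, b, c} = ee a * (ee b * ee c) := by
  have h1 := h.1.trans h.2
  simpa using eS_list [a, b, c] (by simp [h.1.le, h.2.le, h1.le]) (by simp [h.1.ne, h.2.ne, h1.ne])

theorem eS4 {a b c d : Fin 5} (h : [a, b, c, d].Pairwise (· ≤ ·) ∧ [a, b, c, d].Nodup) :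
    eS {a, b, c, d} = ee a * (ee b * (ee c * ee d)) := by
  simpa using eS_list [a, b, c, d] h.1 h.2

theorem eS5 : eS {0, 1, 2, 3, 4} = ee 0 * (ee 1 * (ee 2 * (ee 3 * ee 4))) := by
  simpa using eS_list [0, 1, 2, 3, 4] (by decide) (by decide)

theorem lamb1 : lamb 1 = W1 ee (fun S => (X S : R32)) := by
  have h : Finset.univ.filter (fun S : Finset (Fin 5) => S.card = 1) =
      {{0}, {1}, {2}, {3}, {4}} := by decide
  rw [lamb, h, W1]
  repeat rw [Finset.sum_insert (by decide)]
  rw [Finset.sum_singleton]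
  simp only [← add_assoc]
  simp only [eS1]

theorem lamb2 : lamb 2 = W2 ee (fun S => (X S : R32)) := by
  have h : Finset.univ.filter (fun S : Finset (Fin 5) => S.card = 2) =
      {{0,1}, {0,2}, {0,3}, {0,4}, {1,2}, {1,3}, {1,4}, {2,3}, {2,4}, {3,4}} := by decide
  rw [lamb, h, W2]
  repeat rw [Finset.sum_insert (by decide)]
  rw [Finset.sum_singleton]
  simp only [← add_assoc]
  repeat rw [eS2 (by decide)]

theorem lamb3 : lamb 3 = W3 ee (fun S => (X S : R32)) := by
  have h : Finset.univ.filter (fun S : Finset (Fin 5) => S.card = 3) =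
      {{0,1,2}, {0,1,3}, {0,1,4}, {0,2,3}, {0,2,4}, {0,3,4}, {1,2,3}, {1,2,4}, {1,3,4},
    {2,3,4}} := by decide
  rw [lamb, h, W3]
  repeat rw [Finset.sum_insert (by decide)]
  rw [Finset.sum_singleton]
  simp only [← add_assoc]
  repeat rw [eS3 (by decide)]

theorem lamb4 : lamb 4 = W4 ee (fun S => (X S : R32)) := by
  have h : Finset.univ.filter (fun S : Finset (Fin 5) => S.card = 4) =
      {{0,1,2,3}, {0,1,2,4}, {0,1,3,4}, {0,2,3,4}, {1,2,3,4}} := by decide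
  rw [lamb, h, W4]
  repeat rw [Finset.sum_insert (by decide)]
  rw [Finset.sum_singleton]
  simp only [← add_assoc]
  repeat rw [eS4 (by decide)]

theorem lamb5 : lamb 5 = W5 ee (fun S => (X S : R32)) := by
  have h : Finset.univ.filter (fun S : Finset (Fin 5) => S.card = 5) =
      {{0,1,2,3,4}} := by decide
  rw [lamb, h, W5]
  rw [Finset.sum_singleton]
  rw [eS5]


theorem E1_expand : E1 = c1 (fun S => (X S : R32)) • top5 ee := by
  rw [E1, lamb1, lamb2, lamb3, lamb4, lamb5]
  exact E1_eq _ ee_sq ee_ac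

theorem E2_expand : E2 = (2 : R32) • (c2 (fun S => (X S : R32)) 0 • hat ee 0 +
    c2 (fun S => (X S : R32)) 1 • hat ee 1 + c2 (fun S => (X S : R32)) 2 • hat ee 2 +
    c2 (fun S => (X S : R32)) 3 • hat ee 3 + c2 (fun S => (X S : R32)) 4 • hat ee 4) := by
  rw [E2, lamb1, lamb2, lamb3, lamb4]
  exact E2_eq _ ee_sq ee_ac

theorem E3_expand (r : Fin 5) :
    E3 r = (2 : R32) • (c3 (fun S => (X S : R32)) r • top5 ee) := by
  rw [E3, lamb1, lamb2, lamb3, lamb4, lamb5]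
  exact E3_eq _ ee_sq ee_ac r (ctr r) (ctr_ee r) (ctr_ee_mul r)

/-- the functional `coefficient of the top form` -/
noncomputable def tau : Ext5 →ₗ[R32] R32 :=
  (ExteriorAlgebra.algebraMapInv (R := R32) (M := Fin 5 → R32)).toLinearMap ∘ₗ
    ctr 4 ∘ₗ ctr 3 ∘ₗ ctr 2 ∘ₗ ctr 1 ∘ₗ ctr 0

theorem tau_top : tau (top5 ee) = 1 := by
  simp [tau, top5, ctr_ee_mul, ctr_ee]

theorem mem_of_functional {J : Ideal R32} (f : Ext5 →ₗ[R32] R32) {x : Ext5}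
    (hx : x ∈ J • (⊤ : Submodule R32 Ext5)) : f x ∈ J := by
  refine Submodule.smul_induction_on hx (fun r hr n _ => ?_) (fun x y hx hy => ?_)
  · rw [map_smul, smul_eq_mul]; exact J.mul_mem_right _ hr
  · rw [map_add]; exact J.add_mem hx hy

theorem ee_hat (i j : Fin 5) :
    tau (ee i * hat ee j) = if i = j then (![1, -1, 1, -1, 1] : Fin 5 → R32) i else 0 := by
  have hc := ee_ac
  obtain ⟨h02, hc2⟩ := ac ee_sq ee_ac
  have ht := tau_top
  simp only [top5] at ht
  fin_cases i <;> fin_cases j <;>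
  simp [hat, ee_sq, h02, mul_assoc, hc2 1 0, hc2 2 0, hc2 3 0, hc2 4 0, hc2 2 1, hc2 3 1, hc2 4 1,
    hc2 3 2, hc2 4 2, hc2 4 3, hc 4 3, ht]

theorem of_two_mul {J : Ideal R32} {c : R32} (h : 2 * c ∈ J) : c ∈ J := by
  have : c = C (1 / 2 : ℂ) * (2 * c) := by
    have h2 : (2 : R32) = C (2 : ℂ) := by rw [map_ofNat]
    rw [h2, ← mul_assoc, ← C_mul]; norm_num
  rw [this]; exact J.mul_mem_left _ h

theorem good_iff (J : Ideal R32) :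
    (E1 ∈ J • (⊤ : Submodule R32 Ext5) ∧ E2 ∈ J • (⊤ : Submodule R32 Ext5) ∧
      ∀ r : Fin 5, E3 r ∈ J • (⊤ : Submodule R32 Ext5)) ↔
    (c1 (fun S => (X S : R32)) ∈ J ∧ (∀ i, c2 (fun S => (X S : R32)) i ∈ J) ∧
      ∀ i, c3 (fun S => (X S : R32)) i ∈ J) := by
  constructor
  · rintro ⟨h1, h2, h3⟩
    refine ⟨?_, fun i => ?_, fun i => ?_⟩
    · have := mem_of_functional tau h1
      rwa [E1_expand, map_smul, tau_top, smul_eq_mul, mul_one] at this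
    · have := mem_of_functional (tau ∘ₗ LinearMap.mulLeft R32 (ee i)) h2
      rw [E2_expand, LinearMap.comp_apply, LinearMap.mulLeft_apply] at this
      simp only [mul_add, mul_smul_comm, map_add, map_smul, ee_hat] at this
      apply of_two_mul
      fin_cases i <;> simpa using this
    · have := mem_of_functional tau (h3 i)
      rw [E3_expand, map_smul, map_smul, tau_top, smul_eq_mul, smul_eq_mul, mul_one] at this
      exact of_two_mul this
  · rintro ⟨h1, h2, h3⟩
    refine ⟨?_, ?_, fun i => ?_⟩
    · rw [E1_expand]; exact Submodule.smul_mem_smul h1 trivial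
    · rw [E2_expand]
      refine Submodule.smul_mem _ _ ?_
      repeat' apply Submodule.add_mem
      all_goals exact Submodule.smul_mem_smul (h2 _) trivial
    · rw [E3_expand]
      exact Submodule.smul_mem _ _ (Submodule.smul_mem_smul (h3 _) trivial)

theorem Igrav_le_iff {J : Ideal R32} : Igrav ≤ J ↔
    (c1 (fun S => (X S : R32)) ∈ J ∧ (∀ i, c2 (fun S => (X S : R32)) i ∈ J) ∧
      ∀ i, c3 (fun S => (X S : R32)) i ∈ J) := by
  constructor
  · intro h
    have key : c1 (fun S => (X S : R32)) ∈ Igrav ∧ (∀ i, c2 (fun S => (X S : R32)) i ∈ Igrav) ∧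
        ∀ i, c3 (fun S => (X S : R32)) i ∈ Igrav := by
      refine ⟨?_, fun i => ?_, fun i => ?_⟩ <;>
      · rw [Igrav, Submodule.mem_sInf]
        intro I hI
        have := (good_iff I).1 hI
        first | exact this.1 | exact this.2.1 i | exact this.2.2 i
    exact ⟨h key.1, fun i => h (key.2.1 i), fun i => h (key.2.2 i)⟩
  · intro h
    exact sInf_le ((good_iff J).2 h)

end Grav

namespace Grav
open MvPolynomial

/-- binary code of a subset -/
def code (S : Finset (Fin 5)) : Fin 32 := ∑ i ∈ S, ![1, 2, 4, 8, 16] i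

/-- inverse of `code` -/
def tab : Fin 32 → Finset (Fin 5) := ![
  ∅, {0}, {1}, {0,1}, {2}, {0,2}, {1,2}, {0,1,2}, {3}, {0,3}, {1,3}, {0,1,3}, {2,3},
    {0,2,3}, {1,2,3}, {0,1,2,3}, {4}, {0,4}, {1,4}, {0,1,4}, {2,4}, {0,2,4}, {1,2,4},
    {0,1,2,4}, {3,4}, {0,3,4}, {1,3,4}, {0,1,3,4}, {2,3,4}, {0,2,3,4}, {1,2,3,4},
    {0,1,2,3,4}]

theorem tab_code : ∀ S, tab (code S) = S := by decide
theorem code_tab : ∀ i, code (tab i) = i := by decide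

section
variable {T : Type*} [CommRing T]

/-- The Pluecker relations. -/
def rel (p : Fin 10 → T) : Fin 5 → T := ![
  p 2 * p 8 - p 4 * p 5 + p 7 * p 9,
  p 0 * p 8 - p 1 * p 5 + p 3 * p 9,
  p 0 * p 4 - p 1 * p 2 + p 6 * p 9,
  p 0 * p 7 - p 3 * p 2 + p 6 * p 5,
  p 1 * p 7 - p 3 * p 4 + p 6 * p 8]

variable (v : Fin 16 → T) (p : Fin 10 → T) (q : T)

/-- components of degree three -/
def b3 : Fin 10 → T := ![
  p 0 + q * (v 2 * v 13 - v 11 * v 3 + v 10 * v 4),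
  p 1 + q * (v 2 * v 14 - v 12 * v 3 + v 10 * v 5),
  p 2 + q * (v 1 * v 13 - v 8 * v 3 + v 7 * v 4),
  p 3 + q * (v 2 * v 15 - v 12 * v 4 + v 11 * v 5),
  p 4 + q * (v 1 * v 14 - v 9 * v 3 + v 7 * v 5),
  p 5 + q * (v 1 * v 11 - v 8 * v 2 + v 6 * v 4),
  p 6 + q * (v 3 * v 15 - v 14 * v 4 + v 13 * v 5),
  p 7 + q * (v 1 * v 15 - v 9 * v 4 + v 8 * v 5),
  p 8 + q * (v 1 * v 12 - v 9 * v 2 + v 6 * v 5),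
  p 9 + q * (v 1 * v 10 - v 7 * v 2 + v 6 * v 3)]

/-- components of degree four -/
def b4 : Fin 5 → T := ![
  q * (v 10 * v 15 - v 11 * v 14 + v 12 * v 13 - v 2 * b3 v p q 6 + b3 v p q 3 * v 3 - b3 v
    p q 1 * v 4 + b3 v p q 0 * v 5),
  q * (v 7 * v 15 - v 8 * v 14 + v 9 * v 13 - v 1 * b3 v p q 6 + b3 v p q 7 * v 3 - b3 v p q
    4 * v 4 + b3 v p q 2 * v 5),
  q * (v 6 * v 15 - v 8 * v 12 + v 9 * v 11 - v 1 * b3 v p q 3 + b3 v p q 7 * v 2 - b3 v p q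
    8 * v 4 + b3 v p q 5 * v 5),
  q * (v 6 * v 14 - v 7 * v 12 + v 9 * v 10 - v 1 * b3 v p q 1 + b3 v p q 4 * v 2 - b3 v p q
    8 * v 3 + b3 v p q 9 * v 5),
  q * (v 6 * v 13 - v 7 * v 11 + v 8 * v 10 - v 1 * b3 v p q 0 + b3 v p q 2 * v 2 - b3 v p q
    5 * v 3 + b3 v p q 9 * v 4)]

/-- component of degree five -/
def b5 : T :=
  q * (v 6 * b3 v p q 6 - v 7 * b3 v p q 3 + v 8 * b3 v p q 1 - v 9 * b3 v p q 0 + b3 v p q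
    7 * v 10 - b3 v p q 4 * v 11 + b3 v p q 2 * v 12 + b3 v p q 8 * v 13 - b3 v p q 5 * v 14
    + b3 v p q 9 * v 15 - v 1 * b4 v p q 0 + b4 v p q 1 * v 2 - b4 v p q 2 * v 3 + b4 v p q
    3 * v 4 - b4 v p q 4 * v 5)

/-- all components, ordered by `code` -/
def tbl : Fin 32 → T := ![
  v 0, v 1, v 2, v 6, v 3, v 7, v 10, b3 v p q 9, v 4, v 8, v 11, b3 v p q 5, v 13, b3 v p q
    2, b3 v p q 0, b4 v p q 4, v 5, v 9, v 12, b3 v p q 8, v 14, b3 v p q 4, b3 v p q 1, b4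
    v p q 3, v 15, b3 v p q 7, b3 v p q 3, b4 v p q 2, b3 v p q 6, b4 v p q 1, b4 v p q 0,
    b5 v p q]

/-- the spinor with given parameters -/
def build (S : Finset (Fin 5)) : T := tbl v p q (code S)

theorem build_tab (i : Fin 32) : build v p q (tab i) = tbl v p q i := by rw [build, code_tab]

theorem build_simps :
    build v p q ∅ = v 0 ∧
    build v p q {0} = v 1 ∧
    build v p q {1} = v 2 ∧
    build v p q {0,1} = v 6 ∧
    build v p q {2} = v 3 ∧
    build v p q {0,2} = v 7 ∧
    build v p q {1,2} = v 10 ∧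
    build v p q {0,1,2} = b3 v p q 9 ∧
    build v p q {3} = v 4 ∧
    build v p q {0,3} = v 8 ∧
    build v p q {1,3} = v 11 ∧
    build v p q {0,1,3} = b3 v p q 5 ∧
    build v p q {2,3} = v 13 ∧
    build v p q {0,2,3} = b3 v p q 2 ∧
    build v p q {1,2,3} = b3 v p q 0 ∧
    build v p q {0,1,2,3} = b4 v p q 4 ∧
    build v p q {4} = v 5 ∧
    build v p q {0,4} = v 9 ∧
    build v p q {1,4} = v 12 ∧
    build v p q {0,1,4} = b3 v p q 8 ∧
    build v p q {2,4} = v 14 ∧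
    build v p q {0,2,4} = b3 v p q 4 ∧
    build v p q {1,2,4} = b3 v p q 1 ∧
    build v p q {0,1,2,4} = b4 v p q 3 ∧
    build v p q {3,4} = v 15 ∧
    build v p q {0,3,4} = b3 v p q 7 ∧
    build v p q {1,3,4} = b3 v p q 3 ∧
    build v p q {0,1,3,4} = b4 v p q 2 ∧
    build v p q {2,3,4} = b3 v p q 6 ∧
    build v p q {0,2,3,4} = b4 v p q 1 ∧
    build v p q {1,2,3,4} = b4 v p q 0 ∧
    build v p q {0,1,2,3,4} = b5 v p q :=
  ⟨build_tab v p q 0, build_tab v p q 1, build_tab v p q 2, build_tab v p q 3, build_tab v p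
    q 4, build_tab v p q 5, build_tab v p q 6, build_tab v p q 7, build_tab v p q 8,
    build_tab v p q 9, build_tab v p q 10, build_tab v p q 11, build_tab v p q 12, build_tab
    v p q 13, build_tab v p q 14, build_tab v p q 15, build_tab v p q 16, build_tab v p q
    17, build_tab v p q 18, build_tab v p q 19, build_tab v p q 20, build_tab v p q 21,
    build_tab v p q 22, build_tab v p q 23, build_tab v p q 24, build_tab v p q 25,
    build_tab v p q 26, build_tab v p q 27, build_tab v p q 28, build_tab v p q 29,
    build_tab v p q 30, build_tab v p q 31⟩

/-- parameters of a spinor -/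
def vOf (l : Finset (Fin 5) → T) : Fin 16 → T := ![
  l ∅, l {0}, l {1}, l {2}, l {3}, l {4}, l {0,1}, l {0,2}, l {0,3}, l {0,4}, l {1,2}, l
    {1,3}, l {1,4}, l {2,3}, l {2,4}, l {3,4}]

/-- Pluecker coordinates of a spinor -/
def pOf (l : Finset (Fin 5) → T) (q : T) : Fin 10 → T := ![
  (l {1,2,3} - q * (l {1} * l {2,3} - l {1,3} * l {2} + l {1,2} * l {3})),
  (l {1,2,4} - q * (l {1} * l {2,4} - l {1,4} * l {2} + l {1,2} * l {4})),
  (l {0,2,3} - q * (l {0} * l {2,3} - l {0,3} * l {2} + l {0,2} * l {3})),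
  (l {1,3,4} - q * (l {1} * l {3,4} - l {1,4} * l {3} + l {1,3} * l {4})),
  (l {0,2,4} - q * (l {0} * l {2,4} - l {0,4} * l {2} + l {0,2} * l {4})),
  (l {0,1,3} - q * (l {0} * l {1,3} - l {0,3} * l {1} + l {0,1} * l {3})),
  (l {2,3,4} - q * (l {2} * l {3,4} - l {2,4} * l {3} + l {2,3} * l {4})),
  (l {0,3,4} - q * (l {0} * l {3,4} - l {0,4} * l {3} + l {0,3} * l {4})),
  (l {0,1,4} - q * (l {0} * l {1,4} - l {0,4} * l {1} + l {0,1} * l {4})),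
  (l {0,1,2} - q * (l {0} * l {1,2} - l {0,2} * l {1} + l {0,1} * l {2}))]

theorem vOf_build : vOf (build v p q) = v := by
  have hs := build_simps v p q
  funext i
  fin_cases i <;> simp only [vOf, hs, Matrix.cons_val, Fin.isValue, Fin.reduceFinMk,
    Fin.zero_eta, Fin.mk_one]

theorem pOf_build : pOf (build v p q) q = p := by
  have hs := build_simps v p q
  funext i
  fin_cases i <;>
  · simp only [pOf, hs, b3, Matrix.cons_val, Fin.isValue, Fin.reduceFinMk, Fin.zero_eta, Fin.mk_one]
    ring

theorem c3_build (r : Fin 5) :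
    c3 (build v p q) r = rel p r := by
  have hs := build_simps v p q
  fin_cases r <;>
  · simp only [c3, rel, hs, Matrix.cons_val, Fin.isValue, Fin.reduceFinMk, Fin.zero_eta,
      Fin.mk_one, b5, b4, b3]
    ring

variable {v q}
theorem c1_build (h : v 0 * q = 1) : c1 (build v p q) = 0 := by
  have hs := build_simps v p q
  simp only [c1, hs, b5]
  linear_combination (v 6 * b3 v p q 6 - v 7 * b3 v p q 3 + v 8 * b3 v p q 1 - v 9 * b3 v p
    q 0 + b3 v p q 7 * v 10 - b3 v p q 4 * v 11 + b3 v p q 2 * v 12 + b3 v p q 8 * v 13 - b3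
    v p q 5 * v 14 + b3 v p q 9 * v 15 - v 1 * b4 v p q 0 + b4 v p q 1 * v 2 - b4 v p q 2 *
    v 3 + b4 v p q 3 * v 4 - b4 v p q 4 * v 5) * h

theorem c2_build (h : v 0 * q = 1) (i : Fin 5) : c2 (build v p q) i = 0 := by
  have hs := build_simps v p q
  have hb : ∀ a : T, v 0 * (q * a) = a := fun a => by rw [← mul_assoc, h, one_mul]
  fin_cases i <;>
  · simp only [c2, hs, Matrix.cons_val, Fin.isValue, Fin.reduceFinMk, Fin.zero_eta,
      Fin.mk_one, b4, hb, mul_comm (v 0), mul_comm _ (v 0)]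
    ring

theorem build_of (l : Finset (Fin 5) → T) (h : l ∅ * q = 1) (h1 : c1 l = 0)
    (h2 : ∀ i, c2 l i = 0) : build (vOf l) (pOf l q) q = l := by
  have e3 : b3 (vOf l) (pOf l q) q = ![l {1,2,3}, l {1,2,4}, l {0,2,3}, l {1,3,4}, l {0,2,4}, l {0,1,3}, l {2,3,4}, l {0,3,4}, l {0,1,4}, l {0,1,2}] := by
    funext i
    fin_cases i <;>
    · simp only [b3, pOf, vOf, Matrix.cons_val, Fin.isValue, Fin.reduceFinMk, Fin.zero_eta,
        Fin.mk_one]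
      ring
  have e4 : b4 (vOf l) (pOf l q) q = ![l {1,2,3,4}, l {0,2,3,4}, l {0,1,3,4}, l {0,1,2,4}, l {0,1,2,3}] := by
    funext i
    have h2i := h2 i
    fin_cases i <;>
    · simp only [b4, e3]
      simp only [c2, vOf, Matrix.cons_val, Fin.isValue, Fin.reduceFinMk, Fin.zero_eta,
        Fin.mk_one] at h2i ⊢
      first
      | linear_combination q * h2i + l {1,2,3,4} * h
      | linear_combination q * h2i + l {0,2,3,4} * h
      | linear_combination q * h2i + l {0,1,3,4} * h
      | linear_combination q * h2i + l {0,1,2,4} * h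
      | linear_combination q * h2i + l {0,1,2,3} * h
  have e5 : b5 (vOf l) (pOf l q) q = l {0,1,2,3,4} := by
    simp only [b5, e3, e4]
    simp only [c1, vOf, Matrix.cons_val, Fin.isValue] at h1 ⊢
    linear_combination l {0,1,2,3,4} * h - q * h1
  funext S
  rw [← tab_code S, build_tab]
  generalize code S = i
  simp only [tbl, tab, e3, e4, e5]
  fin_cases i <;>
  simp only [vOf, Matrix.cons_val, Fin.isValue, Fin.reduceFinMk,
    Fin.zero_eta, Fin.mk_one]

theorem rel_of (l : Finset (Fin 5) → T) (h : l ∅ * q = 1) (h1 : c1 l = 0)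
    (h2 : ∀ i, c2 l i = 0) (h3 : ∀ i, c3 l i = 0) (r : Fin 5) : rel (pOf l q) r = 0 := by
  have := c3_build (vOf l) (pOf l q) q r
  rw [build_of l h h1 h2, h3] at this
  simpa using this.symm

variable {U : Type*} [CommRing U] (f : T →+* U)

theorem map_c1 (l : Finset (Fin 5) → T) : f (c1 l) = c1 (fun S => f (l S)) := by
  simp only [c1, map_add, map_sub, map_mul, map_neg]

theorem map_c2 (l : Finset (Fin 5) → T) (i) : f (c2 l i) = c2 (fun S => f (l S)) i := by
  fin_cases i <;> simp [c2]

theorem map_c3 (l : Finset (Fin 5) → T) (i) : f (c3 l i) = c3 (fun S => f (l S)) i := by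
  fin_cases i <;> simp [c3]

theorem map_rel (p : Fin 10 → T) (i) : f (rel p i) = rel (fun S => f (p S)) i := by
  fin_cases i <;> simp [rel]

theorem map_vOf (l : Finset (Fin 5) → T) (i) : f (vOf l i) = vOf (fun S => f (l S)) i := by
  fin_cases i <;> rfl

theorem map_pOf (l : Finset (Fin 5) → T) (q : T) (i) :
    f (pOf l q i) = pOf (fun S => f (l S)) (f q) i := by
  fin_cases i <;> simp [pOf]

theorem map_build (v : Fin 16 → T) (p : Fin 10 → T) (q : T) (S) :
    f (build v p q S) = build (fun i => f (v i)) (fun i => f (p i)) (f q) S := by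
  have e3 (i) : f (b3 v p q i) = b3 (fun i => f (v i)) (fun i => f (p i)) (f q) i := by
    fin_cases i <;> simp [b3]
  have e4 (i) : f (b4 v p q i) = b4 (fun i => f (v i)) (fun i => f (p i)) (f q) i := by
    fin_cases i <;> simp [b4, e3]
  have e5 : f (b5 v p q) = b5 (fun i => f (v i)) (fun i => f (p i)) (f q) := by
    simp only [b5, e3, e4, map_add, map_sub, map_mul]
  rw [build, build]
  generalize code S = i
  fin_cases i <;> simp [tbl, e3, e4, e5]

end
end Grav

namespace Grav
open MvPolynomial

/-- base ring: coordinates of degree at most two -/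
abbrev KK : Type := MvPolynomial (Fin 16) ℂ

/-- the coordinate `λ₀` in the Pluecker algebra -/
noncomputable def x0 : PB KK := Ideal.Quotient.mk _ (C (X 0))

/-- the model of the chart -/
abbrev DD : Type := Localization.Away x0

theorem x0_ne : x0 ≠ 0 := by
  intro h
  rw [x0, Ideal.Quotient.eq_zero_iff_mem, ← phi_ker, RingHom.mem_ker] at h
  rw [show phi KK (C (X 0)) = C (X 0) from (phi KK).commutes _, C_eq_zero] at h
  exact X_ne_zero _ h

theorem powers_le : Submonoid.powers x0 ≤ nonZeroDivisors (PB KK) :=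
  powers_le_nonZeroDivisors_of_noZeroDivisors x0_ne

theorem DD_domain : IsDomain DD := IsLocalization.isDomain_localization powers_le

theorem DD_normal : IsIntegrallyClosed DD := by
  have := PB_normal (K := KK)
  have := DD_domain
  exact isIntegrallyClosed_of_isLocalization DD (Submonoid.powers x0) powers_le

theorem rel_mem {K : Type} [CommRing K] (i : Fin 5) :
    rel (X : Fin 10 → MvPolynomial (Fin 10) K) i ∈ pf K := by
  fin_cases i <;> simp [rel, pf]

theorem pf_rel {K : Type} [CommRing K] {b : MvPolynomial (Fin 10) K} (hb : b ∈ pf K) :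
    ∃ i, b = rel (X : Fin 10 → MvPolynomial (Fin 10) K) i := by
  simp only [pf, Set.mem_insert_iff, Set.mem_singleton_iff] at hb
  rcases hb with h | h | h | h | h
  · exact ⟨4, h⟩
  · exact ⟨3, h⟩
  · exact ⟨2, h⟩
  · exact ⟨1, h⟩
  · exact ⟨0, h⟩

/-- the map from the Pluecker algebra to the model -/
noncomputable def toDD : MvPolynomial (Fin 10) KK →+* DD :=
  (algebraMap (PB KK) DD).comp (Ideal.Quotient.mk _)

noncomputable def vD (i : Fin 16) : DD := toDD (C (X i))
noncomputable def pD (i : Fin 10) : DD := toDD (X i)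
noncomputable def qD : DD := IsLocalization.Away.invSelf x0

theorem vq : vD 0 * qD = 1 := IsLocalization.Away.mul_invSelf x0

theorem relD (i : Fin 5) : rel pD i = 0 := by
  have := map_rel toDD (X : Fin 10 → MvPolynomial (Fin 10) KK) i
  refine this.symm.trans ?_
  rw [toDD, RingHom.comp_apply, Ideal.Quotient.eq_zero_iff_mem.2
    (Ideal.subset_span (rel_mem i)), map_zero]

noncomputable def f0 : R32 →+* DD :=
  eval₂Hom (toDD.comp ((C : KK →+* MvPolynomial (Fin 10) KK).comp C)) (build vD pD qD)

theorem f0_X : (fun S => f0 (X S)) = build vD pD qD := by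
  funext S; simp [f0]

theorem f0_ker : Igrav ≤ RingHom.ker f0 := by
  rw [Igrav_le_iff]
  refine ⟨?_, fun i => ?_, fun i => ?_⟩ <;> rw [RingHom.mem_ker]
  · rw [map_c1, f0_X, c1_build _ vq]
  · rw [map_c2, f0_X, c2_build _ vq]
  · rw [map_c3, f0_X, c3_build, relD]

noncomputable def f1 : Aq →+* DD := Ideal.Quotient.lift _ f0 f0_ker

theorem f1_mk (x : R32) : f1 (Ideal.Quotient.mk _ x) = f0 x := rfl

theorem build_empty {T : Type*} [CommRing T] (v : Fin 16 → T) (p : Fin 10 → T) (q : T) :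
    build v p q ∅ = v 0 := (build_simps v p q).1

theorem f1_lam0 : f1 lam0 = vD 0 := by
  rw [lam0, f1_mk, congrFun f0_X ∅, build_empty]

theorem f1_unit : IsUnit (f1 lam0) := by
  rw [f1_lam0]; exact IsUnit.of_mul_eq_one _ vq

section
variable (L : Type) [CommRing L] [Algebra Aq L] [IsLocalization.Away lam0 L]

/-- the map from the chart to the model -/
noncomputable def ff : L →+* DD := IsLocalization.Away.lift lam0 f1_unit

theorem ff_alg (x : Aq) : ff L (algebraMap Aq L x) = f1 x := IsLocalization.Away.lift_eq _ _ _

/-- coordinates on the chart -/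
noncomputable def lL (S : Finset (Fin 5)) : L := algebraMap Aq L (Ideal.Quotient.mk _ (X S))
noncomputable def qL : L := IsLocalization.Away.invSelf lam0

theorem lq : lL L ∅ * qL L = 1 := IsLocalization.Away.mul_invSelf lam0

/-- the structure map -/
noncomputable def sL : R32 →+* L := (algebraMap Aq L).comp (Ideal.Quotient.mk _)

theorem sL_zero {x : R32} (h : x ∈ Igrav) : sL L x = 0 := by
  rw [sL, RingHom.comp_apply, Ideal.Quotient.eq_zero_iff_mem.2 h, map_zero]

theorem c1L : c1 (lL L) = 0 :=
  (map_c1 (sL L) X).symm.trans (sL_zero L (Igrav_le_iff.1 le_rfl).1)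
theorem c2L (i) : c2 (lL L) i = 0 :=
  (map_c2 (sL L) X i).symm.trans (sL_zero L ((Igrav_le_iff.1 le_rfl).2.1 i))
theorem c3L (i) : c3 (lL L) i = 0 :=
  (map_c3 (sL L) X i).symm.trans (sL_zero L ((Igrav_le_iff.1 le_rfl).2.2 i))

noncomputable def g0 : MvPolynomial (Fin 10) KK →+* L :=
  eval₂Hom (eval₂Hom ((sL L).comp C) (vOf (lL L))) (pOf (lL L) (qL L))

theorem g0_X (i) : g0 L (X i) = pOf (lL L) (qL L) i := by simp [g0]
theorem g0_CX (i) : g0 L (C (X i)) = vOf (lL L) i := by simp [g0]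
theorem g0_CC (a : ℂ) : g0 L (C (C a)) = sL L (C a) := by simp [g0]

theorem g0_ker : Ideal.span (pf KK) ≤ RingHom.ker (g0 L) := by
  rw [Ideal.span_le]
  intro b hb
  obtain ⟨i, rfl⟩ := pf_rel hb
  rw [SetLike.mem_coe, RingHom.mem_ker, map_rel, funext (g0_X L)]
  exact rel_of _ (lq L) (c1L L) (c2L L) (c3L L) i

noncomputable def g1 : PB KK →+* L := Ideal.Quotient.lift _ (g0 L) (g0_ker L)

theorem g1_mk (x) : g1 L (Ideal.Quotient.mk _ x) = g0 L x := rfl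

theorem g1_unit : IsUnit (g1 L x0) := by
  rw [x0, g1_mk, g0_CX]; exact IsUnit.of_mul_eq_one _ (lq L)

/-- the map from the model to the chart -/
noncomputable def gg : DD →+* L := IsLocalization.Away.lift x0 (g1_unit L)

theorem gg_to (x) : gg L (toDD x) = g0 L x := IsLocalization.Away.lift_eq _ _ _

theorem ff_lL : (fun S => ff L (lL L S)) = build vD pD qD := by
  rw [← f0_X]; funext S; rw [lL, ff_alg, f1_mk]

theorem ff_q : ff L (qL L) = qD := by
  have h := congrArg (ff L) (lq L)
  rw [map_mul, map_one, congrFun (ff_lL L) ∅, build_empty] at h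
  have h' := vq
  calc ff L (qL L) = (vD 0 * qD) * ff L (qL L) := by rw [h', one_mul]
    _ = (vD 0 * ff L (qL L)) * qD := by ring
    _ = qD := by rw [h, one_mul]

theorem gg_q : gg L qD = qL L := by
  have h := congrArg (gg L) vq
  rw [map_mul, map_one, vD, gg_to, g0_CX] at h
  change lL L ∅ * _ = 1 at h
  have h' := lq L
  calc gg L qD = (lL L ∅ * qL L) * gg L qD := by rw [h', one_mul]
    _ = (lL L ∅ * gg L qD) * qL L := by ring
    _ = qL L := by rw [h, one_mul]

theorem gf : (gg L).comp (ff L) = RingHom.id L := by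
  apply IsLocalization.ringHom_ext (Submonoid.powers lam0)
  apply Ideal.Quotient.ringHom_ext
  apply MvPolynomial.ringHom_ext
  · intro a
    simp only [RingHom.comp_apply, RingHom.id_apply, ff_alg, f1_mk]
    rw [show f0 (C a) = toDD (C (C a)) by simp [f0], gg_to, g0_CC]; rfl
  · intro S
    simp only [RingHom.comp_apply, RingHom.id_apply, ff_alg, f1_mk]
    rw [congrFun f0_X S, map_build, gg_q]
    simp only [vD, pD, gg_to, g0_CX, g0_X]
    exact congrFun (build_of (lL L) (lq L) (c1L L) (c2L L)) S

theorem fg : (ff L).comp (gg L) = RingHom.id DD := by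
  apply IsLocalization.ringHom_ext (Submonoid.powers x0)
  apply Ideal.Quotient.ringHom_ext
  suffices h : (ff L).comp (g0 L) = toDD by
    refine RingHom.ext fun x => ?_
    exact (congrArg (ff L) (gg_to L x)).trans (RingHom.congr_fun h x)
  apply MvPolynomial.ringHom_ext
  · intro k
    suffices h : ((ff L).comp (g0 L)).comp C = toDD.comp C from RingHom.congr_fun h k
    apply MvPolynomial.ringHom_ext
    · intro a
      simp only [RingHom.comp_apply, g0_CC, sL, ff_alg, f1_mk]
      simp [f0]
    · intro i
      simp only [RingHom.comp_apply, g0_CX]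
      rw [map_vOf, ff_lL, vOf_build]; rfl
  · intro i
    simp only [RingHom.comp_apply, g0_X]
    rw [map_pOf, ff_lL, ff_q, pOf_build]; rfl

noncomputable def chartEquiv : DD ≃+* L := RingEquiv.ofRingHom (gg L) (ff L) (gf L) (fg L)

theorem chart : IsReduced L ∧ IsDomain L ∧ IsIntegrallyClosed L := by
  have := DD_domain
  have := DD_normal
  have hd : IsDomain L := (chartEquiv L).symm.toMulEquiv.isDomain DD
  exact ⟨inferInstance, hd, IsIntegrallyClosed.of_equiv (chartEquiv L)⟩

end
end Grav

/-- the localization `A[λ_∅⁻¹]` is a reduced ring; in fact it is an integral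
domain which is integrally closed in its field of fractions. -/
theorem localization_chart_reduced_normal (L : Type) [CommRing L] [Algebra Aq L]
    [IsLocalization.Away lam0 L] :
    IsReduced L ∧ IsDomain L ∧ IsIntegrallyClosed L := by
  exact Grav.chart L
end
end

section
/- The integral domain B = ℂ[u_{ij}]/(P₁,…,P₅) is normal, i.e., integrally closed in its field of fractions. -/
noncomputable section

set_option linter.unusedSimpArgs false
namespace PfProof
open MvPolynomial

/-- The index set of the Plücker coordinates. -/
abbrev Idx : Type := {p : Fin 5 × Fin 5 // p.1 < p.2}

def v12 : Idx := ⟨(0, 1), by decide⟩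
def v13 : Idx := ⟨(0, 2), by decide⟩
def v14 : Idx := ⟨(0, 3), by decide⟩
def v15 : Idx := ⟨(0, 4), by decide⟩
def v23 : Idx := ⟨(1, 2), by decide⟩
def v24 : Idx := ⟨(1, 3), by decide⟩
def v25 : Idx := ⟨(1, 4), by decide⟩
def v34 : Idx := ⟨(2, 3), by decide⟩
def v35 : Idx := ⟨(2, 4), by decide⟩
def v45 : Idx := ⟨(3, 4), by decide⟩

lemma univ_eq : (Finset.univ : Finset Idx) =
    {v12, v13, v14, v15, v23, v24, v25, v34, v35, v45} := by decide

lemma sum_idx {M : Type*} [AddCommMonoid M] (f : Idx → M) :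
    ∑ p, f p = f v12 + (f v13 + (f v14 + (f v15 + (f v23 + (f v24 + (f v25 + (f v34 +
      (f v35 + f v45)))))))) := by
  rw [univ_eq]
  repeat rw [Finset.sum_insert (by decide)]
  rw [Finset.sum_singleton]

/-- The ideal of Pfaffians. -/
abbrev I : Ideal PR := Ideal.span (Set.range Pf)

lemma Pf0 : Pf 0 = X v23 * X v45 - X v24 * X v35 + X v25 * X v34 := by
  simp [Pf, U, Fin.succAbove, v23, v45, v24, v35, v25, v34]
lemma Pf1 : Pf 1 = X v13 * X v45 - X v14 * X v35 + X v15 * X v34 := by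
  simp [Pf, U, Fin.succAbove, v13, v45, v14, v35, v15, v34]
lemma Pf2 : Pf 2 = X v12 * X v45 - X v14 * X v25 + X v15 * X v24 := by
  simp [Pf, U, Fin.succAbove, v12, v45, v14, v25, v15, v24]
lemma Pf3 : Pf 3 = X v12 * X v35 - X v13 * X v25 + X v15 * X v23 := by
  simp [Pf, U, Fin.succAbove, v12, v35, v13, v25, v15, v23]
lemma Pf4 : Pf 4 = X v12 * X v34 - X v13 * X v24 + X v14 * X v23 := by
  simp [Pf, U, Fin.succAbove, v12, v34, v13, v24, v14, v23]

lemma Pf_mem (k : Fin 5) : Pf k ∈ I := Ideal.subset_span ⟨k, rfl⟩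

/-- Standard exponents: no incomparable pair occurs. -/
def Std (a : Idx →₀ ℕ) : Prop :=
  (a v14 = 0 ∨ a v23 = 0) ∧ (a v15 = 0 ∨ a v23 = 0) ∧ (a v15 = 0 ∨ a v24 = 0) ∧
    (a v15 = 0 ∨ a v34 = 0) ∧ (a v25 = 0 ∨ a v34 = 0)

/-- The weight `∑ (j - i)^2` used for termination of straightening. -/
def wt (a : Idx →₀ ℕ) : ℕ := ∑ p : Idx, a p * ((p.1.2 : ℕ) - (p.1.1 : ℕ)) ^ 2

lemma wt_add (a b : Idx →₀ ℕ) : wt (a + b) = wt a + wt b := by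
  simp [wt, add_mul, Finset.sum_add_distrib]

lemma wt_single (p : Idx) : wt (Finsupp.single p 1) = ((p.1.2 : ℕ) - (p.1.1 : ℕ)) ^ 2 := by
  simp [wt, Finsupp.single_apply]

/-- Sums of standard polynomials and elements of `I`. -/
def M : Submodule ℂ PR :=
  Submodule.span ℂ ((fun a => monomial a (1 : ℂ)) '' {a | Std a}) ⊔ I.restrictScalars ℂ

/-- One straightening step. -/
lemma step {p q r s t u : Idx} (k : Fin 5) (hk : Pf k = X r * X s - X t * X u + X p * X q)
    (hpq : p ≠ q)
    (h1 : wt (Finsupp.single r 1 + Finsupp.single s 1) <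
      wt (Finsupp.single p 1 + Finsupp.single q 1))
    (h2 : wt (Finsupp.single t 1 + Finsupp.single u 1) <
      wt (Finsupp.single p 1 + Finsupp.single q 1))
    (a : Idx →₀ ℕ) (ih : ∀ b, wt b < wt a → monomial b (1 : ℂ) ∈ M)
    (hp : a p ≠ 0) (hq : a q ≠ 0) : monomial a (1 : ℂ) ∈ M := by
  obtain ⟨b, rfl⟩ : ∃ b, a = (Finsupp.single p 1 + Finsupp.single q 1) + b := by
    refine ⟨a - (Finsupp.single p 1 + Finsupp.single q 1), ?_⟩
    rw [add_tsub_cancel_of_le]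
    intro x
    simp only [Finsupp.add_apply, Finsupp.single_apply]
    split_ifs with e1 e2 e2
    · exact absurd (e1.trans e2.symm) hpq
    · subst e1; omega
    · subst e2; omega
    · omega
  have e : ∀ x y : Idx, monomial ((Finsupp.single x 1 + Finsupp.single y 1) + b) (1 : ℂ) =
      X x * X y * monomial b 1 := by
    intro x y
    simp [X, monomial_mul]
  have m1 := ih ((Finsupp.single r 1 + Finsupp.single s 1) + b) (by
    rw [wt_add _ b, wt_add _ b]; omega)
  have m2 := ih ((Finsupp.single t 1 + Finsupp.single u 1) + b) (by
    rw [wt_add _ b, wt_add _ b]; omega)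
  have m3 : Pf k * monomial b 1 ∈ M :=
    Submodule.mem_sup_right (I.mul_mem_right _ (Pf_mem k))
  rw [e] at m1 m2 ⊢
  have : X p * X q * monomial b (1 : ℂ) = Pf k * monomial b 1 - X r * X s * monomial b 1 +
      X t * X u * monomial b 1 := by rw [hk]; ring
  rw [this]
  exact M.add_mem (M.sub_mem m3 m1) m2

lemma monomial_mem : ∀ (n : ℕ) (a : Idx →₀ ℕ), wt a = n → monomial a (1 : ℂ) ∈ M := by
  intro n
  induction n using Nat.strong_induction_on with
  | _ n IH =>
    intro a ha
    have ih : ∀ b, wt b < wt a → monomial b (1 : ℂ) ∈ M := fun b hb => IH _ (ha ▸ hb) b rfl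
    by_cases hs : Std a
    · exact Submodule.mem_sup_left (Submodule.subset_span ⟨a, hs, rfl⟩)
    · simp only [Std, not_and_or, not_or] at hs
      rcases hs with h | h | h | h | h
      · exact step 4 Pf4 (by decide) (by simp only [wt_add, wt_single]; decide)
          (by simp only [wt_add, wt_single]; decide) a ih h.1 h.2
      · exact step 3 Pf3 (by decide) (by simp only [wt_add, wt_single]; decide)
          (by simp only [wt_add, wt_single]; decide) a ih h.1 h.2
      · exact step 2 Pf2 (by decide) (by simp only [wt_add, wt_single]; decide)
          (by simp only [wt_add, wt_single]; decide) a ih h.1 h.2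
      · exact step 1 Pf1 (by decide) (by simp only [wt_add, wt_single]; decide)
          (by simp only [wt_add, wt_single]; decide) a ih h.1 h.2
      · exact step 0 Pf0 (by decide) (by simp only [wt_add, wt_single]; decide)
          (by simp only [wt_add, wt_single]; decide) a ih h.1 h.2

lemma M_top (f : PR) : f ∈ M := by
  induction f using MvPolynomial.induction_on' with
  | monomial a c =>
    have := M.smul_mem c (monomial_mem _ a rfl)
    simpa [smul_monomial] using this
  | add p q hp hq => exact M.add_mem hp hq

/-- The target ring of the parametrisations. -/
abbrev D : Type := MvPolynomial (Fin 10) ℂ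

def xi (i : Fin 5) : Fin 10 := Fin.castAdd 5 i
def yi (i : Fin 5) : Fin 10 := Fin.natAdd 5 i

/-- The parametrisation `u_{ij} ↦ x_i y_j - x_j y_i`, with `y_j` scaled by `c j`. -/
def th (c : Fin 5 → ℂ) : PR →ₐ[ℂ] D :=
  aeval (fun p : Idx => X (xi p.1.1) * (C (c p.1.2) * X (yi p.1.2)) -
    X (xi p.1.2) * (C (c p.1.1) * X (yi p.1.1)))

lemma I_le_ker (c : Fin 5 → ℂ) : I ≤ RingHom.ker (th c) := by
  rw [Ideal.span_le]
  rintro _ ⟨k, rfl⟩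
  rw [SetLike.mem_coe, RingHom.mem_ker]
  fin_cases k
  · change th c (Pf 0) = 0
    rw [Pf0]; simp only [th, map_add, map_sub, map_mul, aeval_X, v23, v45, v24, v35, v25, v34]; ring
  · change th c (Pf 1) = 0
    rw [Pf1]; simp only [th, map_add, map_sub, map_mul, aeval_X, v13, v45, v14, v35, v15, v34]; ring
  · change th c (Pf 2) = 0
    rw [Pf2]; simp only [th, map_add, map_sub, map_mul, aeval_X, v12, v45, v14, v25, v15, v24]; ring
  · change th c (Pf 3) = 0
    rw [Pf3]; simp only [th, map_add, map_sub, map_mul, aeval_X, v12, v35, v13, v25, v15, v23]; ring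
  · change th c (Pf 4) = 0
    rw [Pf4]; simp only [th, map_add, map_sub, map_mul, aeval_X, v12, v34, v13, v24, v14, v23]; ring

/-- The leading exponent of `u_p`. -/
def ld (p : Idx) : Fin 10 →₀ ℕ := Finsupp.single (xi p.1.1) 1 + Finsupp.single (yi p.1.2) 1

/-- The monomial order used. -/
abbrev mo : MonomialOrder (Fin 10) := MonomialOrder.lex

lemma lex_aux (p : Idx) :
    mo.toSyn (Finsupp.single (xi p.1.2) 1 + Finsupp.single (yi p.1.1) 1) < mo.toSyn (ld p) := by
  rw [MonomialOrder.lex_lt_iff, Finsupp.Lex.lt_iff]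
  obtain ⟨⟨i, j⟩, hij⟩ := p
  refine ⟨xi i, ?_, ?_⟩
  · revert i j
    simp only [ld, xi, yi, Finsupp.add_apply, Finsupp.single_apply, ofLex_toLex]
    decide
  · revert i j
    simp only [ld, xi, yi, Finsupp.add_apply, Finsupp.single_apply, ofLex_toLex]
    decide

lemma deg_th (c : Fin 5 → ℂ) (p : Idx) (hc : c p.1.2 ≠ 0) :
    mo.degree (th c (X p)) = ld p ∧ th c (X p) ≠ 0 := by
  have e : th c (X p) = monomial (ld p) (c p.1.2) -
      monomial (Finsupp.single (xi p.1.2) 1 + Finsupp.single (yi p.1.1) 1) (c p.1.1) := by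
    rw [th, aeval_X]
    simp only [ld, X, C_mul_monomial, monomial_mul, mul_one, one_mul]
  have hd : mo.degree (monomial (ld p) (c p.1.2)) = ld p := by
    classical
    rw [MonomialOrder.degree_monomial, if_neg hc]
  have h : mo.degree (th c (X p)) = ld p := by
    rw [e, MonomialOrder.degree_sub_of_lt, hd]
    rw [hd]
    exact lt_of_le_of_lt (MonomialOrder.degree_monomial_le _) (lex_aux p)
  refine ⟨h, ?_⟩
  apply MonomialOrder.ne_zero_of_degree_ne_zero (m := mo)
  rw [h]
  intro h0
  have := DFunLike.congr_fun h0 (xi p.1.1)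
  simp [ld] at this

lemma th_monomial (c : Fin 5 → ℂ) (a : Idx →₀ ℕ) :
    th c (monomial a 1) = ∏ p, (th c (X p)) ^ a p := by
  rw [monomial_eq, Finsupp.prod_fintype _ _ (by simp)]
  simp

lemma deg_th_monomial (c : Fin 5 → ℂ) (a : Idx →₀ ℕ) (hc : ∀ p : Idx, c p.1.2 = 0 → a p = 0) :
    mo.degree (th c (monomial a 1)) = ∑ p, a p • ld p ∧ th c (monomial a 1) ≠ 0 := by
  rw [th_monomial]
  have hne : ∀ p ∈ Finset.univ, (th c (X p)) ^ a p ≠ 0 := by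
    intro p _
    by_cases h : c p.1.2 = 0
    · simp [hc p h]
    · exact pow_ne_zero _ (deg_th c p h).2
  refine ⟨?_, Finset.prod_ne_zero_iff.2 hne⟩
  rw [MonomialOrder.degree_prod hne]
  refine Finset.sum_congr rfl fun p _ => ?_
  rw [MonomialOrder.degree_pow]
  by_cases h : c p.1.2 = 0
  · simp [hc p h]
  · rw [(deg_th c p h).1]

lemma ld_inj (a b : Idx →₀ ℕ) (ha : Std a) (hb : Std b)
    (h : ∑ p, a p • ld p = ∑ p, b p • ld p) : a = b := by
  have facet : ∀ a : Idx →₀ ℕ, Std a →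
      (a v15 = 0 ∧ a v14 = 0 ∧ a v34 = 0) ∨ (a v15 = 0 ∧ a v14 = 0 ∧ a v25 = 0) ∨
      (a v15 = 0 ∧ a v23 = 0 ∧ a v34 = 0) ∨ (a v15 = 0 ∧ a v23 = 0 ∧ a v25 = 0) ∨
      (a v23 = 0 ∧ a v24 = 0 ∧ a v34 = 0) := by
    intro a ha
    unfold Std at ha
    omega
  have hx : ∀ k, (∑ p, a p • ld p) k = (∑ p, b p • ld p) k := fun k => by rw [h]
  have h0 : a v12 + a v13 + a v14 + a v15 = b v12 + b v13 + b v14 + b v15 := by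
    have := hx (xi 0)
    simp [sum_idx, ld, xi, yi, v12, v13, v14, v15, v23, v24, v25, v34, v35, v45,
      Fin.ext_iff] at this
    simp only [v12, v13, v14, v15, v23, v24, v25, v34, v35, v45]
    omega
  have h1 : a v23 + a v24 + a v25 = b v23 + b v24 + b v25 := by
    have := hx (xi 1)
    simp [sum_idx, ld, xi, yi, v12, v13, v14, v15, v23, v24, v25, v34, v35, v45,
      Fin.ext_iff] at this
    simp only [v12, v13, v14, v15, v23, v24, v25, v34, v35, v45]
    omega
  have h2 : a v34 + a v35 = b v34 + b v35 := by
    have := hx (xi 2)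
    simp [sum_idx, ld, xi, yi, v12, v13, v14, v15, v23, v24, v25, v34, v35, v45,
      Fin.ext_iff] at this
    simp only [v12, v13, v14, v15, v23, v24, v25, v34, v35, v45]
    omega
  have h3 : a v45 = b v45 := by
    have := hx (xi 3)
    simp [sum_idx, ld, xi, yi, v12, v13, v14, v15, v23, v24, v25, v34, v35, v45,
      Fin.ext_iff] at this
    simp only [v12, v13, v14, v15, v23, v24, v25, v34, v35, v45]
    omega
  have h4 : a v12 = b v12 := by
    have := hx (yi 1)
    simp [sum_idx, ld, xi, yi, v12, v13, v14, v15, v23, v24, v25, v34, v35, v45,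
      Fin.ext_iff] at this
    simp only [v12, v13, v14, v15, v23, v24, v25, v34, v35, v45]
    omega
  have h5 : a v13 + a v23 = b v13 + b v23 := by
    have := hx (yi 2)
    simp [sum_idx, ld, xi, yi, v12, v13, v14, v15, v23, v24, v25, v34, v35, v45,
      Fin.ext_iff] at this
    simp only [v12, v13, v14, v15, v23, v24, v25, v34, v35, v45]
    omega
  have h6 : a v14 + a v24 + a v34 = b v14 + b v24 + b v34 := by
    have := hx (yi 3)
    simp [sum_idx, ld, xi, yi, v12, v13, v14, v15, v23, v24, v25, v34, v35, v45,
      Fin.ext_iff] at this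
    simp only [v12, v13, v14, v15, v23, v24, v25, v34, v35, v45]
    omega
  have h7 : a v15 + a v25 + a v35 + a v45 = b v15 + b v25 + b v35 + b v45 := by
    have := hx (yi 4)
    simp [sum_idx, ld, xi, yi, v12, v13, v14, v15, v23, v24, v25, v34, v35, v45,
      Fin.ext_iff] at this
    simp only [v12, v13, v14, v15, v23, v24, v25, v34, v35, v45]
    omega
  clear hx h
  have key : a v12 = b v12 ∧ a v13 = b v13 ∧ a v14 = b v14 ∧ a v15 = b v15 ∧ a v23 = b v23 ∧
      a v24 = b v24 ∧ a v25 = b v25 ∧ a v34 = b v34 ∧ a v35 = b v35 ∧ a v45 = b v45 := by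
    rcases facet a ha with h | h | h | h | h <;> rcases facet b hb with h' | h' | h' | h' | h' <;>
      refine ⟨?_, ?_, ?_, ?_, ?_, ?_, ?_, ?_, ?_, ?_⟩ <;> omega
  ext p
  have : p ∈ (Finset.univ : Finset Idx) := Finset.mem_univ p
  rw [univ_eq] at this
  simp only [Finset.mem_insert, Finset.mem_singleton] at this
  rcases this with rfl | rfl | rfl | rfl | rfl | rfl | rfl | rfl | rfl | rfl <;> tauto

lemma indep (c : Fin 5 → ℂ) (f : PR)
    (hf : ∀ a ∈ f.support, Std a ∧ ∀ p : Idx, c p.1.2 = 0 → a p = 0) (h0 : th c f = 0) :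
    f = 0 := by
  by_contra hne
  obtain ⟨a, ha, hmax⟩ := Finset.exists_max_image f.support
    (fun a => mo.toSyn (∑ p, a p • ld p)) (support_nonempty.2 hne)
  have e : th c f = ∑ b ∈ f.support, C (coeff b f) * th c (monomial b 1) := by
    conv_lhs => rw [f.as_sum]
    rw [map_sum]
    refine Finset.sum_congr rfl fun b _ => ?_
    rw [← mul_one (coeff b f), ← C_mul_monomial, map_mul, mul_one]
    congr 1
    exact (th c).commutes _
  have hz : coeff (∑ p, a p • ld p) (th c f) = 0 := by rw [h0, coeff_zero]
  rw [e, coeff_sum, Finset.sum_eq_single a] at hz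
  · rw [coeff_C_mul, ← (deg_th_monomial c a (hf a ha).2).1] at hz
    rcases mul_eq_zero.1 hz with h | h
    · exact (mem_support_iff.1 ha) h
    · exact (deg_th_monomial c a (hf a ha).2).2 (MonomialOrder.coeff_degree_eq_zero_iff.1 h)
  · intro b hb hba
    rw [coeff_C_mul, MonomialOrder.coeff_eq_zero_of_lt (m := mo), mul_zero]
    rw [(deg_th_monomial c b (hf b hb).2).1]
    refine lt_of_le_of_ne (hmax b hb) fun h => hba ?_
    exact ld_inj b a (hf b hb).1 (hf a ha).1 (mo.toSyn.injective h)
  · intro h; exact absurd ha h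

lemma reduce (J : Ideal PR) (hI : I ≤ J) (T : (Idx →₀ ℕ) → Prop)
    (hT : ∀ a, Std a → T a ∨ monomial a (1 : ℂ) ∈ J) (f : PR) :
    ∃ s : PR, (∀ a ∈ s.support, T a) ∧ f - s ∈ J := by
  obtain ⟨s, hs, i, hi, rfl⟩ := Submodule.mem_sup.1 (M_top f)
  suffices h : ∃ s' : PR, (∀ a ∈ s'.support, T a) ∧ s - s' ∈ J by
    obtain ⟨s', h1, h2⟩ := h
    refine ⟨s', h1, ?_⟩
    have := J.add_mem h2 (hI hi)
    convert this using 1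
    ring
  induction hs using Submodule.span_induction with
  | mem x hx =>
    obtain ⟨a, ha, rfl⟩ := hx
    rcases hT a ha with h | h
    · refine ⟨monomial a 1, ?_, by simp⟩
      intro b hb
      have := support_monomial_subset hb
      rw [Finset.mem_singleton] at this
      rwa [this]
    · exact ⟨0, by simp, by simpa using h⟩
  | zero => exact ⟨0, by simp, by simp⟩
  | add x y _ _ hx hy =>
    obtain ⟨s1, a1, b1⟩ := hx
    obtain ⟨s2, a2, b2⟩ := hy
    classical
    refine ⟨s1 + s2, ?_, ?_⟩
    · intro a ha
      rcases Finset.mem_union.1 (support_add ha) with h | h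
      · exact a1 a h
      · exact a2 a h
    · have := J.add_mem b1 b2
      convert this using 1
      ring
  | smul r x _ hx =>
    obtain ⟨s1, a1, b1⟩ := hx
    refine ⟨r • s1, fun a ha => a1 a (support_smul ha), ?_⟩
    rw [← smul_sub, smul_eq_C_mul]
    exact J.mul_mem_left _ b1

lemma ker_eq (J : Ideal PR) (hI : I ≤ J) (c : Fin 5 → ℂ) (hJ : J ≤ RingHom.ker (th c))
    (hT : ∀ a, Std a → (∀ p : Idx, c p.1.2 = 0 → a p = 0) ∨ monomial a (1 : ℂ) ∈ J) :
    J = RingHom.ker (th c) := by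
  refine le_antisymm hJ fun f hf => ?_
  obtain ⟨s, h1, h2⟩ := reduce J hI (fun a => Std a ∧ ∀ p : Idx, c p.1.2 = 0 → a p = 0)
    (fun a ha => (hT a ha).imp (fun h => ⟨ha, h⟩) id) f
  have hs : th c s = 0 := by
    have h3 := hJ h2
    rw [RingHom.mem_ker, map_sub, RingHom.mem_ker.1 hf, zero_sub, neg_eq_zero] at h3
    exact h3
  rw [indep c s h1 hs, sub_zero] at h2
  exact h2

lemma I_eq : I = RingHom.ker (th 1) :=
  ker_eq I le_rfl 1 (I_le_ker 1) fun a _ => Or.inl fun p hp => absurd hp (by simp)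

/-- Scalars killing `y_1` and `y_2`. -/
def c0 : Fin 5 → ℂ := ![0, 0, 1, 1, 1]

lemma c0_zero (p : Idx) (h : c0 p.1.2 = 0) : p = v12 := by
  obtain ⟨⟨i, j⟩, hij⟩ := p
  have hj : ¬ (2 ≤ j) := by
    intro hj
    fin_cases j <;> simp [c0] at h hj
  clear h
  revert i j
  decide

lemma J_eq : I ⊔ Ideal.span {X v12} = RingHom.ker (th c0) := by
  refine ker_eq _ le_sup_left c0 (sup_le (I_le_ker _) ?_) ?_
  · rw [Ideal.span_le, Set.singleton_subset_iff, SetLike.mem_coe, RingHom.mem_ker]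
    simp [th, c0, v12]
  · intro a _
    by_cases h : a v12 = 0
    · exact Or.inl fun p hp => by rw [c0_zero p hp, h]
    · refine Or.inr (Ideal.mem_sup_right (Ideal.mem_span_singleton.2 ?_))
      rw [X, monomial_dvd_monomial]
      refine ⟨Or.inr ?_, one_dvd _⟩
      rw [Finsupp.single_le_iff]
      omega

instance instDom : IsDomain Bring := by
  have : (Ideal.span (Set.range Pf)).IsPrime := by
    rw [show Ideal.span (Set.range Pf) = _ from I_eq]
    exact RingHom.ker_isPrime _
  exact Ideal.Quotient.isDomain _

/-- The class of `u_p` in `B`. -/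
def u (p : Idx) : Bring := Ideal.Quotient.mk I (X p)

lemma prime_u12 : Prime (u v12) := by
  have key : ∀ f : PR, u v12 ∣ Ideal.Quotient.mk I f ↔ f ∈ RingHom.ker (th c0) := by
    intro f
    rw [← J_eq, Submodule.mem_sup]
    constructor
    · rintro ⟨b, hb⟩
      obtain ⟨b, rfl⟩ := Ideal.Quotient.mk_surjective b
      rw [u, ← map_mul, Ideal.Quotient.eq] at hb
      exact ⟨_, hb, X v12 * b, Ideal.mul_mem_right _ _ (Ideal.mem_span_singleton_self _),
        sub_add_cancel _ _⟩
    · rintro ⟨i, hi, g, hg, rfl⟩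
      rw [map_add, Ideal.Quotient.eq_zero_iff_mem.2 hi, zero_add]
      exact map_dvd _ (Ideal.mem_span_singleton.1 hg)
  have hp : (RingHom.ker (th c0)).IsPrime := RingHom.ker_isPrime _
  refine ⟨?_, ?_, ?_⟩
  · intro h
    rw [u, Ideal.Quotient.eq_zero_iff_mem, I_eq, RingHom.mem_ker] at h
    exact (deg_th 1 v12 (by simp)).2 h
  · intro h
    have := (key 1).1 h.dvd
    exact hp.ne_top ((Ideal.eq_top_iff_one _).2 this)
  · intro a b hab
    obtain ⟨a, rfl⟩ := Ideal.Quotient.mk_surjective a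
    obtain ⟨b, rfl⟩ := Ideal.Quotient.mk_surjective b
    rw [← map_mul, key] at hab
    rw [key, key]
    exact hp.mem_or_mem hab

/-- Normality descends from the localisation at a prime element. -/
lemma normal_of_away {B L : Type} [CommRing B] [IsDomain B] [CommRing L] [Algebra B L]
    [IsIntegrallyClosed L] (t : B) (ht : Prime t) [IsLocalization.Away t L] :
    IsIntegrallyClosed B := by
  let K := FractionRing B
  have hunit : IsUnit (algebraMap B K t) := IsUnit.mk0 _ (by simpa using ht.ne_zero)
  let g : L →+* K := IsLocalization.Away.lift t hunit
  let := g.toAlgebra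
  have : IsScalarTower B L K := IsScalarTower.of_algebraMap_eq
    fun b => (IsLocalization.Away.lift_eq t hunit b).symm
  have := IsFractionRing.isFractionRing_of_isDomain_of_isLocalization (Submonoid.powers t) L K
  refine (isIntegrallyClosed_iff K).2 fun {x} hx => ?_
  have hxL : IsIntegral L x := hx.tower_top
  obtain ⟨l, rfl⟩ := (isIntegrallyClosed_iff K).1 ‹_› hxL
  obtain ⟨n, b, hb⟩ := IsLocalization.Away.surj t l
  have hb' : algebraMap L K l * algebraMap B K t ^ n = algebraMap B K b := by
    rw [IsScalarTower.algebraMap_apply B L K t, IsScalarTower.algebraMap_apply B L K b, ← hb,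
      map_mul, map_pow]
  generalize algebraMap L K l = x at *
  clear hb hxL
  induction n generalizing b with
  | zero => exact ⟨b, by simpa using hb'.symm⟩
  | succ n ih =>
    have hy : IsIntegral B (x * algebraMap B K t ^ n) :=
      hx.mul (isIntegral_algebraMap.pow n)
    obtain ⟨p, hp, hp0⟩ := hy
    have hd := Polynomial.dvd_pow_natDegree_of_eval₂_eq_zero (IsFractionRing.injective B K) hp t b
      _ hp0 (by rw [← hb']; ring)
    obtain ⟨b', rfl⟩ := ht.dvd_of_dvd_pow hd
    refine ih b' ?_
    have hne : algebraMap B K t ≠ 0 := by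
      simpa using ht.ne_zero
    apply mul_left_cancel₀ hne
    rw [← map_mul, ← hb']
    ring

/-- The polynomial ring in `u_{12}, u_{13}, u_{14}, u_{15}, u_{23}, u_{24}, u_{25}`. -/
abbrev A : Type := MvPolynomial (Fin 7) ℂ
abbrev L : Type := Localization.Away (X 0 : A)

/-- Images of the variables in `L`. -/
def z (i : Fin 7) : L := algebraMap A L (X i)

/-- The inverse of `u_{12}` in `L`. -/
def ti : L := IsLocalization.Away.invSelf (X 0 : A)

lemma z_ti : z 0 * ti = 1 := IsLocalization.Away.mul_invSelf (X 0 : A)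

def gf (p : Idx) : L :=
  (![![0, z 0, z 1, z 2, z 3], ![0, 0, z 4, z 5, z 6],
    ![0, 0, 0, (z 1 * z 5 - z 2 * z 4) * ti, (z 1 * z 6 - z 3 * z 4) * ti],
    ![0, 0, 0, 0, (z 2 * z 6 - z 3 * z 5) * ti], ![0, 0, 0, 0, 0]] :
      Fin 5 → Fin 5 → L) p.1.1 p.1.2

lemma gf12 : gf v12 = z 0 := rfl
lemma gf13 : gf v13 = z 1 := rfl
lemma gf14 : gf v14 = z 2 := rfl
lemma gf15 : gf v15 = z 3 := rfl
lemma gf23 : gf v23 = z 4 := rfl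
lemma gf24 : gf v24 = z 5 := rfl
lemma gf25 : gf v25 = z 6 := rfl
lemma gf34 : gf v34 = (z 1 * z 5 - z 2 * z 4) * ti := rfl
lemma gf35 : gf v35 = (z 1 * z 6 - z 3 * z 4) * ti := rfl
lemma gf45 : gf v45 = (z 2 * z 6 - z 3 * z 5) * ti := rfl

def g0 : PR →ₐ[ℂ] L := aeval gf

lemma g0_I (f : PR) (hf : f ∈ I) : g0 f = 0 := by
  suffices h : I ≤ RingHom.ker g0 from RingHom.mem_ker.1 (h hf)
  rw [Ideal.span_le]
  rintro _ ⟨k, rfl⟩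
  rw [SetLike.mem_coe, RingHom.mem_ker]
  have ht := z_ti
  fin_cases k
  · change g0 (Pf 0) = 0
    rw [Pf0]
    simp only [g0, map_add, map_sub, map_mul, aeval_X, gf12, gf13, gf14, gf15, gf23, gf24, gf25,
      gf34, gf35, gf45]
    ring
  · change g0 (Pf 1) = 0
    rw [Pf1]
    simp only [g0, map_add, map_sub, map_mul, aeval_X, gf12, gf13, gf14, gf15, gf23, gf24, gf25,
      gf34, gf35, gf45]
    ring
  · change g0 (Pf 2) = 0
    rw [Pf2]
    simp only [g0, map_add, map_sub, map_mul, aeval_X, gf12, gf13, gf14, gf15, gf23, gf24, gf25,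
      gf34, gf35, gf45]
    linear_combination (z 2 * z 6 - z 3 * z 5) * ht
  · change g0 (Pf 3) = 0
    rw [Pf3]
    simp only [g0, map_add, map_sub, map_mul, aeval_X, gf12, gf13, gf14, gf15, gf23, gf24, gf25,
      gf34, gf35, gf45]
    linear_combination (z 1 * z 6 - z 3 * z 4) * ht
  · change g0 (Pf 4) = 0
    rw [Pf4]
    simp only [g0, map_add, map_sub, map_mul, aeval_X, gf12, gf13, gf14, gf15, gf23, gf24, gf25,
      gf34, gf35, gf45]
    linear_combination (z 1 * z 5 - z 2 * z 4) * ht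

/-- The map `B → A[1/u_{12}]`. -/
def g : Bring →ₐ[ℂ] L := Ideal.Quotient.liftₐ I g0 g0_I

lemma g_u (p : Idx) : g (u p) = gf p := by
  change g0 (X p) = gf p
  simp [g0]

/-- The inclusion `A → B`. -/
def j : A →ₐ[ℂ] Bring := aeval ![u v12, u v13, u v14, u v15, u v23, u v24, u v25]

lemma g_j (a : A) : g (j a) = algebraMap A L a := by
  have : g.comp j = IsScalarTower.toAlgHom ℂ A L := by
    apply MvPolynomial.algHom_ext
    intro i
    rw [AlgHom.comp_apply, j, aeval_X]
    change _ = z i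
    fin_cases i <;> exact g_u _
  exact DFunLike.congr_fun this a

lemma rel (k : Fin 5) : Ideal.Quotient.mk I (Pf k) = 0 :=
  Ideal.Quotient.eq_zero_iff_mem.2 (Pf_mem k)

lemma exists_pow (b : Bring) : ∃ (n : ℕ) (a : A), u v12 ^ n * b = j a := by
  have j0 : j (X 0) = u v12 := by rw [j, aeval_X]; rfl
  have j1 : j (X 1) = u v13 := by rw [j, aeval_X]; rfl
  have j2 : j (X 2) = u v14 := by rw [j, aeval_X]; rfl
  have j3 : j (X 3) = u v15 := by rw [j, aeval_X]; rfl
  have j4 : j (X 4) = u v23 := by rw [j, aeval_X]; rfl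
  have j5 : j (X 5) = u v24 := by rw [j, aeval_X]; rfl
  have j6 : j (X 6) = u v25 := by rw [j, aeval_X]; rfl
  have hu : ∀ p, ∃ (n : ℕ) (a : A), u v12 ^ n * u p = j a := by
    intro p
    have hp : p ∈ (Finset.univ : Finset Idx) := Finset.mem_univ p
    rw [univ_eq] at hp
    simp only [Finset.mem_insert, Finset.mem_singleton] at hp
    rcases hp with rfl | rfl | rfl | rfl | rfl | rfl | rfl | rfl | rfl | rfl
    · exact ⟨0, X 0, by rw [j0]; ring⟩
    · exact ⟨0, X 1, by rw [j1]; ring⟩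
    · exact ⟨0, X 2, by rw [j2]; ring⟩
    · exact ⟨0, X 3, by rw [j3]; ring⟩
    · exact ⟨0, X 4, by rw [j4]; ring⟩
    · exact ⟨0, X 5, by rw [j5]; ring⟩
    · exact ⟨0, X 6, by rw [j6]; ring⟩
    · refine ⟨1, X 1 * X 5 - X 2 * X 4, ?_⟩
      have h := rel 4
      rw [Pf4, map_add, map_sub, map_mul, map_mul, map_mul] at h
      simp only [← u.eq_1] at h
      rw [map_sub, map_mul, map_mul, j1, j5, j2, j4]
      linear_combination h
    · refine ⟨1, X 1 * X 6 - X 3 * X 4, ?_⟩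
      have h := rel 3
      rw [Pf3, map_add, map_sub, map_mul, map_mul, map_mul] at h
      simp only [← u.eq_1] at h
      rw [map_sub, map_mul, map_mul, j1, j6, j3, j4]
      linear_combination h
    · refine ⟨1, X 2 * X 6 - X 3 * X 5, ?_⟩
      have h := rel 2
      rw [Pf2, map_add, map_sub, map_mul, map_mul, map_mul] at h
      simp only [← u.eq_1] at h
      rw [map_sub, map_mul, map_mul, j2, j6, j3, j5]
      linear_combination h
  obtain ⟨f, rfl⟩ := Ideal.Quotient.mk_surjective b
  induction f using MvPolynomial.induction_on with
  | C c =>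
    refine ⟨0, C c, ?_⟩
    rw [pow_zero, one_mul]
    exact (j.commutes c).symm
  | add p q hp hq =>
    obtain ⟨n, a, ha⟩ := hp
    obtain ⟨m, b, hb⟩ := hq
    refine ⟨n + m, X 0 ^ m * a + X 0 ^ n * b, ?_⟩
    rw [map_add, map_add, map_mul, map_mul, map_pow, map_pow, j0, ← ha, ← hb]
    ring
  | mul_X p v hp =>
    obtain ⟨n, a, ha⟩ := hp
    obtain ⟨m, b, hb⟩ := hu v
    refine ⟨n + m, a * b, ?_⟩
    rw [map_mul, map_mul, ← ha, ← hb, u, u]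
    ring

lemma X0_ne : (X 0 : A) ≠ 0 := X_ne_zero 0

lemma powers_le : Submonoid.powers (X 0 : A) ≤ nonZeroDivisors A :=
  powers_le_nonZeroDivisors_of_noZeroDivisors X0_ne

lemma g_inj : Function.Injective g := by
  rw [injective_iff_map_eq_zero]
  intro b hb
  obtain ⟨n, a, ha⟩ := exists_pow b
  have h : algebraMap A L a = 0 := by rw [← g_j, ← ha, map_mul, hb, mul_zero]
  have h' : a = 0 := IsLocalization.injective L powers_le (by rw [h, map_zero])
  rw [h', map_zero] at ha
  exact (mul_eq_zero.1 ha).resolve_left (pow_ne_zero _ prime_u12.ne_zero)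

lemma normal : IsIntegrallyClosed Bring := by
  have hL : IsIntegrallyClosed L :=
    isIntegrallyClosed_of_isLocalization L (Submonoid.powers (X 0 : A)) powers_le
  let : Algebra Bring L := g.toRingHom.toAlgebra
  have hal : ∀ b, algebraMap Bring L b = g b := fun b => rfl
  have h0 : g (u v12) = algebraMap A L (X 0) := g_u v12
  have : IsLocalization.Away (u v12) L := by
    apply IsLocalization.Away.mk
    · rw [hal, h0]
      exact IsLocalization.Away.algebraMap_isUnit (X 0 : A)
    · intro s
      obtain ⟨n, a, ha⟩ := IsLocalization.Away.surj (X 0 : A) s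
      exact ⟨n, j a, by rw [hal, hal, h0, g_j, ha]⟩
    · intro a b hab
      exact ⟨0, by rw [g_inj hab]⟩
  exact normal_of_away (L := L) (u v12) prime_u12

end PfProof

/-- the integral domain `B = ℂ[u_{ij}]/(P₁,…,P₅)` is normal, i.e. it is a
domain which is integrally closed in its field of fractions. -/
theorem pfaffianRing_normal : IsDomain Bring ∧ IsIntegrallyClosed Bring :=
  ⟨PfProof.instDom, PfProof.normal⟩
end
end

section
/- The ring B = ℂ[u_{ij}]/(P₁,…,P₅) has Krull dimension 7, and its depth with respect to the irrelevant maximal ideal 𝔪 = (u_{ij} : 1≤i<j≤5) is 7: there exists a regular B-sequence of length 7 consisting of elements of 𝔪, and every regular B-sequence of elements of 𝔪 has length at most 7 (so B is Cohen–Macaulay). -/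
noncomputable section

/-- The irrelevant maximal ideal `𝔪 = (u_{ij} : 1 ≤ i < j ≤ 5)` of `B`. -/
def mIdeal : Ideal Bring :=
  Ideal.span (Set.range fun p : {p : Fin 5 × Fin 5 // p.1 < p.2} =>
    Ideal.Quotient.mk (Ideal.span (Set.range Pf)) (MvPolynomial.X p))

/-- `x₁,…,x_n` is a regular `B`-sequence: `x_i` is a nonzerodivisor on
`B/(x₁,…,x_{i−1})B` for each `i`, and `B/(x₁,…,x_n)B ≠ 0`. -/
def IsRegSeq {n : ℕ} (x : Fin n → Bring) : Prop :=
  (∀ i : Fin n, ∀ z : Bring,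
      x i * z ∈ Ideal.span (x '' {j | j < i}) → z ∈ Ideal.span (x '' {j | j < i})) ∧
  Ideal.span (Set.range x) ≠ ⊤


abbrev AR : Type := MvPolynomial (Fin 7) ℂ

/-- The `(i,j)` variable in the quotient. -/
def bv (p : {p : Fin 5 × Fin 5 // p.1 < p.2}) : Bring :=
  Ideal.Quotient.mk (Ideal.span (Set.range Pf)) (MvPolynomial.X p)

abbrev i12 : {p : Fin 5 × Fin 5 // p.1 < p.2} := ⟨(0, 1), by decide⟩
abbrev i13 : {p : Fin 5 × Fin 5 // p.1 < p.2} := ⟨(0, 2), by decide⟩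
abbrev i14 : {p : Fin 5 × Fin 5 // p.1 < p.2} := ⟨(0, 3), by decide⟩
abbrev i15 : {p : Fin 5 × Fin 5 // p.1 < p.2} := ⟨(0, 4), by decide⟩
abbrev i23 : {p : Fin 5 × Fin 5 // p.1 < p.2} := ⟨(1, 2), by decide⟩
abbrev i24 : {p : Fin 5 × Fin 5 // p.1 < p.2} := ⟨(1, 3), by decide⟩
abbrev i25 : {p : Fin 5 × Fin 5 // p.1 < p.2} := ⟨(1, 4), by decide⟩
abbrev i34 : {p : Fin 5 × Fin 5 // p.1 < p.2} := ⟨(2, 3), by decide⟩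
abbrev i35 : {p : Fin 5 × Fin 5 // p.1 < p.2} := ⟨(2, 4), by decide⟩
abbrev i45 : {p : Fin 5 × Fin 5 // p.1 < p.2} := ⟨(3, 4), by decide⟩

lemma Pf_zero : Pf 0 = MvPolynomial.X i23 * MvPolynomial.X i45 -
    MvPolynomial.X i24 * MvPolynomial.X i35 + MvPolynomial.X i25 * MvPolynomial.X i34 := rfl
lemma Pf_one : Pf 1 = MvPolynomial.X i13 * MvPolynomial.X i45 -
    MvPolynomial.X i14 * MvPolynomial.X i35 + MvPolynomial.X i15 * MvPolynomial.X i34 := rfl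
lemma Pf_two : Pf 2 = MvPolynomial.X i12 * MvPolynomial.X i45 -
    MvPolynomial.X i14 * MvPolynomial.X i25 + MvPolynomial.X i15 * MvPolynomial.X i24 := rfl
lemma Pf_three : Pf 3 = MvPolynomial.X i12 * MvPolynomial.X i35 -
    MvPolynomial.X i13 * MvPolynomial.X i25 + MvPolynomial.X i15 * MvPolynomial.X i23 := rfl
lemma Pf_four : Pf 4 = MvPolynomial.X i12 * MvPolynomial.X i34 -
    MvPolynomial.X i13 * MvPolynomial.X i24 + MvPolynomial.X i14 * MvPolynomial.X i23 := rfl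

lemma mk_Pf (k : Fin 5) : Ideal.Quotient.mk (Ideal.span (Set.range Pf)) (Pf k) = 0 :=
  Ideal.Quotient.eq_zero_iff_mem.mpr (Ideal.subset_span ⟨k, rfl⟩)

lemma rel0 : bv i23 * bv i45 - bv i24 * bv i35 + bv i25 * bv i34 = 0 := by
  have h := mk_Pf 0
  rw [Pf_zero] at h; simp only [map_add, map_sub, map_mul] at h; exact h
lemma rel1 : bv i13 * bv i45 - bv i14 * bv i35 + bv i15 * bv i34 = 0 := by
  have h := mk_Pf 1
  rw [Pf_one] at h; simp only [map_add, map_sub, map_mul] at h; exact h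
lemma rel2 : bv i12 * bv i45 - bv i14 * bv i25 + bv i15 * bv i24 = 0 := by
  have h := mk_Pf 2
  rw [Pf_two] at h; simp only [map_add, map_sub, map_mul] at h; exact h
lemma rel3 : bv i12 * bv i35 - bv i13 * bv i25 + bv i15 * bv i23 = 0 := by
  have h := mk_Pf 3
  rw [Pf_three] at h; simp only [map_add, map_sub, map_mul] at h; exact h
lemma rel4 : bv i12 * bv i34 - bv i13 * bv i24 + bv i14 * bv i23 = 0 := by
  have h := mk_Pf 4
  rw [Pf_four] at h; simp only [map_add, map_sub, map_mul] at h; exact h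

/-- The system of parameters. -/
def theta : Fin 7 → Bring :=
  ![bv i12, bv i23, bv i34, bv i45, bv i15, bv i13 + bv i24 + bv i35, bv i14 + bv i25 + bv i35]

def psi : AR →+* Bring := (MvPolynomial.aeval theta : AR →ₐ[ℂ] Bring).toRingHom

lemma psi_X (i : Fin 7) : psi (MvPolynomial.X i) = theta i := by
  simp [psi]

instance instAlgAB : Algebra AR Bring := psi.toAlgebra

instance instModAB : Module AR Bring := instAlgAB.toModule

lemma smul_AB (a : AR) (b : Bring) : a • b = psi a * b := rfl

section Mats
variable {R : Type*} [CommRing R] (a b c d e p q : R)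

/-- Multiplication by `u₂₄` on the basis `1, u₂₄, u₂₅, u₃₅, u₂₅u₃₅` (rows). -/
def matX : Matrix (Fin 5) (Fin 5) R :=
  !![0, 1, 0, 0, 0;
     -a*c-q*b-b*d, p, b-c, b, 0;
     -e*b, 0, p, -a, -1;
     b*d, 0, c, 0, 0;
     -a*c*d, -c*e, b*d+c*q, 0, -c]

/-- Multiplication by `u₂₅`. -/
def matY : Matrix (Fin 5) (Fin 5) R :=
  !![0, 0, 1, 0, 0;
     -e*b, 0, p, -a, -1;
     -a*d, -e, q, 0, -1;
     0, 0, 0, 0, 1;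
     -p*a*d-a*c*d-a*c*e-b*d*e, a*d-c*e, b*d+c*q-c*e, q*a+e*b, q-p-a-c]

/-- Multiplication by `u₃₅`. -/
def matZ : Matrix (Fin 5) (Fin 5) R :=
  !![0, 0, 0, 1, 0;
     b*d, 0, c, 0, 0;
     0, 0, 0, 0, 1;
     -p*d-e*c, d, 0, q+d, -1;
     p*a*d+a*c*d+a*c*e, c*e-a*d, -b*d-c*q, -a*d-q*a-e*b, p+a+c]

lemma comm_XY : matX a b c d e p q * matY a b c d e p q =
    matY a b c d e p q * matX a b c d e p q := by
  ext i j
  fin_cases i <;> fin_cases j <;>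
    simp [matX, matY, Matrix.mul_apply, Fin.sum_univ_five] <;> ring
lemma comm_XZ : matX a b c d e p q * matZ a b c d e p q =
    matZ a b c d e p q * matX a b c d e p q := by
  ext i j
  fin_cases i <;> fin_cases j <;>
    simp [matX, matZ, Matrix.mul_apply, Fin.sum_univ_five] <;> ring
lemma comm_YZ : matY a b c d e p q * matZ a b c d e p q =
    matZ a b c d e p q * matY a b c d e p q := by
  ext i j
  fin_cases i <;> fin_cases j <;>
    simp [matY, matZ, Matrix.mul_apply, Fin.sum_univ_five] <;> ring

lemma mrel0 : (b*d) • (1 : Matrix (Fin 5) (Fin 5) R) - matX a b c d e p q * matZ a b c d e p q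
    + c • matY a b c d e p q = 0 := by
  ext i j
  fin_cases i <;> fin_cases j <;>
    simp [matX, matY, matZ, Matrix.mul_apply, Fin.sum_univ_five] <;> ring
lemma mrel1 : d • (p • (1 : Matrix (Fin 5) (Fin 5) R) - matX a b c d e p q - matZ a b c d e p q)
    - (q • (1 : Matrix (Fin 5) (Fin 5) R) - matY a b c d e p q - matZ a b c d e p q) *
      matZ a b c d e p q + (e * c) • 1 = 0 := by
  ext i j
  fin_cases i <;> fin_cases j <;>
    simp [matX, matY, matZ, Matrix.mul_apply, Fin.sum_univ_five] <;> ring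
lemma mrel2 : (a * d) • (1 : Matrix (Fin 5) (Fin 5) R)
    - (q • (1 : Matrix (Fin 5) (Fin 5) R) - matY a b c d e p q - matZ a b c d e p q) *
      matY a b c d e p q + e • matX a b c d e p q = 0 := by
  ext i j
  fin_cases i <;> fin_cases j <;>
    simp [matX, matY, matZ, Matrix.mul_apply, Fin.sum_univ_five] <;> ring
lemma mrel3 : a • matZ a b c d e p q
    - (p • (1 : Matrix (Fin 5) (Fin 5) R) - matX a b c d e p q - matZ a b c d e p q) *
      matY a b c d e p q + (e * b) • 1 = 0 := by
  ext i j
  fin_cases i <;> fin_cases j <;>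
    simp [matX, matY, matZ, Matrix.mul_apply, Fin.sum_univ_five] <;> ring
lemma mrel4 : (a * c) • (1 : Matrix (Fin 5) (Fin 5) R)
    - (p • (1 : Matrix (Fin 5) (Fin 5) R) - matX a b c d e p q - matZ a b c d e p q) *
      matX a b c d e p q +
    b • (q • (1 : Matrix (Fin 5) (Fin 5) R) - matY a b c d e p q - matZ a b c d e p q) = 0 := by
  ext i j
  fin_cases i <;> fin_cases j <;>
    simp [matX, matY, matZ, Matrix.mul_apply, Fin.sum_univ_five] <;> ring

end Mats

set_option linter.unusedSimpArgs false
set_option synthInstance.maxHeartbeats 200000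
open MvPolynomial (X C)

abbrev mX : Matrix (Fin 5) (Fin 5) AR := matX (X 0) (X 1) (X 2) (X 3) (X 4) (X 5) (X 6)
abbrev mY : Matrix (Fin 5) (Fin 5) AR := matY (X 0) (X 1) (X 2) (X 3) (X 4) (X 5) (X 6)
abbrev mZ : Matrix (Fin 5) (Fin 5) AR := matZ (X 0) (X 1) (X 2) (X 3) (X 4) (X 5) (X 6)

abbrev SA : Subalgebra AR (Matrix (Fin 5) (Fin 5) AR) := Algebra.adjoin AR {mX, mY, mZ}

instance instSAcomm : IsMulCommutative SA := by
  apply Algebra.isMulCommutative_adjoin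
  rintro x (rfl | rfl | rfl) y (rfl | rfl | rfl)
  · rfl
  · exact comm_XY _ _ _ _ _ _ _
  · exact comm_XZ _ _ _ _ _ _ _
  · exact (comm_XY _ _ _ _ _ _ _).symm
  · rfl
  · exact comm_YZ _ _ _ _ _ _ _
  · exact (comm_XZ _ _ _ _ _ _ _).symm
  · exact (comm_YZ _ _ _ _ _ _ _).symm
  · rfl

open scoped IsMulCommutative in
instance instSAring : CommRing SA := inferInstance

def sX : SA := ⟨mX, Algebra.subset_adjoin (by simp)⟩
def sY : SA := ⟨mY, Algebra.subset_adjoin (by simp)⟩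
def sZ : SA := ⟨mZ, Algebra.subset_adjoin (by simp)⟩

def al : AR →+* SA := algebraMap AR SA

lemma coe_al (a : AR) : ((al a : SA) : Matrix (Fin 5) (Fin 5) AR) = a • 1 :=
  Algebra.algebraMap_eq_smul_one a

lemma coe_add' (x y : SA) : ((x + y : SA) : Matrix (Fin 5) (Fin 5) AR) = x + y := rfl
lemma coe_sub' (x y : SA) : ((x - y : SA) : Matrix (Fin 5) (Fin 5) AR) = x - y := rfl
lemma coe_mul' (x y : SA) : ((x * y : SA) : Matrix (Fin 5) (Fin 5) AR) = x * y := rfl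

/-- The images of the variables. -/
def Tm (p : {p : Fin 5 × Fin 5 // p.1 < p.2}) : SA :=
  (!![0, al (X 0), al (X 5) - sX - sZ, al (X 6) - sY - sZ, al (X 4);
      0, 0, al (X 1), sX, sY;
      0, 0, 0, al (X 2), sZ;
      0, 0, 0, 0, al (X 3);
      0, 0, 0, 0, 0] : Matrix (Fin 5) (Fin 5) SA) p.1.1 p.1.2

lemma Tm12 : Tm i12 = al (X 0) := rfl
lemma Tm13 : Tm i13 = al (X 5) - sX - sZ := rfl
lemma Tm14 : Tm i14 = al (X 6) - sY - sZ := rfl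
lemma Tm15 : Tm i15 = al (X 4) := rfl
lemma Tm23 : Tm i23 = al (X 1) := rfl
lemma Tm24 : Tm i24 = sX := rfl
lemma Tm25 : Tm i25 = sY := rfl
lemma Tm34 : Tm i34 = al (X 2) := rfl
lemma Tm35 : Tm i35 = sZ := rfl
lemma Tm45 : Tm i45 = al (X 3) := rfl

def phi0 : PR →+* SA := MvPolynomial.eval₂Hom (al.comp C) Tm

lemma phi0_X (p) : phi0 (X p) = Tm p := by simp [phi0]

lemma phi0_Pf (k : Fin 5) : phi0 (Pf k) = 0 := by
  fin_cases k
  · change phi0 (Pf 0) = 0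
    simp only [Pf_zero, map_add, map_sub, map_mul, phi0_X, Tm12, Tm13, Tm14, Tm15, Tm23, Tm24,
      Tm25, Tm34, Tm35, Tm45]
    apply Subtype.ext
    simp only [coe_al, coe_add', coe_sub', coe_mul']
    refine Eq.trans ?_ (mrel0 (X 0) (X 1) (X 2) (X 3) (X 4) (X 5) (X 6))
    simp [sX, sY, sZ, smul_smul, mul_comm]
  · change phi0 (Pf 1) = 0
    simp only [Pf_one, map_add, map_sub, map_mul, phi0_X, Tm12, Tm13, Tm14, Tm15, Tm23, Tm24,
      Tm25, Tm34, Tm35, Tm45]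
    apply Subtype.ext
    simp only [coe_al, coe_add', coe_sub', coe_mul']
    refine Eq.trans ?_ (mrel1 (X 0) (X 1) (X 2) (X 3) (X 4) (X 5) (X 6))
    simp [sX, sY, sZ, smul_smul, mul_comm]
  · change phi0 (Pf 2) = 0
    simp only [Pf_two, map_add, map_sub, map_mul, phi0_X, Tm12, Tm13, Tm14, Tm15, Tm23, Tm24,
      Tm25, Tm34, Tm35, Tm45]
    apply Subtype.ext
    simp only [coe_al, coe_add', coe_sub', coe_mul']
    refine Eq.trans ?_ (mrel2 (X 0) (X 1) (X 2) (X 3) (X 4) (X 5) (X 6))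
    simp [sX, sY, sZ, smul_smul, mul_comm]
  · change phi0 (Pf 3) = 0
    simp only [Pf_three, map_add, map_sub, map_mul, phi0_X, Tm12, Tm13, Tm14, Tm15, Tm23, Tm24,
      Tm25, Tm34, Tm35, Tm45]
    apply Subtype.ext
    simp only [coe_al, coe_add', coe_sub', coe_mul']
    refine Eq.trans ?_ (mrel3 (X 0) (X 1) (X 2) (X 3) (X 4) (X 5) (X 6))
    simp [sX, sY, sZ, smul_smul, mul_comm]
  · change phi0 (Pf 4) = 0
    simp only [Pf_four, map_add, map_sub, map_mul, phi0_X, Tm12, Tm13, Tm14, Tm15, Tm23, Tm24,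
      Tm25, Tm34, Tm35, Tm45]
    apply Subtype.ext
    simp only [coe_al, coe_add', coe_sub', coe_mul']
    refine Eq.trans ?_ (mrel4 (X 0) (X 1) (X 2) (X 3) (X 4) (X 5) (X 6))
    simp [sX, sY, sZ, smul_smul, mul_comm]

def phi : Bring →+* SA := Ideal.Quotient.lift (Ideal.span (Set.range Pf)) phi0 (by
  intro a ha
  have : Ideal.span (Set.range Pf) ≤ RingHom.ker phi0 := by
    rw [Ideal.span_le]
    rintro _ ⟨k, rfl⟩
    exact phi0_Pf k
  exact RingHom.mem_ker.mp (this ha))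

lemma phi_mk (f : PR) : phi (Ideal.Quotient.mk (Ideal.span (Set.range Pf)) f) = phi0 f := rfl

lemma phi_bv (p) : phi (bv p) = Tm p := by
  rw [bv, phi_mk, phi0_X]

lemma phi_psi (a : AR) : phi (psi a) = al a := by
  suffices h : phi.comp psi = al from congrArg (fun f => f a) h
  apply MvPolynomial.ringHom_ext
  · intro r
    have h1 : psi (C r) = Ideal.Quotient.mk (Ideal.span (Set.range Pf)) (C r) := by
      have : psi (C r) = algebraMap ℂ Bring r := by simp [psi]
      rw [this]; rfl
    rw [RingHom.comp_apply, h1, phi_mk]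
    simp [phi0]
  · intro i
    rw [RingHom.comp_apply, psi_X]
    fin_cases i <;> simp [theta, phi_bv, Tm12, Tm13, Tm14, Tm15, Tm23, Tm24,
      Tm25, Tm34, Tm35, Tm45]
    all_goals ring

/-- The coordinate map `B → A^5`. -/
def Lmap : Bring →ₗ[AR] (Fin 5 → AR) where
  toFun b := (phi b : Matrix (Fin 5) (Fin 5) AR) 0
  map_add' x y := by rw [map_add]; rfl
  map_smul' a x := by
    rw [smul_AB, map_mul, phi_psi, coe_mul', coe_al, smul_mul_assoc, one_mul]
    rfl

def bas : Fin 5 → Bring := ![1, bv i24, bv i25, bv i35, bv i25 * bv i35]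

lemma Lmap_bas (i : Fin 5) : Lmap (bas i) = Pi.single i 1 := by
  change (phi (bas i) : Matrix (Fin 5) (Fin 5) AR) 0 = _
  fin_cases i
  · simp only [bas]
    simp
    ext j
    fin_cases j <;> simp [Matrix.one_apply]
  · simp [bas, phi_bv, Tm24, sX, matX]
    ext j; fin_cases j <;> simp
  · simp [bas, phi_bv, Tm25, sY, matY]
    ext j; fin_cases j <;> simp
  · simp [bas, phi_bv, Tm35, sZ, matZ]
    ext j; fin_cases j <;> simp
  · simp only [bas]
    simp [phi_bv, Tm35, Tm25, sZ, sY, coe_mul']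
    ext j; fin_cases j <;> simp [matY, matZ, Matrix.mul_apply, Fin.sum_univ_five]

def Gmap : (Fin 5 → AR) →ₗ[AR] Bring := Fintype.linearCombination AR bas

lemma Gmap_apply (v : Fin 5 → AR) : Gmap v = psi (v 0) + psi (v 1) * bv i24 + psi (v 2) * bv i25
    + psi (v 3) * bv i35 + psi (v 4) * (bv i25 * bv i35) := by
  simp [Gmap, Fintype.linearCombination_apply, Fin.sum_univ_five, smul_AB, bas]

lemma L_G (v : Fin 5 → AR) : Lmap (Gmap v) = v := by
  rw [Gmap, Fintype.linearCombination_apply, map_sum]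
  simp only [map_smul, Lmap_bas]
  ext j; fin_cases j <;> simp [Fin.sum_univ_five]
open Matrix in
lemma G_X (v : Fin 5 → AR) : bv i24 * Gmap v = Gmap (v ᵥ* mX) := by
  simp only [Gmap_apply, Matrix.vecMul, dotProduct, Fin.sum_univ_five, matX, Matrix.of_apply,
    Matrix.cons_val, map_add, map_sub, map_mul, map_neg, map_zero, map_one, psi_X, theta]
  have h0 := rel0
  have h1 := rel1
  have h2 := rel2
  have h3 := rel3
  have h4 := rel4
  generalize bv i12 = u12 at *
  generalize bv i13 = u13 at *
  generalize bv i14 = u14 at *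
  generalize bv i15 = u15 at *
  generalize bv i23 = u23 at *
  generalize bv i24 = u24 at *
  generalize bv i25 = u25 at *
  generalize bv i34 = u34 at *
  generalize bv i35 = u35 at *
  generalize bv i45 = u45 at *
  generalize psi (v 0) = w0
  generalize psi (v 1) = w1
  generalize psi (v 2) = w2
  generalize psi (v 3) = w3
  generalize psi (v 4) = w4
  linear_combination w1 * (h4 + h0) + w2 * h3 - w3 * h0 + w4 * (-u25 * h0 + u34 * h2)

open Matrix in
lemma G_Y (v : Fin 5 → AR) : bv i25 * Gmap v = Gmap (v ᵥ* mY) := by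
  simp only [Gmap_apply, Matrix.vecMul, dotProduct, Fin.sum_univ_five, matY, Matrix.of_apply,
    Matrix.cons_val, map_add, map_sub, map_mul, map_neg, map_zero, map_one, psi_X, theta]
  have h0 := rel0
  have h1 := rel1
  have h2 := rel2
  have h3 := rel3
  have h4 := rel4
  generalize bv i12 = u12 at *
  generalize bv i13 = u13 at *
  generalize bv i14 = u14 at *
  generalize bv i15 = u15 at *
  generalize bv i23 = u23 at *
  generalize bv i24 = u24 at *
  generalize bv i25 = u25 at *
  generalize bv i34 = u34 at *
  generalize bv i35 = u35 at *
  generalize bv i45 = u45 at *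
  generalize psi (v 0) = w0
  generalize psi (v 1) = w1
  generalize psi (v 2) = w2
  generalize psi (v 3) = w3
  generalize psi (v 4) = w4
  linear_combination w1 * h3 + w2 * h2 +
    w4 * ((u15 - u25) * h0 + (u34 + u35) * h2 - u35 * h3 + u12 * h1)

open Matrix in
lemma G_Z (v : Fin 5 → AR) : bv i35 * Gmap v = Gmap (v ᵥ* mZ) := by
  simp only [Gmap_apply, Matrix.vecMul, dotProduct, Fin.sum_univ_five, matZ, Matrix.of_apply,
    Matrix.cons_val, map_add, map_sub, map_mul, map_neg, map_zero, map_one, psi_X, theta]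
  have h0 := rel0
  have h1 := rel1
  have h2 := rel2
  have h3 := rel3
  have h4 := rel4
  generalize bv i12 = u12 at *
  generalize bv i13 = u13 at *
  generalize bv i14 = u14 at *
  generalize bv i15 = u15 at *
  generalize bv i23 = u23 at *
  generalize bv i24 = u24 at *
  generalize bv i25 = u25 at *
  generalize bv i34 = u34 at *
  generalize bv i35 = u35 at *
  generalize bv i45 = u45 at *
  generalize psi (v 0) = w0
  generalize psi (v 1) = w1
  generalize psi (v 2) = w2
  generalize psi (v 3) = w3
  generalize psi (v 4) = w4
  linear_combination -w1 * h0 + w3 * h1 + w4 * (u25 * h0 + u35 * h3 - u12 * h1 - u34 * h2)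

lemma psi_C (r : ℂ) : psi (C r) = Ideal.Quotient.mk (Ideal.span (Set.range Pf)) (C r) := by
  have : psi (C r) = algebraMap ℂ Bring r := by simp [psi]
  rw [this]; rfl

lemma psi_stab (a : AR) (b : Bring) (hb : b ∈ LinearMap.range Gmap) :
    psi a * b ∈ LinearMap.range Gmap := by
  rw [← smul_AB]
  exact Submodule.smul_mem _ a hb

lemma bv_stab (p) (b : Bring) (hb : b ∈ LinearMap.range Gmap) :
    bv p * b ∈ LinearMap.range Gmap := by
  have hx : bv i24 * b ∈ LinearMap.range Gmap := by
    obtain ⟨v, rfl⟩ := hb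
    exact ⟨_, (G_X v).symm⟩
  have hy : bv i25 * b ∈ LinearMap.range Gmap := by
    obtain ⟨v, rfl⟩ := hb
    exact ⟨_, (G_Y v).symm⟩
  have hz : bv i35 * b ∈ LinearMap.range Gmap := by
    obtain ⟨v, rfl⟩ := hb
    exact ⟨_, (G_Z v).symm⟩
  have ht : ∀ i, theta i * b ∈ LinearMap.range Gmap := fun i => by
    rw [← psi_X]; exact psi_stab _ _ hb
  have hp : p = i12 ∨ p = i13 ∨ p = i14 ∨ p = i15 ∨ p = i23 ∨ p = i24 ∨ p = i25 ∨ p = i34 ∨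
      p = i35 ∨ p = i45 := by revert p; decide
  rcases hp with rfl | rfl | rfl | rfl | rfl | rfl | rfl | rfl | rfl | rfl
  · exact ht 0
  · have h : bv i13 * b = theta 5 * b - bv i24 * b - bv i35 * b := by
      change _ = (bv i13 + bv i24 + bv i35) * b - bv i24 * b - bv i35 * b
      ring
    rw [h]
    exact Submodule.sub_mem _ (Submodule.sub_mem _ (ht 5) hx) hz
  · have h : bv i14 * b = theta 6 * b - bv i25 * b - bv i35 * b := by
      change _ = (bv i14 + bv i25 + bv i35) * b - bv i25 * b - bv i35 * b
      ring
    rw [h]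
    exact Submodule.sub_mem _ (Submodule.sub_mem _ (ht 6) hy) hz
  · exact ht 4
  · exact ht 1
  · exact hx
  · exact hy
  · exact ht 2
  · exact hz
  · exact ht 3

lemma all_stab (f : PR) : ∀ b ∈ LinearMap.range Gmap,
    Ideal.Quotient.mk (Ideal.span (Set.range Pf)) f * b ∈ LinearMap.range Gmap := by
  induction f using MvPolynomial.induction_on with
  | C r =>
    intro b hb
    rw [← psi_C]; exact psi_stab _ _ hb
  | add f g hf hg =>
    intro b hb
    rw [map_add, add_mul]
    exact Submodule.add_mem _ (hf b hb) (hg b hb)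
  | mul_X f p hf =>
    intro b hb
    rw [map_mul, mul_assoc]
    exact hf _ (bv_stab p b hb)

lemma Gmap_surj : Function.Surjective Gmap := by
  intro b
  obtain ⟨f, rfl⟩ := Ideal.Quotient.mk_surjective b
  have h1 : (1 : Bring) ∈ LinearMap.range Gmap := ⟨Pi.single 0 1, by simp [Gmap_apply]⟩
  have := all_stab f 1 h1
  rwa [mul_one] at this

lemma G_L (b : Bring) : Gmap (Lmap b) = b := by
  obtain ⟨v, rfl⟩ := Gmap_surj b
  rw [L_G]

lemma mem_span_theta (s : Set (Fin 7)) (b : Bring) : b ∈ Ideal.span (theta '' s) ↔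
    ∀ i, Lmap b i ∈ Ideal.span (X '' s : Set AR) := by
  constructor
  · intro hb
    induction hb using Submodule.span_induction with
    | mem x hx =>
      obtain ⟨j, hj, rfl⟩ := hx
      intro i
      have : theta j = (X j : AR) • (1 : Bring) := by rw [smul_AB, psi_X, mul_one]
      rw [this, map_smul, Pi.smul_apply, smul_eq_mul]
      exact Ideal.mul_mem_right _ _ (Ideal.subset_span ⟨j, hj, rfl⟩)
    | zero => simp
    | add x y _ _ hx hy =>
      intro i
      rw [map_add]
      exact Ideal.add_mem _ (hx i) (hy i)
    | smul r x _ hx =>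
      intro k
      have h : r • x = ∑ i, Lmap x i • (r * bas i) := by
        conv_lhs => rw [← G_L x]
        rw [Gmap, Fintype.linearCombination_apply, smul_eq_mul, Finset.mul_sum]
        exact Finset.sum_congr rfl fun i _ => by rw [smul_AB, smul_AB]; ring
      rw [h, map_sum, Finset.sum_apply]
      refine Ideal.sum_mem _ fun i _ => ?_
      rw [map_smul, Pi.smul_apply, smul_eq_mul]
      exact Ideal.mul_mem_right _ _ (hx i)
  · intro h
    rw [← G_L b, Gmap, Fintype.linearCombination_apply]
    refine Ideal.sum_mem _ fun i _ => ?_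
    rw [smul_AB]
    refine Ideal.mul_mem_right _ _ ?_
    have := Ideal.mem_map_of_mem psi (h i)
    rw [Ideal.map_span, Set.image_image] at this
    simpa only [psi_X] using this

lemma X_reg (s : Set (Fin 7)) (i : Fin 7) (hi : i ∉ s) (f : AR)
    (h : X i * f ∈ Ideal.span (X '' s : Set AR)) : f ∈ Ideal.span (X '' s : Set AR) := by
  rw [MvPolynomial.mem_ideal_span_X_image] at h ⊢
  intro m hm
  obtain ⟨j, hj, hne⟩ := h (Finsupp.single i 1 + m) (by
    rw [MvPolynomial.mem_support_iff, MvPolynomial.coeff_X_mul]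
    exact MvPolynomial.mem_support_iff.mp hm)
  refine ⟨j, hj, ?_⟩
  have hij : i ≠ j := by rintro rfl; exact hi hj
  simpa [Finsupp.single_apply, hij] using hne

lemma theta_reg : IsRegSeq theta := by
  constructor
  · intro i z hz
    rw [mem_span_theta] at hz ⊢
    intro k
    apply X_reg _ i (by simp)
    have := hz k
    rwa [← psi_X, ← smul_AB, map_smul, Pi.smul_apply, smul_eq_mul] at this
  · intro h
    have h1 : (1 : Bring) ∈ Ideal.span (theta '' Set.univ) := by
      rw [Set.image_univ, h]; trivial
    rw [mem_span_theta] at h1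
    have h2 := h1 0
    have h3 : Lmap 1 = Pi.single 0 1 := Lmap_bas 0
    rw [h3, Pi.single_eq_same, MvPolynomial.mem_ideal_span_X_image] at h2
    obtain ⟨j, -, hj⟩ := h2 0 (by simp)
    exact hj rfl

lemma theta_mem (i : Fin 7) : theta i ∈ mIdeal := by
  have h : ∀ p, bv p ∈ mIdeal := fun p => Ideal.subset_span ⟨p, rfl⟩
  fin_cases i
  · exact h _
  · exact h _
  · exact h _
  · exact h _
  · exact h _
  · exact Ideal.add_mem _ (Ideal.add_mem _ (h _) (h _)) (h _)
  · exact Ideal.add_mem _ (Ideal.add_mem _ (h _) (h _)) (h _)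

lemma regSeq_dim {R : Type*} [CommRing R] {n : ℕ} (x : Fin n → R)
    (h : ∀ i : Fin n, ∀ z : R,
      x i * z ∈ Ideal.span (x '' {j | j < i}) → z ∈ Ideal.span (x '' {j | j < i}))
    (k : ℕ) (hk : k ≤ n) :
    ringKrullDim (R ⧸ Ideal.span (x '' {j | j.1 < k})) + (k : WithBot ℕ∞) ≤ ringKrullDim R := by
  induction k with
  | zero =>
    simpa using ringKrullDim_quotient_le _
  | succ k ih =>
    refine le_trans ?_ (ih (by omega))
    have hle : Ideal.span (x '' {j | j.1 < k}) ≤ Ideal.span (x '' {j | j.1 < k + 1}) :=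
      Ideal.span_mono (Set.image_mono fun j (hj : j.1 < k) => (by simp; omega))
    have key := ringKrullDim_succ_le_of_surjective (Ideal.Quotient.factor hle)
      (Ideal.Quotient.factor_surjective hle)
      (r := Ideal.Quotient.mk _ (x ⟨k, by omega⟩)) (by
        rw [mem_nonZeroDivisors_iff_right]
        intro z hz
        obtain ⟨z, rfl⟩ := Ideal.Quotient.mk_surjective z
        rw [← map_mul, Ideal.Quotient.eq_zero_iff_mem, mul_comm] at hz
        rw [Ideal.Quotient.eq_zero_iff_mem]
        exact h ⟨k, by omega⟩ z hz) (by
        rw [Ideal.Quotient.factor_mk, Ideal.Quotient.eq_zero_iff_mem]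
        exact Ideal.subset_span ⟨_, by simp, rfl⟩)
    calc _ = (ringKrullDim (R ⧸ Ideal.span (x '' {j | j.1 < k + 1})) + 1) + (k : WithBot ℕ∞) := by
          push_cast
          rw [add_assoc, add_comm (1 : WithBot ℕ∞)]
      _ ≤ _ := by gcongr

lemma isRegSeq_le {n : ℕ} (x : Fin n → Bring) (h : IsRegSeq x) :
    (n : WithBot ℕ∞) ≤ ringKrullDim Bring := by
  have h1 := regSeq_dim x h.1 n le_rfl
  have h2 : x '' {j | j.1 < n} = Set.range x := by
    rw [← Set.image_univ]; congr; ext j; simp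
  rw [h2] at h1
  have : Nontrivial (Bring ⧸ Ideal.span (Set.range x)) := Ideal.Quotient.nontrivial_iff.mpr h.2
  have h3 : 0 ≤ ringKrullDim (Bring ⧸ Ideal.span (Set.range x)) :=
    ringKrullDim_nonneg_of_nontrivial
  refine le_trans ?_ h1
  simpa using add_le_add_left h3 (n : WithBot ℕ∞)

lemma dim_AR : ringKrullDim AR = 7 := by
  rw [MvPolynomial.ringKrullDim_of_isNoetherianRing, ringKrullDim_eq_zero_of_field]
  simp

lemma dim_le : ringKrullDim Bring ≤ 7 := by
  have : Module.Finite AR Bring := Module.Finite.of_surjective Gmap Gmap_surj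
  rw [← dim_AR]
  refine Order.krullDim_le_of_strictMono (PrimeSpectrum.comap (algebraMap AR Bring)) ?_
  intro P Q hPQ
  have hPQ' : P.asIdeal < Q.asIdeal := hPQ
  obtain ⟨hle, r, hr, hr'⟩ := SetLike.lt_iff_le_and_exists.mp hPQ'
  exact Ideal.comap_lt_comap_of_integral_mem_sdiff hle ⟨hr, hr'⟩ (Algebra.IsIntegral.isIntegral r)

/-- `B` has Krull dimension 7 and depth 7 with respect to `𝔪`: there is a
regular `B`-sequence of length 7 of elements of `𝔪`, and every regular `B`-sequence of
elements of `𝔪` has length at most 7 (so `B` is Cohen–Macaulay). -/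
theorem pfaffianRing_dim_and_depth :
    ringKrullDim Bring = 7 ∧
    (∃ x : Fin 7 → Bring, (∀ i, x i ∈ mIdeal) ∧ IsRegSeq x) ∧
    (∀ (n : ℕ) (x : Fin n → Bring), (∀ i, x i ∈ mIdeal) → IsRegSeq x → n ≤ 7) := by

  have h7 : ringKrullDim Bring = 7 :=
    le_antisymm dim_le (by simpa using isRegSeq_le theta theta_reg)
  refine ⟨h7, ⟨theta, theta_mem, theta_reg⟩, fun n x _ hx => ?_⟩
  have h := isRegSeq_le x hx
  rw [h7] at h
  exact_mod_cast h
end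
end
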